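/- arXiv:1602.05676 — 4 statements merged into one kernel-verified Lean document; each statement's English description precedes it below -/
import Mathlib

section
/- Fix positive integers n, r and a non-negative integer d, and let p_1,…,p_r be polynomials in n variables over ℂ, each of degree at most d in each variable, none identically zero. If M > 1 + r·d + n, then the integral over ℝ^n of (1+‖x‖)^{-M} · ∏_{j=1}^r |log|p_j(x)|| dx is finite. -/
open MeasureTheory
open scoped ENNReal

theorem lintegral_ball_enorm_rpow_neg_ne_top {δ : ℝ} (h1 : δ < 1) :
    ∫⁻ t in Metric.ball (0 : ℝ) 1, ‖t‖ₑ ^ (-δ) ≠ ∞ := by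
  have h : IntegrableOn (fun t : ℝ => ‖t‖ ^ (-δ)) (Metric.ball 0 1) := by
    refine integrableOn_ball_of_norm_le_rpow (C := 1) (α := δ) (by simp) (by simpa using h1) ?_ ?_
    · refine Filter.Eventually.of_forall fun t => ?_
      rw [Real.norm_of_nonneg (by positivity), one_mul]
    · exact (measurable_norm.pow_const _).aestronglyMeasurable
  have h2 := h.lintegral_lt_top
  refine (lt_of_eq_of_lt ?_ h2).ne
  refine lintegral_congr_ae ?_
  refine ae_restrict_of_ae ?_
  filter_upwards [Measure.ae_ne volume (0 : ℝ)] with t ht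
  rw [← ENNReal.ofReal_rpow_of_pos (norm_pos_iff.2 ht), ofReal_norm]

theorem enorm_sub_rpow_neg_le {δ : ℝ} (h0 : 0 < δ) (t c : ℝ) :
    ‖t - c‖ₑ ^ (-δ) ≤ 1 + (Metric.ball (0 : ℝ) 1).indicator (fun s => ‖s‖ₑ ^ (-δ)) (t - c) := by
  by_cases h : t - c ∈ Metric.ball (0 : ℝ) 1
  · rw [Set.indicator_of_mem h]
    exact le_add_self
  · rw [Set.indicator_of_notMem h, add_zero, ENNReal.rpow_neg, ENNReal.inv_le_one]
    refine ENNReal.one_le_rpow ?_ h0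
    rw [mem_ball_zero_iff, not_lt] at h
    rw [← ofReal_norm]
    simpa using ENNReal.ofReal_le_ofReal h

theorem exists_lintegral_mul_enorm_sub_rpow_neg_le {w : ℝ → ℝ≥0∞} (hw : Measurable w)
    (hw1 : ∀ t, w t ≤ 1) (hwi : ∫⁻ t, w t ≠ ∞) {δ : ℝ} (h0 : 0 < δ) (h1 : δ < 1) :
    ∃ C : ℝ≥0∞, C ≠ ∞ ∧ ∀ c : ℝ, ∫⁻ t, w t * ‖t - c‖ₑ ^ (-δ) ≤ C := by
  refine ⟨(∫⁻ t, w t) + ∫⁻ t in Metric.ball (0 : ℝ) 1, ‖t‖ₑ ^ (-δ),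
    ENNReal.add_ne_top.2 ⟨hwi, lintegral_ball_enorm_rpow_neg_ne_top h1⟩, fun c => ?_⟩
  calc ∫⁻ t, w t * ‖t - c‖ₑ ^ (-δ)
      ≤ ∫⁻ t, (w t + (Metric.ball (0 : ℝ) 1).indicator (fun s => ‖s‖ₑ ^ (-δ)) (t - c)) := by
        refine lintegral_mono fun t => ?_
        refine (mul_le_mul_right (enorm_sub_rpow_neg_le h0 t c) _).trans ?_
        rw [mul_add, mul_one]
        gcongr
        exact mul_le_of_le_one_left zero_le (hw1 t)
    _ = _ := by
        rw [lintegral_add_left hw, lintegral_sub_right_eq_self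
          ((Metric.ball (0 : ℝ) 1).indicator fun s => ‖s‖ₑ ^ (-δ)) c,
          lintegral_indicator Metric.isOpen_ball.measurableSet]

theorem Multiset.prod_le_one_add_sum_pow {s : Multiset ℝ≥0∞} {D : ℕ} (hD : D ≠ 0)
    (hs : card s ≤ D) : s.prod ≤ 1 + (s.map (· ^ D)).sum := by
  set S := 1 + (s.map (· ^ D)).sum with hS
  have h1 : (s.map (· ^ D)).prod ≤ S ^ card (s.map (· ^ D)) := by
    refine Multiset.prod_le_pow_card _ _ fun x hx => ?_
    exact (Multiset.single_le_sum (fun _ _ => bot_le) x hx).trans le_add_self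
  rw [Multiset.prod_map_pow, Multiset.map_id', Multiset.card_map] at h1
  refine (ENNReal.pow_le_pow_left_iff hD).1 (h1.trans ?_)
  exact pow_le_pow_right₀ le_self_add hs

theorem enorm_multiset_prod_rpow (s : Multiset ℂ) (z : ℝ) :
    ‖s.prod‖ₑ ^ z = (s.map (fun a => ‖a‖ₑ ^ z)).prod := by
  induction s using Multiset.induction with
  | empty => simp
  | cons a s ih =>
    rw [Multiset.prod_cons, enorm_mul, ENNReal.mul_rpow_of_ne_top (by simp) (by simp), ih,
      Multiset.map_cons, Multiset.prod_cons]

theorem lintegral_mul_multiset_sum_le {α ι : Type*} [MeasurableSpace α] {μ : Measure α}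
    {w : α → ℝ≥0∞} {f : ι → α → ℝ≥0∞} (hw : Measurable w) (hf : ∀ i, Measurable (f i))
    {C : ℝ≥0∞} (h : ∀ i, ∫⁻ a, w a * f i a ∂μ ≤ C) (s : Multiset ι) :
    ∫⁻ a, w a * (s.map (f · a)).sum ∂μ ≤ Multiset.card s * C := by
  induction s using Multiset.induction with
  | empty => simp
  | cons i s ih =>
    simp only [Multiset.map_cons, Multiset.sum_cons, Multiset.card_cons, mul_add]
    rw [lintegral_add_left (by exact hw.mul (hf i)), add_comm]
    push_cast
    rw [add_mul, one_mul]
    exact add_le_add ih (h i)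

theorem Polynomial.exists_lintegral_mul_enorm_eval_rpow_neg_le {w : ℝ → ℝ≥0∞} (hw : Measurable w)
    (hw1 : ∀ t, w t ≤ 1) (hwi : ∫⁻ t, w t ≠ ∞) {d : ℕ} {ε : ℝ} (h0 : 0 < ε)
    (h1 : ε * (d + 1) < 1) :
    ∃ C : ℝ≥0∞, C ≠ ∞ ∧ ∀ (k : ℕ) (P : Polynomial ℂ), k ≤ d → P.natDegree ≤ k →
      ∫⁻ t : ℝ, w t * ‖P.eval (t : ℂ)‖ₑ ^ (-ε) ≤ C * ‖P.coeff k‖ₑ ^ (-ε) := by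
  obtain ⟨C, hC, h⟩ := exists_lintegral_mul_enorm_sub_rpow_neg_le hw hw1 hwi
    (δ := ε * (d + 1)) (by positivity) h1
  refine ⟨(∫⁻ t, w t) + d * C + 1, by finiteness, fun k P hk hP => ?_⟩
  by_cases ha : P.coeff k = 0
  · simp [ha, h0, ENNReal.mul_top]
  have hkP : P.natDegree = k := Polynomial.natDegree_eq_of_le_of_coeff_ne_zero hP ha
  have hsp := IsAlgClosed.splits P
  have hcard : Multiset.card P.roots ≤ d := (P.card_roots'.trans hP).trans hk
  have key (t : ℝ) : ‖P.eval (t : ℂ)‖ₑ ^ (-ε) ≤ ‖P.coeff k‖ₑ ^ (-ε) *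
      (1 + (P.roots.map (fun z => ‖t - z.re‖ₑ ^ (-(ε * (d + 1))))).sum) := by
    rw [hsp.eval_eq_prod_roots, enorm_mul, ENNReal.mul_rpow_of_ne_top (by simp) (by simp),
      Polynomial.leadingCoeff, hkP, enorm_multiset_prod_rpow]
    gcongr
    refine (Multiset.prod_le_one_add_sum_pow (D := d + 1) (by simp) (by simp; lia)).trans ?_
    gcongr
    simp only [Multiset.map_map, Function.comp_def]
    refine Multiset.sum_map_le_sum_map _ _ fun z _ => ?_
    rw [← ENNReal.rpow_natCast, ← ENNReal.rpow_mul, ENNReal.rpow_neg]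
    push_cast
    rw [neg_mul, ENNReal.rpow_neg, ENNReal.inv_le_inv]
    refine ENNReal.rpow_le_rpow ?_ (by positivity)
    rw [← ofReal_norm, ← ofReal_norm]
    refine ENNReal.ofReal_le_ofReal ?_
    simpa using Complex.abs_re_le_norm ((t : ℂ) - z)
  calc ∫⁻ t : ℝ, w t * ‖P.eval (t : ℂ)‖ₑ ^ (-ε)
      ≤ ∫⁻ t : ℝ, ‖P.coeff k‖ₑ ^ (-ε) *
        (w t + w t * (P.roots.map (fun z => ‖t - z.re‖ₑ ^ (-(ε * (d + 1))))).sum) := by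
        refine lintegral_mono fun t => (mul_le_mul_right (key t) _).trans_eq ?_
        ring
    _ ≤ _ := by
        rw [lintegral_const_mul' _ _ (by simp [ENNReal.rpow_eq_top_iff, ha]), mul_comm,
          lintegral_add_left hw]
        refine mul_le_mul_left (le_trans ?_ le_self_add) _
        refine add_le_add_right ?_ _
        refine (lintegral_mul_multiset_sum_le hw (fun z => by fun_prop)
          (fun z : ℂ => h z.re) P.roots).trans ?_
        exact mul_le_mul_left (by exact_mod_cast hcard) _

theorem MvPolynomial.lintegral_prod_mul_enorm_eval_rpow_neg_ne_top {w : ℝ → ℝ≥0∞}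
    (hw : Measurable w) (hw1 : ∀ t, w t ≤ 1) (hwi : ∫⁻ t, w t ≠ ∞)
    {d : ℕ} {ε : ℝ} (h0 : 0 < ε) (h1 : ε * (d + 1) < 1) {n : ℕ} (p : MvPolynomial (Fin n) ℂ)
    (hp : p ≠ 0) (hd : ∀ i, p.degreeOf i ≤ d) :
    ∫⁻ x : Fin n → ℝ, (∏ i, w (x i)) *
      ‖MvPolynomial.eval (fun i => (x i : ℂ)) p‖ₑ ^ (-ε) ≠ ∞ := by
  obtain ⟨C, hC, h⟩ := Polynomial.exists_lintegral_mul_enorm_eval_rpow_neg_le hw hw1 hwi h0 h1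
  induction n with
  | zero =>
    obtain ⟨a, rfl⟩ := MvPolynomial.C_surjective (Fin 0) p
    have ha : a ≠ 0 := by rintro rfl; simp at hp
    simp only [Finset.univ_eq_empty, Finset.prod_empty, MvPolynomial.eval_C, one_mul,
      lintegral_const]
    refine ENNReal.mul_ne_top (by simp [ENNReal.rpow_eq_top_iff, ha]) ?_
    rw [volume_pi, Measure.pi_univ]
    simp
  | succ n ih =>
    set P := MvPolynomial.finSuccEquiv ℂ n p with hP
    set k := P.natDegree with hk
    have hk' : k ≤ d := by
      rw [hk, hP, MvPolynomial.natDegree_finSuccEquiv]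
      exact hd 0
    have hP0 : P.leadingCoeff ≠ 0 := by simpa [hP] using hp
    have ih := ih P.leadingCoeff hP0 fun j =>
      (MvPolynomial.degreeOf_coeff_finSuccEquiv p j _).trans (hd _)
    rw [← (volume_preserving_piFinSuccAbove (fun _ : Fin (n + 1) => ℝ) 0).symm.lintegral_comp_emb
      (MeasurableEquiv.measurableEmbedding _)]
    have hmeas (q : MvPolynomial (Fin (n + 1)) ℂ) : Measurable fun x : Fin (n + 1) → ℝ =>
        MvPolynomial.eval (fun i => (x i : ℂ)) q := by
      refine Continuous.measurable ?_
      exact (MvPolynomial.continuous_eval q).comp (by fun_prop)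
    rw [Measure.volume_eq_prod, lintegral_prod_symm' _ (by
      have := hmeas p
      refine Measurable.comp (g := fun x : Fin (n + 1) → ℝ => (∏ i, w (x i)) *
        ‖MvPolynomial.eval (fun i => (x i : ℂ)) p‖ₑ ^ (-ε)) ?_ (MeasurableEquiv.measurable _)
      fun_prop)]
    refine ((lintegral_mono fun y => ?_).trans_lt
      (lt_of_eq_of_lt (lintegral_const_mul' C _ hC) (ENNReal.mul_lt_top hC.lt_top ih.lt_top))).ne
    simp only [MeasurableEquiv.piFinSuccAbove_symm_apply, Fin.insertNthEquiv_zero,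
      Fin.consEquiv_apply, Fin.prod_univ_succ, Fin.cons_zero, Fin.cons_succ]
    have hcons (t : ℝ) : (fun i => ((Fin.cons (α := fun _ => ℝ) t y i : ℝ) : ℂ)) =
        Fin.cons (α := fun _ => ℂ) (t : ℂ) (fun i => (y i : ℂ)) := by
      ext i
      refine Fin.cases ?_ (fun j => ?_) i <;> simp
    simp only [hcons, MvPolynomial.eval_eq_eval_mv_eval', ← hP]
    have hprod : ∏ i, w (y i) ≠ ∞ :=
      ENNReal.prod_ne_top fun i _ => ((hw1 _).trans_lt ENNReal.one_lt_top).ne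
    calc _ = ∫⁻ t : ℝ, (∏ i, w (y i)) * (w t * ‖Polynomial.eval (t : ℂ)
            (Polynomial.map (MvPolynomial.eval fun i => (y i : ℂ)) P)‖ₑ ^ (-ε)) :=
          lintegral_congr fun t => by ring
      _ ≤ (∏ i, w (y i)) * (C * ‖(Polynomial.map (MvPolynomial.eval fun i => (y i : ℂ)) P).coeff
            k‖ₑ ^ (-ε)) := by
          rw [lintegral_const_mul' _ _ hprod]
          gcongr
          exact h k _ hk' Polynomial.natDegree_map_le
      _ = _ := by
          rw [Polynomial.coeff_map]
          simp only [Polynomial.leadingCoeff, ← hk]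
          ring


theorem exists_abs_log_pow_le {r : ℕ} (hr : r ≠ 0) {ε : ℝ} (hε : 0 < ε) :
    ∃ K : ℝ, 0 ≤ K ∧ ∀ t : ℝ, 0 ≤ t → |Real.log t| ^ r ≤ K * (t ^ (-ε) + t ^ ε) := by
  have hr' : (r : ℝ) ≠ 0 := by exact_mod_cast hr
  have hη : 0 < ε / r := by positivity
  refine ⟨((ε / r)⁻¹) ^ r, by positivity, fun t ht => ?_⟩
  have key (s : ℝ) (hs : 1 ≤ s) : |Real.log s| ^ r ≤ ((ε / r)⁻¹) ^ r * s ^ ε := by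
    have h1 := Real.log_le_rpow_div (zero_le_one.trans hs) hη
    rw [abs_of_nonneg (Real.log_nonneg hs)]
    refine (pow_le_pow_left₀ (Real.log_nonneg hs) h1 r).trans_eq ?_
    rw [div_eq_inv_mul, mul_pow, ← Real.rpow_mul_natCast (zero_le_one.trans hs),
      div_mul_cancel₀ _ hr']
  rcases ht.eq_or_lt with rfl | ht
  · rw [Real.log_zero, abs_zero, zero_pow hr]
    positivity
  rcases le_total 1 t with h | h
  · refine (key t h).trans ?_
    gcongr
    exact le_add_of_nonneg_left (by positivity)
  · have := key t⁻¹ ((one_le_inv₀ ht).2 h)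
    rw [Real.log_inv, abs_neg, Real.inv_rpow ht.le, ← Real.rpow_neg ht.le] at this
    refine this.trans ?_
    gcongr
    exact le_add_of_nonneg_right (by positivity)

theorem MvPolynomial.exists_norm_eval_le {n : ℕ} (p : MvPolynomial (Fin n) ℂ) :
    ∃ K : ℝ, 0 ≤ K ∧ ∀ x : EuclideanSpace ℝ (Fin n),
      ‖MvPolynomial.eval (fun i => (x i : ℂ)) p‖ ≤ K * (1 + ‖x‖) ^ p.totalDegree := by
  refine ⟨∑ m ∈ p.support, ‖p.coeff m‖, by positivity, fun x => ?_⟩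
  rw [MvPolynomial.eval_eq, Finset.sum_mul]
  refine (norm_sum_le _ _).trans (Finset.sum_le_sum fun m hm => ?_)
  rw [norm_mul, norm_prod]
  gcongr
  calc ∏ i ∈ m.support, ‖((x i : ℂ)) ^ m i‖ ≤ ∏ i ∈ m.support, (1 + ‖x‖) ^ m i := by
        refine Finset.prod_le_prod (fun _ _ => norm_nonneg _) fun i _ => ?_
        rw [norm_pow, Complex.norm_real]
        gcongr
        exact (PiLp.norm_apply_le x i).trans (by linarith)
    _ = (1 + ‖x‖) ^ (m.sum fun _ e => e) := by rw [Finset.prod_pow_eq_pow_sum]; rfl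
    _ ≤ _ := pow_le_pow_right₀ (by linarith [norm_nonneg x]) (MvPolynomial.le_totalDegree hm)

theorem MvPolynomial.measurable_eval_ofReal {n : ℕ} (p : MvPolynomial (Fin n) ℂ) :
    Measurable fun x : EuclideanSpace ℝ (Fin n) => MvPolynomial.eval (fun i => (x i : ℂ)) p :=
  ((MvPolynomial.continuous_eval p).comp (by fun_prop)).measurable

theorem MvPolynomial.integrable_mul_norm_eval_rpow {n : ℕ} (p : MvPolynomial (Fin n) ℂ)
    {ε M : ℝ} (h0 : 0 ≤ ε) (hM : n < M - p.totalDegree * ε) :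
    Integrable fun x : EuclideanSpace ℝ (Fin n) =>
      (1 + ‖x‖) ^ (-M) * ‖MvPolynomial.eval (fun i => (x i : ℂ)) p‖ ^ ε := by
  obtain ⟨K, hK, h⟩ := p.exists_norm_eval_le
  have := p.measurable_eval_ofReal
  refine ((integrable_one_add_norm (E := EuclideanSpace ℝ (Fin n)) (μ := volume)
    (r := M - p.totalDegree * ε) (by simpa using hM)).const_mul (K ^ ε)).mono'
    (by fun_prop) (Filter.Eventually.of_forall fun x => ?_)
  rw [Real.norm_of_nonneg (by positivity)]
  have hx : 0 < 1 + ‖x‖ := by positivity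
  calc (1 + ‖x‖) ^ (-M) * ‖MvPolynomial.eval (fun i => (x i : ℂ)) p‖ ^ ε
      ≤ (1 + ‖x‖) ^ (-M) * (K * (1 + ‖x‖) ^ p.totalDegree) ^ ε := by
        gcongr
        exact h x
    _ = _ := by
        rw [Real.mul_rpow hK (by positivity), ← Real.rpow_natCast_mul hx.le, neg_sub, sub_eq_add_neg,
          Real.rpow_add hx]
        ring

theorem EuclideanSpace.one_add_norm_rpow_neg_le {n : ℕ} (hn : n ≠ 0) {M : ℝ} (hM : 0 ≤ M)
    (x : EuclideanSpace ℝ (Fin n)) :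
    (1 + ‖x‖) ^ (-M) ≤ ∏ i, (1 + ‖x i‖) ^ (-(M / n)) := by
  have hn' : (n : ℝ) ≠ 0 := by exact_mod_cast hn
  calc (1 + ‖x‖) ^ (-M) = ∏ i : Fin n, (1 + ‖x‖) ^ (-(M / n)) := by
        rw [Finset.prod_const, Finset.card_univ, Fintype.card_fin,
          ← Real.rpow_mul_natCast (by positivity), neg_mul, div_mul_cancel₀ _ hn']
    _ ≤ _ := by
        refine Finset.prod_le_prod (fun _ _ => by positivity) fun i _ => ?_
        refine Real.rpow_le_rpow_of_nonpos (by positivity) ?_ (neg_nonpos.2 (by positivity))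
        gcongr
        exact PiLp.norm_apply_le x i

theorem MvPolynomial.integrable_mul_norm_eval_rpow_neg {n : ℕ} (hn : n ≠ 0)
    {p : MvPolynomial (Fin n) ℂ} (hp : p ≠ 0) {d : ℕ} (hd : ∀ i, p.degreeOf i ≤ d)
    {ε M : ℝ} (h0 : 0 < ε) (h1 : ε * (d + 1) < 1) (hM : n < M) :
    Integrable fun x : EuclideanSpace ℝ (Fin n) =>
      (1 + ‖x‖) ^ (-M) * ‖MvPolynomial.eval (fun i => (x i : ℂ)) p‖ ^ (-ε) := by
  have hn' : (0 : ℝ) < n := by exact_mod_cast Nat.pos_of_ne_zero hn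
  have := p.measurable_eval_ofReal
  refine ⟨by fun_prop, ?_⟩
  set w : ℝ → ℝ≥0∞ := fun t => ENNReal.ofReal ((1 + ‖t‖) ^ (-(M / n)))
  have hMn : 1 < M / n := (one_lt_div hn').2 hM
  have hw1 (t : ℝ) : w t ≤ 1 := ENNReal.ofReal_le_one.2
    (Real.rpow_le_one_of_one_le_of_nonpos (by linarith [norm_nonneg t]) (by linarith))
  have hwi : ∫⁻ t, w t ≠ ∞ := (finite_integral_one_add_norm (by simpa using hMn)).ne
  have key := p.lintegral_prod_mul_enorm_eval_rpow_neg_ne_top (by fun_prop) hw1 hwi h0 h1 hp hd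
  rw [← (EuclideanSpace.volume_preserving_symm_measurableEquiv_toLp (Fin n)).lintegral_comp_emb
    (MeasurableEquiv.measurableEmbedding _)] at key
  refine lt_of_le_of_lt (lintegral_mono fun x => ?_) key.lt_top
  rw [enorm_mul]
  refine mul_le_mul' ?_ ?_
  · rw [Real.enorm_of_nonneg (by positivity)]
    refine (ENNReal.ofReal_le_ofReal
      (EuclideanSpace.one_add_norm_rpow_neg_le hn (hn'.trans hM).le x)).trans_eq ?_
    rw [ENNReal.ofReal_prod_of_nonneg fun _ _ => by positivity]
    rfl
  · change _ ≤ ‖MvPolynomial.eval (fun i => (x i : ℂ)) p‖ₑ ^ (-ε)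
    by_cases hz : MvPolynomial.eval (fun i => (x i : ℂ)) p = 0
    · simp [hz, h0]
    · rw [Real.enorm_of_nonneg (by positivity), ← ENNReal.ofReal_rpow_of_pos (norm_pos_iff.2 hz),
        ofReal_norm]

theorem MvPolynomial.integrable_mul_abs_log_norm_eval_pow {n : ℕ} (hn : n ≠ 0)
    {p : MvPolynomial (Fin n) ℂ} (hp : p ≠ 0) {M : ℝ} (hM : n < M) {r : ℕ} (hr : r ≠ 0) :
    Integrable fun x : EuclideanSpace ℝ (Fin n) =>
      (1 + ‖x‖) ^ (-M) * |Real.log ‖MvPolynomial.eval (fun i => (x i : ℂ)) p‖| ^ r := by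
  set D : ℝ := (p.totalDegree : ℝ)
  have hD0 : 0 ≤ D := by positivity
  obtain ⟨ε, h0, h1, h2⟩ : ∃ ε : ℝ, 0 < ε ∧ ε * (D + 1) < 1 ∧ n < M - D * ε := by
    have hδ : 0 < min 1 (M - n) / 2 := by
      have := lt_min one_pos (sub_pos.2 hM)
      positivity
    refine ⟨min 1 (M - n) / 2 / (D + 1), by positivity, ?_, ?_⟩
    · rw [div_mul_cancel₀ _ (by positivity)]
      linarith [min_le_left 1 (M - n)]
    · have : D * (min 1 (M - n) / 2 / (D + 1)) ≤ min 1 (M - n) / 2 := by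
        rw [mul_div_left_comm]
        exact mul_le_of_le_one_right hδ.le ((div_le_one (by positivity)).2 (by linarith))
      linarith [min_le_right 1 (M - n)]
  obtain ⟨K, hK, hlog⟩ := exists_abs_log_pow_le hr h0
  have := p.measurable_eval_ofReal
  refine (((integrable_mul_norm_eval_rpow_neg hn hp (p.degreeOf_le_totalDegree ·) h0 h1 hM).add
    (p.integrable_mul_norm_eval_rpow h0.le h2)).const_mul K).mono'
    (Measurable.aestronglyMeasurable ?_) (Filter.Eventually.of_forall fun x => ?_)
  · have := Real.measurable_log.comp this.norm
    exact Measurable.mul (by fun_prop) ((measurable_norm.comp this).pow_const r)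
  · rw [Real.norm_of_nonneg (by positivity)]
    refine (mul_le_mul_of_nonneg_left (hlog _ (norm_nonneg _)) (by positivity)).trans_eq ?_
    simp only [Pi.add_apply]
    ring

theorem Finset.prod_le_sum_pow_card {ι : Type*} {s : Finset ι} (hs : s.Nonempty) {f : ι → ℝ}
    (hf : ∀ i ∈ s, 0 ≤ f i) : ∏ i ∈ s, f i ≤ ∑ i ∈ s, f i ^ s.card := by
  obtain ⟨j, hj, hmax⟩ := s.exists_max_image f hs
  calc ∏ i ∈ s, f i ≤ ∏ _i ∈ s, f j := Finset.prod_le_prod hf hmax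
    _ = f j ^ s.card := Finset.prod_const _
    _ ≤ _ := Finset.single_le_sum (f := fun i => f i ^ s.card)
      (fun i hi => pow_nonneg (hf i hi) _) hj

/-- Let `p_1,…,p_r` be nonzero polynomials in `n` variables over `ℂ`, each of degree at most
`d` in each variable.  If `M > 1 + r·d + n` then
`∫_{ℝ^n} (1+‖x‖)^{-M} · ∏_{j=1}^r |log|p_j(x)|| dx < ∞`. -/
theorem statement2 (n r : ℕ) (hn : 0 < n) (hr : 0 < r) (d : ℕ)
    (p : Fin r → MvPolynomial (Fin n) ℂ) (hp : ∀ j, p j ≠ 0)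
    (hd : ∀ j i, (p j).degreeOf i ≤ d)
    (M : ℝ) (hM : 1 + (r : ℝ) * d + n < M) :
    Integrable (fun x : EuclideanSpace ℝ (Fin n) =>
      (1 + ‖x‖) ^ (-M) *
        ∏ j, |Real.log ‖MvPolynomial.eval (fun i => ((x i : ℝ) : ℂ)) (p j)‖|) := by
  have hnM : (n : ℝ) < M := by
    have : (0 : ℝ) ≤ r * d := by positivity
    linarith
  have hmeas (j : Fin r) := (p j).measurable_eval_ofReal
  refine (integrable_finsetSum Finset.univ fun j _ =>
    (p j).integrable_mul_abs_log_norm_eval_pow hn.ne' (hp j) hnM hr.ne').mono'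
    (Measurable.aestronglyMeasurable ?_) (Filter.Eventually.of_forall fun x => ?_)
  · refine Measurable.mul (by fun_prop) (Finset.measurable_prod _ fun j _ => ?_)
    exact measurable_norm.comp (Real.measurable_log.comp (hmeas j).norm)
  · rw [Real.norm_of_nonneg (by positivity), ← Finset.mul_sum]
    have : Nonempty (Fin r) := ⟨⟨0, hr⟩⟩
    gcongr
    simpa using Finset.prod_le_sum_pow_card Finset.univ_nonempty
      (f := fun j => |Real.log ‖MvPolynomial.eval (fun i => (x i : ℂ)) (p j)‖|)
      fun _ _ => abs_nonneg _
end

section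
/- The index of the principal congruence subgroup Γ_n(N) in Γ_n(1) = Sp(n,ℤ) equals N^{n(2n+1)} · ∏_{p prime, p | N} ∏_{l=1}^{n} (1 - p^{-2l}). -/
open Matrix

/-- The principal congruence subgroup `Γ_n(N)` of `Sp(n,ℤ)`: symplectic integral matrices
congruent to the identity modulo `N`, realized as the preimage of `1` under reduction
modulo `N`. -/
def GammaSp (n N : ℕ) : Subgroup (Matrix.symplecticGroup (Fin n) ℤ) where
  carrier := {γ | (Int.castRingHom (ZMod N)).mapMatrix (γ : Matrix (Fin n ⊕ Fin n) (Fin n ⊕ Fin n) ℤ) = 1}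
  one_mem' := by
    simp [Set.mem_setOf_eq]
  mul_mem' := by
    intro a b ha hb
    simp only [Set.mem_setOf_eq, Submonoid.coe_mul, _root_.map_mul] at *
    rw [ha, hb, one_mul]
  inv_mem' := by
    intro a ha
    simp only [Set.mem_setOf_eq] at *
    have h1 : (↑(a * a⁻¹) : Matrix (Fin n ⊕ Fin n) (Fin n ⊕ Fin n) ℤ) =
        (↑(1 : Matrix.symplecticGroup (Fin n) ℤ) : Matrix (Fin n ⊕ Fin n) (Fin n ⊕ Fin n) ℤ) := by
      rw [mul_inv_cancel]
    rw [Submonoid.coe_mul, OneMemClass.coe_one] at h1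
    have h2 := congrArg ((Int.castRingHom (ZMod N)).mapMatrix :
      Matrix (Fin n ⊕ Fin n) (Fin n ⊕ Fin n) ℤ →+* Matrix (Fin n ⊕ Fin n) (Fin n ⊕ Fin n) (ZMod N)) h1
    rw [_root_.map_mul, _root_.map_one, ha, one_mul] at h2
    exact h2

section Form

variable {l R : Type*} [DecidableEq l] [Fintype l] [CommRing R]

/-- The standard alternating form `x ↦ y ↦ x ⬝ᵥ J *ᵥ y`. -/
noncomputable abbrev sympForm (l R : Type*) [DecidableEq l] [Fintype l] [CommRing R] :
    LinearMap.BilinForm R (l ⊕ l → R) :=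
  Matrix.toLinearMap₂' R (J l R)

theorem sympForm_apply (x y : l ⊕ l → R) : sympForm l R x y = x ⬝ᵥ J l R *ᵥ y :=
  Matrix.toLinearMap₂'_apply' _ _ _

theorem sympForm_self (x : l ⊕ l → R) : sympForm l R x x = 0 := by
  rw [sympForm_apply, J, Matrix.fromBlocks_mulVec, dotProduct]
  simp [Fintype.sum_sum_type, Matrix.neg_mulVec, mul_comm]

theorem sympForm_swap (x y : l ⊕ l → R) : sympForm l R x y = -sympForm l R y x :=
  (LinearMap.IsAlt.neg (B := sympForm l R) sympForm_self y x).symm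

theorem sympForm_mulVec {M : Matrix (l ⊕ l) (l ⊕ l) R} (hM : M ∈ symplecticGroup l R)
    (x y : l ⊕ l → R) : sympForm l R (M *ᵥ x) (M *ᵥ y) = sympForm l R x y := by
  rw [SymplecticGroup.mem_iff'] at hM
  simp only [sympForm_apply]
  conv_rhs => rw [← hM]
  simp only [← Matrix.mulVec_mulVec, Matrix.dotProduct_mulVec, Matrix.vecMul_transpose]

theorem mem_symplecticGroup_of_sympForm {M : Matrix (l ⊕ l) (l ⊕ l) R}
    (hM : ∀ x y, sympForm l R (M *ᵥ x) (M *ᵥ y) = sympForm l R x y) :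
    M ∈ symplecticGroup l R := by
  rw [SymplecticGroup.mem_iff']
  apply (Matrix.toLinearMap₂' (n := l ⊕ l) (m := l ⊕ l) (S₁ := R) (S₂ := R) (N₂ := R) R).injective
  refine LinearMap.ext fun x => LinearMap.ext fun y => ?_
  rw [← hM x y]
  simp only [Matrix.toLinearMap₂'_apply', ← Matrix.mulVec_mulVec, Matrix.dotProduct_mulVec,
    Matrix.vecMul_transpose]

/-- The symplectic transvection `x ↦ x + c • ω(u, x) • u`. -/
def sympTransvection (u : l ⊕ l → R) (c : R) : Matrix (l ⊕ l) (l ⊕ l) R :=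
  1 + c • vecMulVec u (u ᵥ* J l R)

theorem sympTransvection_mulVec (u : l ⊕ l → R) (c : R) (x : l ⊕ l → R) :
    sympTransvection u c *ᵥ x = x + (c * sympForm l R u x) • u := by
  rw [sympTransvection, Matrix.add_mulVec, Matrix.one_mulVec, Matrix.smul_mulVec,
    Matrix.vecMulVec_mulVec, ← Matrix.dotProduct_mulVec, ← sympForm_apply, mul_smul]
  simp

theorem sympTransvection_mem (u : l ⊕ l → R) (c : R) :
    sympTransvection u c ∈ symplecticGroup l R := by
  refine mem_symplecticGroup_of_sympForm fun x y => ?_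
  simp only [sympTransvection_mulVec, map_add, map_smul, LinearMap.add_apply,
    LinearMap.smul_apply, smul_eq_mul, sympForm_self]
  rw [sympForm_swap x u]
  ring

theorem sympTransvection_map {S : Type*} [CommRing S] (f : R →+* S) (u : l ⊕ l → R) (c : R) :
    (sympTransvection u c).map f = sympTransvection (f ∘ u) (f c) := by
  have h : f ∘ (u ᵥ* J l R) = (f ∘ u) ᵥ* J l S := by
    ext i
    rw [Function.comp_apply, RingHom.map_vecMul, ← map_J l f]
  ext i j
  have hj := congrFun h j
  simp only [Function.comp_apply] at hj
  simp only [sympTransvection, Matrix.map_apply, Matrix.add_apply, Matrix.smul_apply,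
    vecMulVec_apply, smul_eq_mul, map_add, map_mul, hj, Matrix.one_apply, Function.comp_apply]
  split_ifs <;> simp

/-- Entrywise base change of symplectic matrices. -/
def sympMap (l : Type*) [DecidableEq l] [Fintype l] {R S : Type*} [CommRing R] [CommRing S]
    (f : R →+* S) : symplecticGroup l R →* symplecticGroup l S where
  toFun M := ⟨(M : Matrix (l ⊕ l) (l ⊕ l) R).map f, SymplecticGroup.map_mem M.2 f⟩
  map_one' := Subtype.ext (Matrix.map_one f f.map_zero f.map_one)
  map_mul' _ _ := Subtype.ext Matrix.map_mul

end Form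

section Transitive

variable {l R : Type*} [DecidableEq l] [Fintype l] [CommRing R]
  {S : Subgroup (symplecticGroup l R)}

theorem exists_mem_mulVec_eq_of_isUnit
    (hS : ∀ u c, ⟨sympTransvection u c, sympTransvection_mem u c⟩ ∈ S)
    {v e : l ⊕ l → R} (h : IsUnit (sympForm l R v e)) :
    ∃ g ∈ S, ∀ x, g.1 *ᵥ v = e ∧
      (sympForm l R v x = sympForm l R e x → g.1 *ᵥ x = x) := by
  obtain ⟨c, hc⟩ := h.exists_left_inv
  refine ⟨_, hS (e - v) (-c), fun x => ⟨?_, fun hx => ?_⟩⟩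
  · have : -c * sympForm l R (e - v) v = 1 := by
      rw [map_sub, LinearMap.sub_apply, sympForm_self, sympForm_swap e v, ← hc]
      ring
    rw [sympTransvection_mulVec, this, one_smul, add_sub_cancel]
  · simp [sympTransvection_mulVec, hx]

theorem exists_mem_mulVec_eq (hR : ∀ x y : R, IsCoprime x y → ∃ t, IsUnit (x + t * y))
    (hS : ∀ u c, ⟨sympTransvection u c, sympTransvection_mem u c⟩ ∈ S)
    {v y e f : l ⊕ l → R} (hv : sympForm l R v y = 1) (he : sympForm l R e f = 1) :
    ∃ g ∈ S, g.1 *ᵥ v = e := by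
  set α := sympForm l R v f with hα
  set β := sympForm l R y e with hβ
  obtain ⟨a, ha⟩ := hR (-α) (1 + α * β) ⟨β, 1, by ring⟩
  set z := a • y + (a * β - 1) • f with hz
  have hvz : sympForm l R v z = -α + a * (1 + α * β) := by
    simp only [hz, map_add, map_smul, smul_eq_mul, hv, ← hα]
    ring
  have hze : sympForm l R z e = 1 := by
    simp only [hz, map_add, map_smul, LinearMap.add_apply, LinearMap.smul_apply, smul_eq_mul,
      ← hβ, sympForm_swap f e, he]
    ring
  obtain ⟨g₁, hg₁, h₁⟩ := exists_mem_mulVec_eq_of_isUnit hS (v := v) (e := z) (hvz ▸ ha)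
  obtain ⟨g₂, hg₂, h₂⟩ := exists_mem_mulVec_eq_of_isUnit hS (v := z) (e := e)
    (hze ▸ isUnit_one)
  refine ⟨g₂ * g₁, mul_mem hg₂ hg₁, ?_⟩
  rw [Submonoid.coe_mul, ← Matrix.mulVec_mulVec, (h₁ 0).1, (h₂ 0).1]

theorem exists_mem_mulVec_eq_and_fix
    (hS : ∀ u c, ⟨sympTransvection u c, sympTransvection_mem u c⟩ ∈ S)
    {w e f : l ⊕ l → R} (hw : sympForm l R e w = 1) (he : sympForm l R e f = 1) :
    ∃ g ∈ S, g.1 *ᵥ e = e ∧ g.1 *ᵥ w = f := by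
  set c := 1 - sympForm l R w f with hc
  have h : sympForm l R (w + c • e) f = 1 := by
    simp only [map_add, map_smul, LinearMap.add_apply, LinearMap.smul_apply, smul_eq_mul, he, hc]
    ring
  obtain ⟨g, hg, hgx⟩ := exists_mem_mulVec_eq_of_isUnit hS (h ▸ isUnit_one)
  refine ⟨_, mul_mem hg (hS e c), ?_, ?_⟩
  · rw [Submonoid.coe_mul, ← Matrix.mulVec_mulVec]
    simp only [sympTransvection_mulVec, sympForm_self, mul_zero, zero_smul, add_zero]
    apply (hgx e).2
    rw [sympForm_swap f e, he, sympForm_swap _ e, map_add, map_smul, hw, sympForm_self]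
    simp
  · rw [Submonoid.coe_mul, ← Matrix.mulVec_mulVec]
    simp only [sympTransvection_mulVec, hw, mul_one]
    exact (hgx 0).1

/-- A subgroup of the symplectic group containing all transvections acts transitively on
hyperbolic pairs. -/
theorem exists_mem_mulVec_pair_eq (hR : ∀ x y : R, IsCoprime x y → ∃ t, IsUnit (x + t * y))
    (hS : ∀ u c, ⟨sympTransvection u c, sympTransvection_mem u c⟩ ∈ S)
    {v w e f : l ⊕ l → R} (hv : sympForm l R v w = 1) (he : sympForm l R e f = 1) :
    ∃ g ∈ S, g.1 *ᵥ v = e ∧ g.1 *ᵥ w = f := by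
  obtain ⟨g, hg, hgv⟩ := exists_mem_mulVec_eq hR hS hv he
  have hgw : sympForm l R e (g.1 *ᵥ w) = 1 := by
    rw [← hgv, sympForm_mulVec g.2, hv]
  obtain ⟨k, hk, hke, hkw⟩ := exists_mem_mulVec_eq_and_fix hS hgw he
  refine ⟨k * g, mul_mem hk hg, ?_, ?_⟩ <;>
    simp only [Submonoid.coe_mul, ← Matrix.mulVec_mulVec, hgv, hke, hkw]

end Transitive

section Extend

variable {l m R : Type*} [DecidableEq l] [Fintype l] [DecidableEq m] [Fintype m] [CommRing R]

/-- The bijection of indices splitting off one hyperbolic plane. -/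
def splitEquiv (σ : l ≃ m ⊕ Unit) : l ⊕ l ≃ (m ⊕ m) ⊕ (Unit ⊕ Unit) :=
  (σ.sumCongr σ).trans (Equiv.sumSumSumComm m Unit m Unit)

omit [Fintype l] [Fintype m] in
theorem J_eq_submatrix (σ : l ≃ m ⊕ Unit) :
    J l R = (fromBlocks (J m R) 0 0 (J Unit R)).submatrix (splitEquiv σ) (splitEquiv σ) := by
  ext i j
  obtain ⟨i, rfl⟩ := (σ.sumCongr σ).symm.surjective i
  obtain ⟨j, rfl⟩ := (σ.sumCongr σ).symm.surjective j
  rcases i with (i | i) | (i | i) <;> rcases j with (j | j) | (j | j) <;>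
    simp [J, splitEquiv, Matrix.one_apply]

theorem fromBlocks_submatrix_mem (σ : l ≃ m ⊕ Unit) {M : Matrix (m ⊕ m) (m ⊕ m) R}
    (hM : M ∈ symplecticGroup m R) :
    (fromBlocks M 0 0 1).submatrix (splitEquiv σ) (splitEquiv σ) ∈ symplecticGroup l R := by
  rw [SymplecticGroup.mem_iff] at hM ⊢
  rw [J_eq_submatrix σ, Matrix.transpose_submatrix, Matrix.submatrix_mul_equiv,
    Matrix.submatrix_mul_equiv]
  simp [fromBlocks_transpose, fromBlocks_multiply, hM]

/-- The embedding of symplectic groups acting trivially on a hyperbolic plane. -/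
def sympExtend (R : Type*) [CommRing R] (σ : l ≃ m ⊕ Unit) :
    symplecticGroup m R →* symplecticGroup l R where
  toFun M := ⟨_, fromBlocks_submatrix_mem σ M.2⟩
  map_one' := Subtype.ext (by simp)
  map_mul' M N := Subtype.ext (by
    simp only [Submonoid.coe_mul]
    rw [Matrix.submatrix_mul_equiv]
    simp [fromBlocks_multiply])

theorem sympExtend_injective (σ : l ≃ m ⊕ Unit) : Function.Injective (sympExtend R σ) := by
  intro M N h
  have h' := congrArg (fun A => (A.1.submatrix (splitEquiv σ).symm (splitEquiv σ).symm)) h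
  simp only [sympExtend, MonoidHom.coe_mk, OneHom.coe_mk, Matrix.submatrix_submatrix,
    Equiv.self_comp_symm, Matrix.submatrix_id_id, Matrix.fromBlocks_inj] at h'
  exact Subtype.ext h'.1

theorem sympMap_sympExtend {S : Type*} [CommRing S] (f : R →+* S) (σ : l ≃ m ⊕ Unit)
    (M : symplecticGroup m R) :
    sympMap l f (sympExtend R σ M) = sympExtend S σ (sympMap m f M) := by
  apply Subtype.ext
  simp only [sympMap, sympExtend, MonoidHom.coe_mk, OneHom.coe_mk]
  rw [← Matrix.submatrix_map, Matrix.fromBlocks_map, Matrix.map_zero _ f.map_zero,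
    Matrix.map_zero _ f.map_zero, Matrix.map_one _ f.map_zero f.map_one]

/-- The index of a basis vector of the split hyperbolic plane. -/
def planeIndex (σ : l ≃ m ⊕ Unit) (i : Unit ⊕ Unit) : l ⊕ l := (splitEquiv σ).symm (Sum.inr i)

omit [Fintype m] in
theorem sympForm_planeIndex (σ : l ≃ m ⊕ Unit) :
    sympForm l R (Pi.single (planeIndex σ (Sum.inr ())) 1)
      (Pi.single (planeIndex σ (Sum.inl ())) 1) = 1 := by
  rw [sympForm_apply, Matrix.mulVec_single_one, single_one_dotProduct, J_eq_submatrix σ]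
  simp [planeIndex, J]

theorem sympExtend_mulVec_single (σ : l ≃ m ⊕ Unit) (M : symplecticGroup m R) (i : Unit ⊕ Unit) :
    (sympExtend R σ M).1 *ᵥ Pi.single (planeIndex σ i) 1 = Pi.single (planeIndex σ i) 1 := by
  rw [Matrix.mulVec_single_one]
  ext j
  obtain ⟨j, rfl⟩ := (splitEquiv σ).symm.surjective j
  rcases j with j | j
  · simp [sympExtend, planeIndex]
  · simp [sympExtend, planeIndex, Matrix.one_apply, Pi.single_apply]

theorem mem_range_sympExtend (σ : l ≃ m ⊕ Unit) {M : symplecticGroup l R}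
    (hM : ∀ i, M.1 *ᵥ Pi.single (planeIndex σ i) 1 = Pi.single (planeIndex σ i) 1) :
    M ∈ (sympExtend R σ).range := by
  obtain ⟨M, hMs⟩ := M
  obtain ⟨N, rfl⟩ : ∃ N : Matrix ((m ⊕ m) ⊕ (Unit ⊕ Unit)) _ R,
      N.submatrix (splitEquiv σ) (splitEquiv σ) = M :=
    ⟨M.submatrix (splitEquiv σ).symm (splitEquiv σ).symm, by simp⟩
  have hcol : ∀ i j, N j (Sum.inr i) = if j = Sum.inr i then 1 else 0 := by
    intro i j
    have h := congrFun (hM i) ((splitEquiv σ).symm j)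
    rw [Matrix.mulVec_single_one] at h
    simpa [planeIndex, Pi.single_apply] using h
  obtain ⟨A, B, C, D, rfl⟩ : ∃ A B C D, fromBlocks A B C D = N :=
    ⟨_, _, _, _, N.fromBlocks_toBlocks⟩
  obtain rfl : B = 0 := by ext j i; simpa using hcol i (Sum.inl j)
  obtain rfl : D = 1 := by ext j i; simpa [Matrix.one_apply] using hcol i (Sum.inr j)
  have h := SymplecticGroup.mem_iff'.1 hMs
  rw [J_eq_submatrix σ, Matrix.transpose_submatrix, Matrix.submatrix_mul_equiv,
    Matrix.submatrix_mul_equiv] at h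
  replace h := congrArg (fun A => A.submatrix (splitEquiv σ).symm (splitEquiv σ).symm) h
  simp only [Matrix.submatrix_submatrix, Equiv.self_comp_symm, Matrix.submatrix_id_id,
    fromBlocks_transpose, fromBlocks_multiply, Matrix.fromBlocks_inj] at h
  obtain ⟨h₁, -, h₂, -⟩ := h
  obtain rfl : C = 0 := by
    have h₃ := congrArg (fun A => J Unit R * A) h₂
    simpa [← Matrix.mul_assoc, Matrix.J_squared] using h₃
  refine ⟨⟨A, SymplecticGroup.mem_iff'.2 (by simpa using h₁)⟩, rfl⟩

theorem sympMap_surjective_of_equiv {A : Type*} [CommRing A] {f : A →+* R}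
    (hf : Function.Surjective f)
    (hR : ∀ x y : R, IsCoprime x y → ∃ t, IsUnit (x + t * y)) (σ : l ≃ m ⊕ Unit)
    (hm : Function.Surjective (sympMap m f)) : Function.Surjective (sympMap l f) := by
  rw [← MonoidHom.range_eq_top]
  have hS : ∀ (u : l ⊕ l → R) c, ⟨sympTransvection u c, sympTransvection_mem u c⟩ ∈
      (sympMap l f).range := by
    intro u c
    obtain ⟨u, rfl⟩ := hf.comp_left u
    obtain ⟨c, rfl⟩ := hf c
    exact ⟨⟨sympTransvection u c, sympTransvection_mem u c⟩,
      Subtype.ext (sympTransvection_map f u c)⟩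
  refine eq_top_iff.2 fun M _ => ?_
  obtain ⟨g, hg, h₁, h₂⟩ := exists_mem_mulVec_pair_eq hR hS
    ((sympForm_mulVec M.2 _ _).trans (sympForm_planeIndex σ)) (sympForm_planeIndex σ)
  rw [← Subgroup.mul_mem_cancel_left _ hg]
  obtain ⟨N, hN⟩ : g * M ∈ (sympExtend R σ).range := by
    refine mem_range_sympExtend σ fun i => ?_
    rw [Submonoid.coe_mul, ← Matrix.mulVec_mulVec]
    rcases i with i | i
    exacts [h₂, h₁]
  obtain ⟨N, rfl⟩ := hm N
  exact ⟨sympExtend A σ N, (sympMap_sympExtend f σ N).trans hN⟩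

theorem card_symplecticGroup_of_equiv (hR : ∀ x y : R, IsCoprime x y → ∃ t, IsUnit (x + t * y))
    (σ : l ≃ m ⊕ Unit) :
    Nat.card (symplecticGroup l R) =
      Nat.card {v : (l ⊕ l → R) × (l ⊕ l → R) // sympForm l R v.1 v.2 = 1} *
        Nat.card (symplecticGroup m R) := by
  set e : l ⊕ l → R := Pi.single (planeIndex σ (Sum.inr ())) 1
  set f : l ⊕ l → R := Pi.single (planeIndex σ (Sum.inl ())) 1
  have hef : sympForm l R e f = 1 := sympForm_planeIndex σ
  let F : symplecticGroup l R →
      {v : (l ⊕ l → R) × (l ⊕ l → R) // sympForm l R v.1 v.2 = 1} :=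
    fun M => ⟨(M.1 *ᵥ e, M.1 *ᵥ f), (sympForm_mulVec M.2 _ _).trans hef⟩
  have hFsurj : Function.Surjective F := by
    rintro ⟨⟨v, w⟩, h⟩
    obtain ⟨g, -, h₁, h₂⟩ := exists_mem_mulVec_pair_eq (S := ⊤) hR (fun _ _ => trivial) hef h
    exact ⟨g, Subtype.ext (Prod.ext h₁ h₂)⟩
  have hF : ∀ M N, F M = F N ↔ M⁻¹ * N ∈ (sympExtend R σ).range := by
    intro M N
    have hinv : ∀ x, M.1 *ᵥ ((M⁻¹ * N).1 *ᵥ x) = N.1 *ᵥ x := fun x => by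
      rw [Matrix.mulVec_mulVec, ← Submonoid.coe_mul, mul_inv_cancel_left]
    have hinv' : ∀ x, (M⁻¹).1 *ᵥ (M.1 *ᵥ x) = x := fun x => by
      rw [Matrix.mulVec_mulVec, ← Submonoid.coe_mul, inv_mul_cancel, Submonoid.coe_one,
        Matrix.one_mulVec]
    constructor
    · intro h
      have h₁ : M.1 *ᵥ e = N.1 *ᵥ e := congrArg (fun v => v.1.1) h
      have h₂ : M.1 *ᵥ f = N.1 *ᵥ f := congrArg (fun v => v.1.2) h
      refine mem_range_sympExtend σ fun i => ?_
      rw [Submonoid.coe_mul, ← Matrix.mulVec_mulVec]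
      rcases i with i | i
      exacts [h₂ ▸ hinv' _, h₁ ▸ hinv' _]
    · rintro ⟨K, hK⟩
      refine Subtype.ext (Prod.ext ?_ ?_)
      · have h : (M⁻¹ * N).1 *ᵥ e = e := hK ▸ sympExtend_mulVec_single σ K (Sum.inr ())
        exact (congrArg (M.1 *ᵥ ·) h.symm).trans (hinv e)
      · have h : (M⁻¹ * N).1 *ᵥ f = f := hK ▸ sympExtend_mulVec_single σ K (Sum.inl ())
        exact (congrArg (M.1 *ᵥ ·) h.symm).trans (hinv f)
  rw [Subgroup.card_eq_card_quotient_mul_card_subgroup (sympExtend R σ).range,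
    ← Nat.card_congr (MonoidHom.ofInjective (sympExtend_injective σ)).toEquiv]
  congr 1
  refine Nat.card_eq_of_bijective
    (Quotient.lift F fun M N h => (hF M N).2 (QuotientGroup.leftRel_apply.1 h)) ⟨?_, ?_⟩
  · rintro ⟨M⟩ ⟨N⟩ h
    exact Quotient.sound (QuotientGroup.leftRel_apply.2 ((hF M N).1 h))
  · exact fun v => (hFsurj v).imp' (fun M => ⟦M⟧) fun _ h => h

end Extend

section Count

theorem card_preimage_mul_card {G H : Type*} [AddGroup G] [AddGroup H] [Finite G] [Finite H]
    {f : G →+ H} (hf : Function.Surjective f) (P : H → Prop) :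
    Nat.card {x // P (f x)} * Nat.card H = Nat.card {y // P y} * Nat.card G := by
  have key : ∀ Q : H → Prop, Nat.card {x // Q (f x)} = Nat.card {y // Q y} * Nat.card f.ker := by
    intro Q
    have e₁ := Equiv.sigmaSubtypeFiberEquivSubtype f (p := fun x => Q (f x)) fun _ => Iff.rfl
    have e₂ : (Σ y : {y // Q y}, {x // f x = y}) ≃ {y // Q y} × f.ker :=
      (Equiv.sigmaCongrRight fun y : {y // Q y} =>
        AddMonoidHom.fiberEquivKerOfSurjective hf y.1).trans (Equiv.sigmaEquivProd _ _)
    rw [← Nat.card_congr e₁, Nat.card_congr e₂, Nat.card_prod]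
  have h := key fun _ => True
  rw [Nat.card_congr (Equiv.subtypeUnivEquiv fun _ => trivial),
    Nat.card_congr (Equiv.subtypeUnivEquiv fun _ => trivial)] at h
  rw [key, h]
  ring

/-- Reduction of `ZMod N` modulo all prime factors of `N`. -/
def reduceModPrimes (N : ℕ) : ZMod N →+* Π p : N.primeFactors, ZMod p :=
  RingHom.pi fun p => ZMod.castHom (Nat.dvd_of_mem_primeFactors p.2) (ZMod p)

instance (N : ℕ) (p : N.primeFactors) : Fact (p : ℕ).Prime := ⟨Nat.prime_of_mem_primeFactors p.2⟩

theorem reduceModPrimes_surjective (N : ℕ) : Function.Surjective (reduceModPrimes N) := by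
  intro a
  obtain ⟨x, rfl⟩ := (ZMod.prodEquivPi (fun p : N.primeFactors => (p : ℕ)) fun p q hpq =>
    (Nat.coprime_primes (Nat.prime_of_mem_primeFactors p.2)
      (Nat.prime_of_mem_primeFactors q.2)).2 fun h => hpq (Subtype.ext h)).surjective a
  obtain ⟨z, rfl⟩ := ZMod.intCast_surjective x
  exact ⟨z, by rw [map_intCast, map_intCast]⟩

theorem span_range_eq_top_iff {N : ℕ} (hN : N ≠ 0) {ι : Type*} (v : ι → ZMod N) :
    Ideal.span (Set.range v) = ⊤ ↔ ∀ p, (fun i => reduceModPrimes N (v i) p) ≠ 0 := by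
  constructor
  · intro h p hp
    have hle : Ideal.span (Set.range v) ≤
        RingHom.ker ((Pi.evalRingHom _ p).comp (reduceModPrimes N)) := by
      rw [Ideal.span_le]
      rintro _ ⟨i, rfl⟩
      exact congrFun hp i
    have h1 := hle (h ▸ Submodule.mem_top : (1 : ZMod N) ∈ _)
    simp at h1
  · intro h
    by_contra hne
    obtain ⟨m, hm, hle⟩ := Ideal.exists_le_maximal _ hne
    have hm' := Ideal.comap_isMaximal_of_surjective (Int.castRingHom (ZMod N))
      ZMod.intCast_surjective (K := m)
    obtain ⟨q, hq⟩ := IsPrincipalIdealRing.principal (m.comap (Int.castRingHom (ZMod N)))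
    have hmem : ∀ z : ℤ, (z : ZMod N) ∈ m ↔ (q.natAbs : ℤ) ∣ z := by
      intro z
      rw [Int.natAbs_dvd, ← Ideal.mem_span_singleton]
      exact (SetLike.ext_iff.1 hq z)
    have hqN : q.natAbs ∣ N := by
      rw [← Int.natCast_dvd_natCast, ← hmem]
      simp
    have hq0 : q ≠ 0 := by
      rintro rfl
      exact hN (by simpa using hqN)
    have hqp : q.natAbs.Prime := by
      rw [← Int.prime_iff_natAbs_prime, ← Ideal.span_singleton_prime hq0]
      have h := hm'.isPrime
      rw [hq] at h
      exact h
    refine h ⟨q.natAbs, Nat.mem_primeFactors.2 ⟨hqp, hqN, hN⟩⟩ (funext fun i => ?_)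
    obtain ⟨z, hz⟩ := ZMod.intCast_surjective (v i)
    have hz' : (q.natAbs : ℤ) ∣ z := (hmem z).1 (hz ▸ hle (Ideal.subset_span ⟨i, rfl⟩))
    rw [← hz, map_intCast]
    simpa [ZMod.intCast_zmod_eq_zero_iff_dvd] using (ZMod.intCast_zmod_eq_zero_iff_dvd z _).2 hz'

theorem isUnit_iff_reduceModPrimes {N : ℕ} (hN : N ≠ 0) (x : ZMod N) :
    IsUnit x ↔ ∀ p, reduceModPrimes N x p ≠ 0 := by
  have h := span_range_eq_top_iff hN (fun _ : Unit => x)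
  rw [Set.range_const, Ideal.span_singleton_eq_top] at h
  rw [h]
  exact forall_congr' fun p => not_congr (by simp [funext_iff])

/-- `ZMod N` has stable rank one. -/
theorem exists_isUnit_add_mul {N : ℕ} (hN : N ≠ 0) (x y : ZMod N) (h : IsCoprime x y) :
    ∃ t, IsUnit (x + t * y) := by
  classical
  obtain ⟨t, ht⟩ := reduceModPrimes_surjective N
    fun p => if reduceModPrimes N x p = 0 then 1 else 0
  refine ⟨t, (isUnit_iff_reduceModPrimes hN _).2 fun p => ?_⟩
  have hc := (h.map (reduceModPrimes N)).map (Pi.evalRingHom _ p)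
  simp only [Pi.evalRingHom_apply] at hc
  simp only [map_add, map_mul, ht, Pi.add_apply, Pi.mul_apply]
  split_ifs with hx
  · simpa [hx] using hc.ne_zero_or_ne_zero
  · simpa using hx

theorem card_span_range_eq_top {N : ℕ} (hN : N ≠ 0) (ι : Type*) [Fintype ι] :
    (Nat.card {v : ι → ZMod N // Ideal.span (Set.range v) = ⊤} : ℝ) =
      (N : ℝ) ^ Fintype.card ι * ∏ p ∈ N.primeFactors, (1 - ((p : ℝ) ^ Fintype.card ι)⁻¹) := by
  have : NeZero N := ⟨hN⟩
  have hsurj : Function.Surjective ((reduceModPrimes N).toAddMonoidHom.compLeft ι) :=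
    (reduceModPrimes_surjective N).comp_left
  have h := card_preimage_mul_card hsurj fun g => ∀ p, (fun i => g i p) ≠ 0
  have e : {g : ι → Π p : N.primeFactors, ZMod p // ∀ p, (fun i => g i p) ≠ 0} ≃
      Π p : N.primeFactors, {g : ι → ZMod p // g ≠ 0} :=
    ((Equiv.piComm fun (_ : ι) (p : N.primeFactors) => ZMod p).subtypeEquiv
      fun _ => Iff.rfl).trans
      (Equiv.subtypePiEquivPi (p := fun (p : N.primeFactors) (g : ι → ZMod p) => g ≠ 0))
  have hc : ∀ p : N.primeFactors,
      (Nat.card {g : ι → ZMod p // g ≠ 0} : ℝ) = (p : ℝ) ^ Fintype.card ι - 1 := by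
    classical
    intro p
    rw [Nat.card_eq_fintype_card, Fintype.card_subtype_compl, Fintype.card_subtype_eq,
      Nat.cast_sub Fintype.card_pos]
    simp
  have h0 : ∀ p ∈ N.primeFactors, (p : ℝ) ^ Fintype.card ι ≠ 0 := fun p hp =>
    pow_ne_zero _ (Nat.cast_ne_zero.2 (Nat.prime_of_mem_primeFactors hp).ne_zero)
  have hU : {v : ι → ZMod N // Ideal.span (Set.range v) = ⊤} ≃
      {v : ι → ZMod N // ∀ p, (fun i => reduceModPrimes N (v i) p) ≠ 0} :=
    Equiv.subtypeEquivRight fun v => span_range_eq_top_iff hN v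
  replace h : Nat.card {v : ι → ZMod N // Ideal.span (Set.range v) = ⊤} *
      Nat.card (ι → Π p : N.primeFactors, ZMod p) = _ :=
    (congrArg (· * _) (Nat.card_congr hU)).trans h
  rw [Nat.card_congr e, Nat.card_fun, Nat.card_pi, Nat.card_pi, Nat.card_fun] at h
  replace h := congrArg (Nat.cast : ℕ → ℝ) h
  push_cast at h
  simp only [hc, Nat.card_zmod, Nat.card_eq_fintype_card (α := ι)] at h
  rw [Finset.prod_coe_sort N.primeFactors fun p => (p : ℝ),
    Finset.prod_coe_sort N.primeFactors fun p => (p : ℝ) ^ Fintype.card ι - 1,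
    ← Finset.prod_pow] at h
  rw [← mul_right_cancel_iff_of_pos
    (Finset.prod_pos fun p hp => (pow_nonneg (Nat.cast_nonneg p) _).lt_of_ne' (h0 p hp)), h,
    mul_assoc, ← Finset.prod_mul_distrib, mul_comm]
  congr 1
  refine Finset.prod_congr rfl fun p hp => ?_
  rw [sub_mul, inv_mul_cancel₀ (h0 p hp), one_mul]

theorem exists_sympForm_eq_one_iff {l R : Type*} [DecidableEq l] [Fintype l] [CommRing R]
    (v : l ⊕ l → R) : (∃ w, sympForm l R v w = 1) ↔ Ideal.span (Set.range v) = ⊤ := by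
  rw [Ideal.eq_top_iff_one, Ideal.mem_span_range_iff_exists_fun]
  constructor
  · rintro ⟨w, hw⟩
    rw [sympForm_apply, dotProduct_comm] at hw
    exact ⟨_, hw⟩
  · rintro ⟨c, hc⟩
    refine ⟨-(J l R *ᵥ c), ?_⟩
    rw [sympForm_apply, Matrix.mulVec_neg, Matrix.mulVec_mulVec, J_squared, Matrix.neg_mulVec,
      Matrix.one_mulVec, neg_neg, dotProduct_comm]
    exact hc

theorem card_hyperbolic_pairs {N : ℕ} (hN : N ≠ 0) (l : Type*) [DecidableEq l] [Fintype l] :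
    Nat.card {v : (l ⊕ l → ZMod N) × (l ⊕ l → ZMod N) // sympForm l (ZMod N) v.1 v.2 = 1} * N =
      Nat.card {v : l ⊕ l → ZMod N // Ideal.span (Set.range v) = ⊤} *
        N ^ (2 * Fintype.card l) := by
  have : NeZero N := ⟨hN⟩
  let e : {v : (l ⊕ l → ZMod N) × (l ⊕ l → ZMod N) // sympForm l (ZMod N) v.1 v.2 = 1} ≃
      Σ v : {v : l ⊕ l → ZMod N // Ideal.span (Set.range v) = ⊤},
        {w // sympForm l (ZMod N) v.1 w = 1} :=
    { toFun := fun v => ⟨⟨v.1.1, (exists_sympForm_eq_one_iff _).1 ⟨_, v.2⟩⟩, ⟨v.1.2, v.2⟩⟩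
      invFun := fun v => ⟨(v.1.1, v.2.1), v.2.2⟩
      left_inv := fun _ => rfl
      right_inv := fun _ => rfl }
  have hfib : ∀ v : {v : l ⊕ l → ZMod N // Ideal.span (Set.range v) = ⊤},
      Nat.card {w // sympForm l (ZMod N) v.1 w = 1} * N = N ^ (2 * Fintype.card l) := by
    intro v
    obtain ⟨w, hw⟩ := (exists_sympForm_eq_one_iff v.1).2 v.2
    have hs : Function.Surjective (sympForm l (ZMod N) v.1).toAddMonoidHom := fun a =>
      ⟨a • w, by simp [hw]⟩
    simpa [Nat.card_fun, two_mul] using card_preimage_mul_card hs (· = 1)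
  rw [Nat.card_congr e, Nat.card_sigma, Finset.sum_mul, Finset.sum_congr rfl fun v _ => hfib v]
  simp

end Count

theorem sympMap_surjective {N : ℕ} (hN : N ≠ 0) (n : ℕ) :
    Function.Surjective (sympMap (Fin n) (Int.castRingHom (ZMod N))) := by
  induction n with
  | zero => exact fun M => ⟨1, Subtype.ext (Subsingleton.elim _ _)⟩
  | succ n ih =>
    exact sympMap_surjective_of_equiv ZMod.intCast_surjective (exists_isUnit_add_mul hN)
      ((finSuccEquiv n).trans (Equiv.optionEquivSumPUnit _)) ih

theorem card_symplecticGroup_zmod {N : ℕ} (hN : N ≠ 0) (n : ℕ) :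
    (Nat.card (symplecticGroup (Fin n) (ZMod N)) : ℝ) =
      (N : ℝ) ^ (n * (2 * n + 1)) *
        ∏ p ∈ N.primeFactors, ∏ l ∈ Finset.Icc 1 n, (1 - (p : ℝ) ^ (-(2 * (l : ℤ)))) := by
  induction n with
  | zero =>
    have : Unique (symplecticGroup (Fin 0) (ZMod N)) :=
      { default := 1, uniq := fun M => Subtype.ext (Subsingleton.elim _ _) }
    simp
  | succ n ih =>
    have hN' : (N : ℝ) ≠ 0 := Nat.cast_ne_zero.2 hN
    have h := congrArg (Nat.cast : ℕ → ℝ) (card_hyperbolic_pairs hN (Fin (n + 1)))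
    push_cast at h
    rw [card_span_range_eq_top hN] at h
    rw [card_symplecticGroup_of_equiv (exists_isUnit_add_mul hN)
      ((finSuccEquiv n).trans (Equiv.optionEquivSumPUnit _)), Nat.cast_mul, ih,
      eq_div_of_mul_eq hN' h]
    simp only [Finset.prod_Icc_succ_top (Nat.le_add_left 1 n), Finset.prod_mul_distrib]
    have hp : ∀ p : ℕ, (1 : ℝ) - (p : ℝ) ^ (-(2 * ((n + 1 : ℕ) : ℤ))) =
        1 - ((p : ℝ) ^ Fintype.card (Fin (n + 1) ⊕ Fin (n + 1)))⁻¹ := by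
      intro p
      rw [_root_.zpow_neg, ← zpow_natCast]
      simp [two_mul]
    simp only [hp, Fintype.card_sum, Fintype.card_fin]
    field_simp
    ring

theorem GammaSp_eq_ker (n N : ℕ) :
    GammaSp n N = (sympMap (Fin n) (Int.castRingHom (ZMod N))).ker := by
  ext γ
  rw [MonoidHom.mem_ker, ← Subtype.coe_inj]
  rfl

/-- The index of the principal congruence subgroup `Γ_n(N)` in `Γ_n(1) = Sp(n,ℤ)` is
`N^{n(2n+1)} · ∏_{p | N} ∏_{l=1}^n (1 - p^{-2l})`. -/
theorem statement5 (n N : ℕ) (hn : 0 < n) (hN : 0 < N) :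
    ((GammaSp n N).index : ℝ) =
      (N : ℝ) ^ (n * (2 * n + 1)) *
        ∏ p ∈ N.primeFactors, ∏ l ∈ Finset.Icc 1 n, (1 - (p : ℝ) ^ (-(2 * (l : ℤ)))) := by
  rw [GammaSp_eq_ker, Subgroup.index_ker,
    MonoidHom.range_eq_top.2 (sympMap_surjective hN.ne' n), Subgroup.card_top,
    card_symplecticGroup_zmod hN.ne']
end

section
/- (Siegel) For the lattice L_2^* of half-integral symmetric 2×2 matrices: ζ_Sh(L_2^*, 0) = 1/96, and for n > 2, ζ_Sh(L_2^*, 2-n) = -(-1)^n · B_{2n-2} / (2^{2n}·(n-1)). -/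
open Matrix

/-- The set of half-integral symmetric `r×r` matrices: symmetric rational matrices with
integral diagonal entries and off-diagonal entries in `(1/2)ℤ`. -/
def IsHalfIntegral (r : ℕ) (x : Matrix (Fin r) (Fin r) ℚ) : Prop :=
  x.IsSymm ∧ (∀ i, ∃ a : ℤ, x i i = (a : ℚ)) ∧
    (∀ i j, i ≠ j → ∃ a : ℤ, x i j = (a : ℚ) / 2)

/-- Points of `L_r^* ∩ Ω_r`: half-integral symmetric matrices which are positive definite
(as real matrices). -/
def HalfIntPosDef (r : ℕ) :=
  {x : Matrix (Fin r) (Fin r) ℚ // IsHalfIntegral r x ∧ (x.map ((↑) : ℚ → ℝ)).PosDef}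

/-- The congruence action `x · γ = ᵗγ x γ` of `SL(r,ℤ)` on rational symmetric matrices. -/
def slCongr (r : ℕ) (γ : Matrix.SpecialLinearGroup (Fin r) ℤ) (x : Matrix (Fin r) (Fin r) ℚ) :
    Matrix (Fin r) (Fin r) ℚ :=
  ((γ : Matrix (Fin r) (Fin r) ℤ).map ((↑) : ℤ → ℚ))ᵀ * x *
    (γ : Matrix (Fin r) (Fin r) ℤ).map ((↑) : ℤ → ℚ)

/-- The `Γ_r = SL(r,ℤ)`-orbit equivalence on `L_r^* ∩ Ω_r`. -/
def shOrbitRel (r : ℕ) (x y : HalfIntPosDef r) : Prop :=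
  ∃ γ : Matrix.SpecialLinearGroup (Fin r) ℤ, slCongr r γ x.1 = y.1

/-- The order `ε_r(x)` of the stabilizer of `x` in `Γ_r = SL(r,ℤ)`. -/
noncomputable def shStabOrder (r : ℕ) (x : HalfIntPosDef r) : ℕ :=
  Nat.card {γ : Matrix.SpecialLinearGroup (Fin r) ℤ // slCongr r γ x.1 = x.1}

/-- The Shintani zeta series
`ζ_Sh(L_r^*, s) = (1/2) Σ_{x ∈ L_r^* ∩ Ω_r / Γ_r} 1/(ε_r(x)·det(x)^s)`,
the sum running over the `SL(r,ℤ)`-orbits. -/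
noncomputable def shintaniZetaSeries (r : ℕ) (s : ℂ) : ℂ :=
  (1 / 2) * ∑' q : Quot (shOrbitRel r),
    (((shStabOrder r q.out : ℂ)) * ((q.out.1.det : ℂ) ^ s))⁻¹

/-- The weight attached to the binary quadratic form `a x² + b x y + c y²`: it is supported on
Gauss-reduced forms and its sum over `SL(2, ℤ)` along each orbit equals one. -/
noncomputable def reducedWeight (a b c : ℤ) : ℝ :=
  if 0 < a ∧ |b| ≤ a ∧ a ≤ c then
    (if |b| = a then (if a = c then 1 / 12 else 1 / 4) else (if a = c then 1 / 4 else 1 / 2))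
  else 0

/-- The matrix `!![p, q; r, s]` acts on binary forms by substitution; this is the weight of the
transformed form. -/
noncomputable def reducedWeightAct (a b c p q r s : ℤ) : ℝ :=
  reducedWeight (a * p ^ 2 + b * p * r + c * r ^ 2)
    (2 * a * p * q + b * (p * s + q * r) + 2 * c * r * s)
    (a * q ^ 2 + b * q * s + c * s ^ 2)

lemma reducedWeightAct_neg (a b c p q r s : ℤ) :
    reducedWeightAct a b c (-p) (-q) (-r) (-s) = reducedWeightAct a b c p q r s := by
  unfold reducedWeightAct; congr 1 <;> ring

lemma reducedWeight_eq_zero {a b c : ℤ} (h : ¬ (0 < a ∧ |b| ≤ a ∧ a ≤ c)) :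
    reducedWeight a b c = 0 := if_neg h

lemma reducedWeight_interior {a b c : ℤ} (h : 0 < a) (hb : |b| < a) (hc : a < c) :
    reducedWeight a b c = 1 / 2 := by
  unfold reducedWeight; rw [if_pos ⟨h, hb.le, hc.le⟩, if_neg hb.ne, if_neg hc.ne]

lemma reducedWeight_side {a b c : ℤ} (h : 0 < a) (hb : |b| = a) (hc : a < c) :
    reducedWeight a b c = 1 / 4 := by
  unfold reducedWeight; rw [if_pos ⟨h, hb.le, hc.le⟩, if_pos hb, if_neg hc.ne]

lemma reducedWeight_arc {a b c : ℤ} (h : 0 < a) (hb : |b| < a) (hc : a = c) :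
    reducedWeight a b c = 1 / 4 := by
  unfold reducedWeight; rw [if_pos ⟨h, hb.le, hc.le⟩, if_neg hb.ne, if_pos hc]

lemma reducedWeight_corner {a b c : ℤ} (h : 0 < a) (hb : |b| = a) (hc : a = c) :
    reducedWeight a b c = 1 / 12 := by
  unfold reducedWeight; rw [if_pos ⟨h, hb.le, hc.le⟩, if_pos hb, if_pos hc]

/-- The ten matrices with entries in `{-1, 0, 1}`, up to sign. -/
lemma sum_reducedWeightAct {a b c : ℤ} (ha : 0 < a) (hb : |b| ≤ a) (hc : a ≤ c) :
    reducedWeightAct a b c 1 0 0 1 + reducedWeightAct a b c 1 1 0 1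
      + reducedWeightAct a b c 1 (-1) 0 1 + reducedWeightAct a b c 1 0 1 1
      + reducedWeightAct a b c 1 0 (-1) 1 + reducedWeightAct a b c 0 (-1) 1 0
      + reducedWeightAct a b c 1 (-1) 1 0 + reducedWeightAct a b c (-1) (-1) 1 0
      + reducedWeightAct a b c 0 (-1) 1 1 + reducedWeightAct a b c 0 (-1) 1 (-1) = 1 / 2 := by
  simp only [reducedWeightAct]
  ring_nf
  obtain hb' | hb' | hb' : (|b| < a) ∨ (b = a) ∨ (b = -a) := by grind
  all_goals obtain hc' | hc' := hc.lt_or_eq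
  all_goals subst_vars
  all_goals simp (discharger := grind) only [reducedWeight_eq_zero, reducedWeight_interior, reducedWeight_side, reducedWeight_arc, reducedWeight_corner]
  all_goals norm_num

lemma le_of_reduced {a b c : ℤ} (ha : 0 < a) (hb : |b| ≤ a) (hc : a ≤ c) {x y : ℤ}
    (h : x ≠ 0 ∨ y ≠ 0) : a ≤ a * x ^ 2 + b * x * y + c * y ^ 2 := by
  obtain ⟨h1, h2⟩ := abs_le.mp hb
  have key : 1 ≤ x ^ 2 + y ^ 2 - |x * y| := by
    have h3 : 0 < x ^ 2 + y ^ 2 := by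
      rcases h with h | h <;> positivity
    rcases abs_cases (x * y) with ⟨e, _⟩ | ⟨e, _⟩ <;> rw [e] <;>
      nlinarith [sq_nonneg (x - y), sq_nonneg (x + y)]
  have h4 : -(a * |x * y|) ≤ b * (x * y) := by
    have : |b * (x * y)| ≤ a * |x * y| := by rw [abs_mul]; gcongr
    linarith [neg_abs_le (b * (x * y))]
  nlinarith [mul_le_mul_of_nonneg_left key ha.le, mul_le_mul_of_nonneg_right hc (sq_nonneg y)]

set_option maxHeartbeats 1000000 in
lemma entries_of_reduced {a b c p q r s : ℤ} (ha : 0 < a) (hb : |b| ≤ a) (hc : a ≤ c)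
    (hdet : p * s - q * r = 1)
    (ha' : 0 < a * p ^ 2 + b * p * r + c * r ^ 2)
    (hb' : |2 * a * p * q + b * (p * s + q * r) + 2 * c * r * s| ≤
      a * p ^ 2 + b * p * r + c * r ^ 2)
    (hc' : a * p ^ 2 + b * p * r + c * r ^ 2 ≤ a * q ^ 2 + b * q * s + c * s ^ 2) :
    (|p| ≤ 1 ∧ |q| ≤ 1) ∧ |r| ≤ 1 ∧ |s| ≤ 1 := by
  have hle : a * p ^ 2 + b * p * r + c * r ^ 2 ≤ a := by
    have h := le_of_reduced ha' hb' hc' (x := s) (y := -r) (by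
      by_contra! h; obtain ⟨h1, h2⟩ := h
      have : r = 0 := by omega
      simp [h1, this] at hdet)
    have e : (a * p ^ 2 + b * p * r + c * r ^ 2) * s ^ 2 +
        (2 * a * p * q + b * (p * s + q * r) + 2 * c * r * s) * s * -r +
        (a * q ^ 2 + b * q * s + c * s ^ 2) * (-r) ^ 2 = a * (p * s - q * r) ^ 2 := by ring
    rw [e, hdet] at h; linarith
  obtain ⟨h1, h2⟩ := abs_le.mp hb
  have hr : |r| ≤ 1 := by
    by_contra! h
    have h4 : 4 ≤ r ^ 2 := by rw [← sq_abs]; nlinarith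
    have : 4 * a * (a * p ^ 2 + b * p * r + c * r ^ 2) =
      (2 * a * p + b * r) ^ 2 + (4 * a * c - b ^ 2) * r ^ 2 := by ring
    have h5 : 3 * a ^ 2 ≤ 4 * a * c - b ^ 2 := by nlinarith
    nlinarith [sq_nonneg (2 * a * p + b * r)]
  have hp : |p| ≤ 1 := by
    by_contra! h
    have h4 : 4 ≤ p ^ 2 := by rw [← sq_abs]; nlinarith
    have h6 : 4 * c * (a * p ^ 2 + b * p * r + c * r ^ 2) =
      (2 * c * r + b * p) ^ 2 + (4 * a * c - b ^ 2) * p ^ 2 := by ring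
    have h7 : b ^ 2 ≤ a * c := by nlinarith
    have h8 : 0 < a * c := by nlinarith
    have h9 : (4 * a * c - b ^ 2) * 4 ≤ (4 * a * c - b ^ 2) * p ^ 2 := by gcongr; nlinarith
    have h10 : c * (a * p ^ 2 + b * p * r + c * r ^ 2) ≤ c * a := by gcongr; linarith
    nlinarith [sq_nonneg (2 * c * r + b * p)]
  obtain ⟨h3, h4⟩ := abs_le.mp hr
  obtain ⟨h5, h6⟩ := abs_le.mp hp
  obtain ⟨h7, h8⟩ := abs_le.mp hb'
  refine ⟨⟨hp, ?_⟩, hr, ?_⟩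
  · rw [abs_le]
    interval_cases p <;> interval_cases r <;> first | omega | skip
    all_goals constructor <;> by_contra! h <;> nlinarith
  · rw [abs_le]
    interval_cases p <;> interval_cases r <;> first | omega | skip
    all_goals constructor <;> by_contra! h <;> nlinarith

lemma hasSum_reducedWeightAct {a b c : ℤ} (ha : 0 < a) (hb : |b| ≤ a) (hc : a ≤ c) :
    HasSum (fun γ : Matrix.SpecialLinearGroup (Fin 2) ℤ =>
      reducedWeightAct a b c (γ 0 0) (γ 0 1) (γ 1 0) (γ 1 1)) 1 := by
  let g : (ℤ × ℤ) × ℤ × ℤ → ℝ := fun x =>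
    if x.1.1 * x.2.2 - x.1.2 * x.2.1 = 1 then reducedWeightAct a b c x.1.1 x.1.2 x.2.1 x.2.2 else 0
  let e : Matrix.SpecialLinearGroup (Fin 2) ℤ → (ℤ × ℤ) × ℤ × ℤ :=
    fun γ => ((γ 0 0, γ 0 1), γ 1 0, γ 1 1)
  have he : Function.Injective e := by
    intro γ γ' h
    simp only [e, Prod.mk.injEq] at h
    ext i j
    fin_cases i <;> fin_cases j <;> simp_all
  have hg : (fun γ : Matrix.SpecialLinearGroup (Fin 2) ℤ =>
      reducedWeightAct a b c (γ 0 0) (γ 0 1) (γ 1 0) (γ 1 1)) = g ∘ e := by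
    funext γ
    have hd := γ.det_coe
    rw [Matrix.det_fin_two] at hd
    simp [g, e, hd]
  rw [hg, he.hasSum_iff]
  · have hsum : HasSum g (∑ x ∈ (Finset.Icc (-1) 1 ×ˢ Finset.Icc (-1) 1) ×ˢ
        Finset.Icc (-1) 1 ×ˢ Finset.Icc (-1) 1, g x) := by
      refine hasSum_sum_of_ne_finset_zero ?_
      rintro ⟨⟨p, q⟩, r, s⟩ hx
      simp only [g]
      split_ifs with hd
      · refine reducedWeight_eq_zero ?_
        rintro ⟨h1, h2, h3⟩
        have := entries_of_reduced ha hb hc hd h1 h2 h3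
        simp only [abs_le] at this
        simp only [Finset.mem_product, Finset.mem_Icc] at hx
        exact hx this
      · rfl
    convert hsum using 1
    have hI : Finset.Icc (-1 : ℤ) 1 = {-1, 0, 1} := by decide
    have h10 := sum_reducedWeightAct ha hb hc
    have n1 := reducedWeightAct_neg a b c 1 0 0 1
    have n2 := reducedWeightAct_neg a b c 1 1 0 1
    have n3 := reducedWeightAct_neg a b c 1 (-1) 0 1
    have n4 := reducedWeightAct_neg a b c 1 0 1 1
    have n5 := reducedWeightAct_neg a b c 1 0 (-1) 1
    have n6 := reducedWeightAct_neg a b c 0 (-1) 1 0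
    have n7 := reducedWeightAct_neg a b c 1 (-1) 1 0
    have n8 := reducedWeightAct_neg a b c (-1) (-1) 1 0
    have n9 := reducedWeightAct_neg a b c 0 (-1) 1 1
    have n10 := reducedWeightAct_neg a b c 0 (-1) 1 (-1)
    norm_num at n1 n2 n3 n4 n5 n6 n7 n8 n9 n10
    simp only [Finset.sum_product, hI]
    norm_num [g]
    linarith
  · rintro ⟨⟨p, q⟩, r, s⟩ hx
    simp only [g]
    split_ifs with hd
    · exact absurd ⟨⟨!![p, q; r, s], by rw [Matrix.det_fin_two]; simpa using hd⟩, rfl⟩ hx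
    · rfl

/-- The half-integral matrix of the binary form `a x² + b x y + c y²`. -/
def formMatrix (a b c : ℤ) : Matrix (Fin 2) (Fin 2) ℚ := !![(a : ℚ), b / 2; b / 2, c]

lemma posDef_two_iff {a b c : ℝ} :
    (!![a, b; b, c] : Matrix (Fin 2) (Fin 2) ℝ).PosDef ↔ 0 < a ∧ 0 < a * c - b ^ 2 := by
  constructor
  · intro h
    refine ⟨by simpa using h.diag_pos (i := 0), ?_⟩
    have := h.det_pos
    rw [Matrix.det_fin_two] at this
    simp at this
    linarith
  · rintro ⟨ha, hd⟩
    refine Matrix.PosDef.of_dotProduct_mulVec_pos ?_ ?_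
    · ext i j; fin_cases i <;> fin_cases j <;> simp
    · intro x hx
      have hx' : x 0 ≠ 0 ∨ x 1 ≠ 0 := by
        by_contra! h
        apply hx; ext i; fin_cases i
        · exact h.1
        · exact h.2
      simp [Matrix.mulVec, dotProduct, Fin.sum_univ_two]
      have e : a * (x 0 * (a * x 0 + b * x 1) + x 1 * (b * x 0 + c * x 1)) =
        (a * x 0 + b * x 1) ^ 2 + (a * c - b ^ 2) * x 1 ^ 2 := by ring
      have : 0 < (a * x 0 + b * x 1) ^ 2 + (a * c - b ^ 2) * x 1 ^ 2 := by
        by_cases h1 : x 1 = 0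
        · have h0 : x 0 ≠ 0 := by tauto
          rw [h1]; simp; positivity
        · positivity
      rw [← e] at this
      exact pos_of_mul_pos_right this ha.le

lemma isHalfIntegral_formMatrix (a b c : ℤ) : IsHalfIntegral 2 (formMatrix a b c) := by
  refine ⟨?_, ?_, ?_⟩
  · ext i j; fin_cases i <;> fin_cases j <;> simp [formMatrix]
  · intro i; fin_cases i
    · exact ⟨a, by simp [formMatrix]⟩
    · exact ⟨c, by simp [formMatrix]⟩
  · intro i j hij
    refine ⟨b, ?_⟩
    fin_cases i <;> fin_cases j <;> simp [formMatrix] at hij ⊢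

lemma posDef_formMatrix_iff {a b c : ℤ} :
    ((formMatrix a b c).map ((↑) : ℚ → ℝ)).PosDef ↔ 0 < a ∧ 0 < 4 * a * c - b ^ 2 := by
  have : (formMatrix a b c).map ((↑) : ℚ → ℝ) = !![(a : ℝ), b / 2; b / 2, c] := by
    ext i j; fin_cases i <;> fin_cases j <;> simp [formMatrix]
  rw [this, posDef_two_iff]
  refine and_congr (by norm_cast) ?_
  rw [← Int.cast_pos (R := ℝ)]
  push_cast
  constructor <;> intro h <;> nlinarith

lemma exists_formMatrix_eq (x : HalfIntPosDef 2) :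
    ∃ a b c : ℤ, x.1 = formMatrix a b c ∧ 0 < a ∧ 0 < 4 * a * c - b ^ 2 := by
  obtain ⟨x, ⟨hs, hd, ho⟩, hp⟩ := x
  obtain ⟨a, ha⟩ := hd 0
  obtain ⟨c, hc⟩ := hd 1
  obtain ⟨b, hb⟩ := ho 0 1 (by decide)
  have hx : x = formMatrix a b c := by
    ext i j; fin_cases i <;> fin_cases j <;> simp [formMatrix, *]
    rw [← hb]; exact hs.apply 0 1
  refine ⟨a, b, c, hx, ?_⟩
  subst hx
  exact posDef_formMatrix_iff.mp hp

lemma formMatrix_injective {a b c a' b' c' : ℤ} (h : formMatrix a b c = formMatrix a' b' c') :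
    a = a' ∧ b = b' ∧ c = c' := by
  have h0 := congrFun₂ h 0 0
  have h1 := congrFun₂ h 0 1
  have h2 := congrFun₂ h 1 1
  simp [formMatrix] at h0 h1 h2
  exact ⟨h0, h1, h2⟩

lemma slCongr_formMatrix (γ : SpecialLinearGroup (Fin 2) ℤ) (a b c : ℤ) :
    slCongr 2 γ (formMatrix a b c) =
      formMatrix (a * γ 0 0 ^ 2 + b * γ 0 0 * γ 1 0 + c * γ 1 0 ^ 2)
        (2 * a * γ 0 0 * γ 0 1 + b * (γ 0 0 * γ 1 1 + γ 0 1 * γ 1 0) + 2 * c * γ 1 0 * γ 1 1)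
        (a * γ 0 1 ^ 2 + b * γ 0 1 * γ 1 1 + c * γ 1 1 ^ 2) := by
  ext i j
  fin_cases i <;> fin_cases j <;>
    simp [slCongr, formMatrix, Matrix.mul_apply, Fin.sum_univ_two] <;> ring

lemma slCongr_mul (r : ℕ) (γ δ : SpecialLinearGroup (Fin r) ℤ) (x : Matrix (Fin r) (Fin r) ℚ) :
    slCongr r (γ * δ) x = slCongr r δ (slCongr r γ x) := by
  have : ((γ * δ : SpecialLinearGroup (Fin r) ℤ) : Matrix (Fin r) (Fin r) ℤ).map ((↑) : ℤ → ℚ) =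
      (γ : Matrix (Fin r) (Fin r) ℤ).map ((↑) : ℤ → ℚ) *
        (δ : Matrix (Fin r) (Fin r) ℤ).map ((↑) : ℤ → ℚ) := by
    exact Matrix.map_mul (f := Int.castRingHom ℚ) (L := γ.1) (M := δ.1)
  simp only [slCongr, this, Matrix.transpose_mul, Matrix.mul_assoc]

lemma slCongr_one (r : ℕ) (x : Matrix (Fin r) (Fin r) ℚ) : slCongr r 1 x = x := by
  simp [slCongr]

lemma det_slCongr (r : ℕ) (γ : SpecialLinearGroup (Fin r) ℤ) (x : Matrix (Fin r) (Fin r) ℚ) :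
    (slCongr r γ x).det = x.det := by
  have : ((γ : Matrix (Fin r) (Fin r) ℤ).map ((↑) : ℤ → ℚ)).det = 1 := by
    have := (Int.castRingHom ℚ).map_det (γ : Matrix (Fin r) (Fin r) ℤ)
    simpa using this.symm
  simp [slCongr, this]

lemma shOrbitRel_equivalence (r : ℕ) : Equivalence (shOrbitRel r) where
  refl x := ⟨1, slCongr_one r x.1⟩
  symm := by
    rintro x y ⟨γ, h⟩
    exact ⟨γ⁻¹, by rw [← h, ← slCongr_mul, mul_inv_cancel, slCongr_one]⟩
  trans := by
    rintro x y z ⟨γ, h⟩ ⟨δ, h'⟩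
    exact ⟨γ * δ, by rw [slCongr_mul, h, h']⟩

lemma exists_slCongr_eq_mul (x : HalfIntPosDef 2) (γ : SpecialLinearGroup (Fin 2) ℤ) :
    ∃ y : HalfIntPosDef 2, slCongr 2 γ x.1 = y.1 := by
  obtain ⟨a, b, c, hx, ha, hd⟩ := exists_formMatrix_eq x
  have e := slCongr_formMatrix γ a b c
  refine ⟨⟨slCongr 2 γ x.1, ?_, ?_⟩, rfl⟩
  · rw [hx, e]; exact isHalfIntegral_formMatrix _ _ _
  · have h := x.2.2
    rw [hx, e, posDef_formMatrix_iff]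
    have hdet := γ.det_coe
    rw [Matrix.det_fin_two] at hdet
    generalize γ 0 0 = p at *
    generalize γ 0 1 = q at *
    generalize γ 1 0 = r at *
    generalize γ 1 1 = s at *
    constructor
    · have e2 : 4 * a * (a * p ^ 2 + b * p * r + c * r ^ 2) =
        (2 * a * p + b * r) ^ 2 + (4 * a * c - b ^ 2) * r ^ 2 := by ring
      have : 0 < (2 * a * p + b * r) ^ 2 + (4 * a * c - b ^ 2) * r ^ 2 := by
        by_cases hr : r = 0
        · have hp : p ≠ 0 := by rintro rfl; simp [hr] at hdet
          subst hr; simp; positivity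
        · positivity
      rw [← e2] at this
      exact pos_of_mul_pos_right this (by positivity)
    · have : 4 * (a * p ^ 2 + b * p * r + c * r ^ 2) * (a * q ^ 2 + b * q * s + c * s ^ 2) -
        (2 * a * p * q + b * (p * s + q * r) + 2 * c * r * s) ^ 2 =
        (4 * a * c - b ^ 2) * (p * s - q * r) ^ 2 := by ring
      rw [this, hdet]; simpa using hd

/-- The weight of a half-integral matrix. -/
noncomputable def matrixWeight (x : Matrix (Fin 2) (Fin 2) ℚ) : ℝ :=
  reducedWeight (x 0 0).num (2 * x 0 1).num (x 1 1).num

lemma matrixWeight_formMatrix (a b c : ℤ) :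
    matrixWeight (formMatrix a b c) = reducedWeight a b c := by
  simp [matrixWeight, formMatrix]
  congr 1
  rw [mul_div_cancel₀ _ (by norm_num)]
  exact Rat.num_intCast _

lemma matrixWeight_slCongr (γ : SpecialLinearGroup (Fin 2) ℤ) (a b c : ℤ) :
    matrixWeight (slCongr 2 γ (formMatrix a b c)) =
      reducedWeightAct a b c (γ 0 0) (γ 0 1) (γ 1 0) (γ 1 1) := by
  rw [slCongr_formMatrix, matrixWeight_formMatrix]; rfl

lemma exists_reduced (x : HalfIntPosDef 2) : ∃ (γ : SpecialLinearGroup (Fin 2) ℤ) (a b c : ℤ),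
    slCongr 2 γ x.1 = formMatrix a b c ∧ 0 < a ∧ |b| ≤ a ∧ a ≤ c := by
  let P : ℕ → Prop := fun n => 0 < n ∧ ∃ (γ : SpecialLinearGroup (Fin 2) ℤ) (b c : ℤ),
    slCongr 2 γ x.1 = formMatrix n b c
  have hP : ∃ n, P n := by
    obtain ⟨a, b, c, hx, ha, -⟩ := exists_formMatrix_eq x
    lift a to ℕ using ha.le
    exact ⟨a, by exact_mod_cast ha, 1, b, c, by rw [slCongr_one, hx]⟩
  classical
  obtain ⟨hn, γ, b, c, h⟩ := Nat.find_spec hP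
  have hmin := fun m => Nat.find_min' hP (m := m)
  generalize Nat.find hP = n at *
  have hn' : (0 : ℤ) < n := by exact_mod_cast hn
  obtain ⟨k, hk⟩ : ∃ k : ℤ, |b + 2 * n * k| ≤ n := by
    refine ⟨-((b + n) / (2 * n)), ?_⟩
    have h1 := Int.emod_add_mul_ediv (b + n) (2 * n)
    have h2 := Int.emod_nonneg (b + n) (b := 2 * n) (by positivity)
    have h3 := Int.emod_lt_of_pos (b + n) (b := 2 * n) (by positivity)
    rw [abs_le]; constructor <;> linarith
  let T : SpecialLinearGroup (Fin 2) ℤ := ⟨!![1, k; 0, 1], by simp⟩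
  let S : SpecialLinearGroup (Fin 2) ℤ := ⟨!![0, -1; 1, 0], by simp⟩
  have hT : slCongr 2 (γ * T) x.1 = formMatrix n (b + 2 * n * k) (n * k ^ 2 + b * k + c) := by
    rw [slCongr_mul, h, slCongr_formMatrix]
    simp [T]; congr 1; ring
  refine ⟨γ * T, n, _, _, hT, hn', hk, ?_⟩
  have hS : slCongr 2 (γ * T * S) x.1 =
      formMatrix (n * k ^ 2 + b * k + c) (-(b + 2 * n * k)) n := by
    rw [slCongr_mul, hT, slCongr_formMatrix]
    simp [S]
  obtain ⟨y, hy⟩ := exists_slCongr_eq_mul x (γ * T * S)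
  have hpos : 0 < n * k ^ 2 + b * k + c := by
    have := y.2.2
    rw [← hy, hS, posDef_formMatrix_iff] at this
    exact this.1
  generalize n * k ^ 2 + b * k + c = m at *
  lift m to ℕ using hpos.le
  exact_mod_cast hmin m ⟨by exact_mod_cast hpos, γ * T * S, _, _, hS⟩

lemma hasSum_matrixWeight_slCongr (x : HalfIntPosDef 2) :
    HasSum (fun γ : SpecialLinearGroup (Fin 2) ℤ => matrixWeight (slCongr 2 γ x.1)) 1 := by
  obtain ⟨γ₀, a, b, c, h, ha, hb, hc⟩ := exists_reduced x
  rw [← (Equiv.mulLeft γ₀).hasSum_iff]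
  have := hasSum_reducedWeightAct ha hb hc
  simp_rw [← matrixWeight_slCongr, ← h, ← slCongr_mul] at this
  exact this

lemma natCard_slCongr_eq {x y : HalfIntPosDef 2} (h : shOrbitRel 2 x y) :
    Nat.card {γ : SpecialLinearGroup (Fin 2) ℤ // slCongr 2 γ x.1 = y.1} = shStabOrder 2 x := by
  obtain ⟨δ, hδ⟩ := h
  refine Nat.card_congr ((Equiv.mulRight δ⁻¹).subtypeEquiv fun γ => ?_)
  rw [Equiv.coe_mulRight, slCongr_mul]
  constructor
  · intro h
    rw [h, ← hδ, ← slCongr_mul, mul_inv_cancel, slCongr_one]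
  · intro h
    rw [← hδ]
    nth_rw 2 [← h]
    rw [← slCongr_mul, inv_mul_cancel, slCongr_one]

lemma shStabOrder_mul_tsum_fiber (q : Quot (shOrbitRel 2)) :
    shStabOrder 2 q.out *
      ∑' x : {x : HalfIntPosDef 2 // Quot.mk (shOrbitRel 2) x = q}, matrixWeight x.1.1 = 1 := by
  have hq : Quot.mk (shOrbitRel 2) q.out = q := q.out_eq
  choose y hy using exists_slCongr_eq_mul q.out
  let φ : SpecialLinearGroup (Fin 2) ℤ → {x : HalfIntPosDef 2 // Quot.mk (shOrbitRel 2) x = q} :=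
    fun γ => ⟨y γ, by
      refine Eq.trans ?_ hq
      exact (Quot.sound ⟨γ, hy γ⟩).symm⟩
  have h := hasSum_matrixWeight_slCongr q.out
  rw [← (Equiv.sigmaFiberEquiv φ).hasSum_iff] at h
  rw [← h.tsum_eq, h.summable.tsum_sigma, ← tsum_mul_left]
  refine tsum_congr fun x => ?_
  have : ∀ γ : {γ // φ γ = x}, ((fun γ : SpecialLinearGroup (Fin 2) ℤ =>
      matrixWeight (slCongr 2 γ q.out.1)) ∘ Equiv.sigmaFiberEquiv φ) ⟨x, γ⟩ =
      matrixWeight x.1.1 := by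
    rintro ⟨γ, hγ⟩
    simp only [Function.comp, Equiv.sigmaFiberEquiv, Equiv.coe_fn_mk]
    rw [hy, ← hγ]
  rw [tsum_congr this, tsum_const, nsmul_eq_mul]
  congr 2
  rw [← natCard_slCongr_eq (x := q.out) (y := x.1)
    (((shOrbitRel_equivalence 2).quot_mk_eq_iff _ _).mp (hq.trans x.2.symm))]
  refine Nat.card_congr (Equiv.subtypeEquivRight fun γ => ?_)
  rw [hy, Subtype.ext_iff]
  exact Subtype.ext_iff.symm

lemma shintaniZetaSeries_two_eq_tsum {s : ℂ} (hs : Summable fun x : HalfIntPosDef 2 =>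
    (matrixWeight x.1 : ℂ) * ((x.1.det : ℂ) ^ s)⁻¹) :
    shintaniZetaSeries 2 s =
      1 / 2 * ∑' x : HalfIntPosDef 2, (matrixWeight x.1 : ℂ) * ((x.1.det : ℂ) ^ s)⁻¹ := by
  rw [shintaniZetaSeries]
  congr 1
  rw [← (Equiv.sigmaFiberEquiv (Quot.mk (shOrbitRel 2))).summable_iff] at hs
  rw [← (Equiv.sigmaFiberEquiv (Quot.mk (shOrbitRel 2))).tsum_eq]
  refine Eq.trans ?_ (Summable.tsum_sigma hs).symm
  refine tsum_congr fun q => ?_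
  have hdet : ∀ x : {x : HalfIntPosDef 2 // Quot.mk (shOrbitRel 2) x = q},
      x.1.1.det = q.out.1.det := by
    rintro ⟨x, hx⟩
    have : shOrbitRel 2 x q.out :=
      ((shOrbitRel_equivalence 2).quot_mk_eq_iff _ _).mp (hx.trans q.out_eq.symm)
    obtain ⟨γ, h⟩ := this
    rw [← h, det_slCongr]
  have h1 := shStabOrder_mul_tsum_fiber q
  have h2 : (shStabOrder 2 q.out : ℂ) *
      ∑' x : {x : HalfIntPosDef 2 // Quot.mk (shOrbitRel 2) x = q},
        (matrixWeight x.1.1 : ℂ) = 1 := by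
    rw [← Complex.ofReal_tsum]
    exact_mod_cast h1
  have h3 : (shStabOrder 2 q.out : ℂ)⁻¹ =
      ∑' x : {x : HalfIntPosDef 2 // Quot.mk (shOrbitRel 2) x = q},
        (matrixWeight x.1.1 : ℂ) := inv_eq_of_mul_eq_one_right h2
  rw [mul_inv, h3, ← tsum_mul_right]
  refine tsum_congr fun x => ?_
  rw [← hdet x]
  rfl

/-- The discriminant (up to sign) of the form with first coefficient `n + 1`, middle coefficient
`b` and last coefficient `n + 1 + m`. -/
def formDisc (n : ℕ) (i : ℤ × ℕ) : ℤ := 4 * (n + 1) * (n + 1 + i.2) - i.1 ^ 2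

/-- Twice the weight of the form with first coefficient `n + 1`, middle coefficient `b` and last
coefficient `n + 1 + m`. -/
noncomputable def formWeight (n : ℕ) (i : ℤ × ℕ) : ℝ :=
  2 * reducedWeight (n + 1) i.1 (n + 1 + i.2)

lemma reducedWeight_nonneg (a b c : ℤ) : 0 ≤ reducedWeight a b c := by
  unfold reducedWeight; split_ifs <;> norm_num

lemma reducedWeight_le_one (a b c : ℤ) : reducedWeight a b c ≤ 1 / 2 := by
  unfold reducedWeight; split_ifs <;> norm_num

lemma formWeight_nonneg (n : ℕ) (i : ℤ × ℕ) : 0 ≤ formWeight n i :=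
  mul_nonneg zero_le_two (reducedWeight_nonneg _ _ _)

lemma formWeight_le_one (n : ℕ) (i : ℤ × ℕ) : formWeight n i ≤ 1 := by
  have := reducedWeight_le_one (n + 1) i.1 (n + 1 + i.2)
  unfold formWeight; linarith

lemma abs_le_of_formWeight_ne_zero {n : ℕ} {i : ℤ × ℕ} (h : formWeight n i ≠ 0) :
    |i.1| ≤ n + 1 := by
  by_contra h'
  apply h
  rw [formWeight, reducedWeight_eq_zero (fun h => h' h.2.1), mul_zero]

lemma formDisc_ge {n : ℕ} {i : ℤ × ℕ} (h : |i.1| ≤ n + 1) :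
    3 * ((n : ℤ) + 1) * (n + 1 + i.2) ≤ formDisc n i := by
  have : i.1 ^ 2 ≤ ((n : ℤ) + 1) ^ 2 := by rw [← sq_abs]; gcongr
  unfold formDisc
  nlinarith [Int.natCast_nonneg n, Int.natCast_nonneg i.2]

lemma formDisc_pos {n : ℕ} {i : ℤ × ℕ} (h : |i.1| ≤ n + 1) : 0 < formDisc n i :=
  lt_of_lt_of_le (by positivity) (formDisc_ge h)

lemma formDisc_cube_ge {n : ℕ} {i : ℤ × ℕ} (h : |i.1| ≤ n + 1) :
    ((n : ℝ) + 1) * ((|i.1| + 1) * (i.2 + 1)) ≤ (formDisc n i : ℝ) ^ 3 := by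
  have h0 := formDisc_ge h
  have h1 : (n : ℤ) + 1 ≤ formDisc n i := by
    nlinarith [Int.natCast_nonneg n, Int.natCast_nonneg i.2]
  have h2 : (i.2 : ℤ) + 1 ≤ formDisc n i := by
    nlinarith [Int.natCast_nonneg n, Int.natCast_nonneg i.2]
  have h3 : |i.1| + 1 ≤ formDisc n i := by
    nlinarith [Int.natCast_nonneg n, Int.natCast_nonneg i.2]
  have h4 : ((n : ℤ) + 1) * ((|i.1| + 1) * (i.2 + 1)) ≤ formDisc n i ^ 3 := by
    have hnn : 0 ≤ formDisc n i := (formDisc_pos h).le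
    rw [show formDisc n i ^ 3 = formDisc n i * (formDisc n i * formDisc n i) by ring]
    gcongr
  have h5 : ((((n : ℤ) + 1) * ((|i.1| + 1) * (i.2 + 1)) : ℤ) : ℝ) ≤ ((formDisc n i ^ 3 : ℤ) : ℝ) :=
    Int.cast_le.mpr h4
  simpa using h5

lemma summable_formWeight {σ : ℝ} (hσ : 6 ≤ σ) :
    Summable fun x : ℕ × ℤ × ℕ => ‖(formWeight x.1 x.2 : ℂ)‖ / (formDisc x.1 x.2 : ℝ) ^ σ := by
  have hN : Summable fun n : ℕ => (((n : ℝ) + 1) ^ 2)⁻¹ := by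
    have := (summable_nat_add_iff 1).mpr (Real.summable_nat_pow_inv.mpr (one_lt_two))
    simpa using this
  have hZ : Summable fun b : ℤ => (((|b| : ℤ) + 1 : ℝ) ^ 2)⁻¹ := by
    refine Summable.of_nat_of_neg ?_ ?_ <;> simpa using hN
  have hS := hN.mul_of_nonneg (hZ.mul_of_nonneg hN (fun _ => by positivity) (fun _ => by positivity))
    (fun _ => by positivity) (fun _ => by positivity)
  refine hS.of_nonneg_of_le (fun x => ?_) (fun x => ?_)
  · by_cases h : formWeight x.1 x.2 = 0
    · simp [h]
    · have := formDisc_pos (abs_le_of_formWeight_ne_zero h)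
      positivity
  · by_cases h : formWeight x.1 x.2 = 0
    · simp [h]; positivity
    · have hb := abs_le_of_formWeight_ne_zero h
      have h3 := formDisc_cube_ge hb
      have h0 : (1 : ℝ) ≤ formDisc x.1 x.2 := by exact_mod_cast formDisc_pos hb
      rw [Complex.norm_real, Real.norm_of_nonneg (formWeight_nonneg _ _)]
      have h6 : (((x.1 : ℝ) + 1) * ((|x.2.1| + 1) * (x.2.2 + 1))) ^ 2 ≤
          (formDisc x.1 x.2 : ℝ) ^ σ := by
        calc (((x.1 : ℝ) + 1) * ((|x.2.1| + 1) * (x.2.2 + 1))) ^ 2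
            ≤ ((formDisc x.1 x.2 : ℝ) ^ 3) ^ 2 := by gcongr
          _ = (formDisc x.1 x.2 : ℝ) ^ (6 : ℝ) := by rw [← pow_mul]; norm_cast
          _ ≤ _ := Real.rpow_le_rpow_of_exponent_le h0 hσ
      calc formWeight x.1 x.2 / (formDisc x.1 x.2 : ℝ) ^ σ
          ≤ 1 / (((x.1 : ℝ) + 1) * ((|x.2.1| + 1) * (x.2.2 + 1))) ^ 2 := by
            gcongr
            exact formWeight_le_one _ _
        _ = _ := by
            rw [mul_pow, mul_pow, one_div, mul_inv, mul_inv]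

lemma det_formMatrix (a b c : ℤ) : (formMatrix a b c).det = (4 * a * c - b ^ 2 : ℤ) / 4 := by
  rw [Matrix.det_fin_two]; simp [formMatrix]; ring

lemma shintaniZetaSeries_two_eq {s : ℂ} (hs : 6 ≤ s.re) :
    shintaniZetaSeries 2 s = 4 ^ (s - 1) *
      ∑' x : ℕ × ℤ × ℕ, (formWeight x.1 x.2 : ℂ) / ((formDisc x.1 x.2 : ℝ) : ℂ) ^ s := by
  let F : ℤ × ℤ × ℤ → ℂ := fun t => (reducedWeight t.1 t.2.1 t.2.2 : ℂ) *
    ((((4 * t.1 * t.2.2 - t.2.1 ^ 2 : ℤ) : ℝ) / 4 : ℝ) ^ s : ℂ)⁻¹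
  choose A B C hABC using exists_formMatrix_eq
  let e : HalfIntPosDef 2 → ℤ × ℤ × ℤ := fun x => (A x, B x, C x)
  have he : Function.Injective e := by
    intro x y h
    simp only [e, Prod.mk.injEq] at h
    obtain ⟨h1, h2, h3⟩ := h
    exact Subtype.ext (by rw [(hABC x).1, (hABC y).1, h1, h2, h3])
  have hFe : ∀ x : HalfIntPosDef 2,
      (matrixWeight x.1 : ℂ) * ((x.1.det : ℂ) ^ s)⁻¹ = F (e x) := by
    intro x
    rw [(hABC x).1, matrixWeight_formMatrix, det_formMatrix]
    simp [F, e]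
  let g : ℕ × ℤ × ℕ → ℤ × ℤ × ℤ := fun x => (x.1 + 1, x.2.1, x.1 + 1 + x.2.2)
  have hg : Function.Injective g := by
    rintro ⟨n, b, m⟩ ⟨n', b', m'⟩ h
    simp only [g, Prod.mk.injEq] at h ⊢
    omega
  have hred : ∀ t, F t ≠ 0 → 0 < t.1 ∧ |t.2.1| ≤ t.1 ∧ t.1 ≤ t.2.2 := by
    intro t ht
    by_contra h
    exact ht (by simp [F, reducedWeight_eq_zero h])
  have hrangee : ∀ t ∉ Set.range e, F t = 0 := by
    rintro ⟨a, b, c⟩ ht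
    by_contra h
    obtain ⟨h1, h2, h3⟩ := hred _ h
    simp only at h1 h2 h3
    have hd : 0 < 4 * a * c - b ^ 2 := by
      have : b ^ 2 ≤ a ^ 2 := by rw [← sq_abs]; gcongr
      nlinarith
    let x : HalfIntPosDef 2 :=
      ⟨formMatrix a b c, isHalfIntegral_formMatrix _ _ _, posDef_formMatrix_iff.mpr ⟨h1, hd⟩⟩
    refine ht ⟨x, ?_⟩
    obtain ⟨e1, e2, e3⟩ := formMatrix_injective (hABC x).1
    simp only [e, ← e1, ← e2, ← e3]
  have hrangeg : ∀ t ∉ Set.range g, F t = 0 := by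
    rintro ⟨a, b, c⟩ ht
    by_contra h
    obtain ⟨h1, h2, h3⟩ := hred _ h
    refine ht ⟨((a - 1).toNat, b, (c - a).toNat), ?_⟩
    simp only at h1 h3
    simp only [g, Prod.mk.injEq, true_and]
    omega
  have hFg : ∀ x, F (g x) = 4 ^ s / 2 *
      ((formWeight x.1 x.2 : ℂ) / ((formDisc x.1 x.2 : ℝ) : ℂ) ^ s) := by
    intro x
    by_cases h : formWeight x.1 x.2 = 0
    · have : reducedWeight (x.1 + 1) x.2.1 (x.1 + 1 + x.2.2) = 0 := by
        simpa [formWeight] using h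
      simp [F, g, h, this]
    · have hp := formDisc_pos (abs_le_of_formWeight_ne_zero h)
      have hp' : (0 : ℝ) < formDisc x.1 x.2 := by exact_mod_cast hp
      simp only [F, g]
      rw [show (4 * ((x.1 : ℤ) + 1) * (x.1 + 1 + x.2.2) - x.2.1 ^ 2) = formDisc x.1 x.2 from rfl]
      rw [Complex.ofReal_div, Complex.div_cpow_ofReal_nonneg hp'.le (by norm_num), formWeight]
      push_cast
      field_simp
  have hsumg : Summable (F ∘ g) := by
    refine Summable.congr ?_ (fun x => (hFg x).symm)
    refine Summable.mul_left _ ?_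
    refine (summable_formWeight hs).of_norm_bounded (fun x => ?_)
    by_cases h : formWeight x.1 x.2 = 0
    · simp [h]
    · have hp := formDisc_pos (abs_le_of_formWeight_ne_zero h)
      have hp' : (0 : ℝ) < formDisc x.1 x.2 := by exact_mod_cast hp
      rw [norm_div, Complex.norm_cpow_eq_rpow_re_of_pos hp']
  have hsum : Summable F := (hg.summable_iff hrangeg).mp hsumg
  have hsume : Summable (F ∘ e) := (he.summable_iff hrangee).mpr hsum
  rw [shintaniZetaSeries_two_eq_tsum (hsume.congr fun x => (hFe x).symm)]
  rw [tsum_congr hFe, he.tsum_eq (f := F), ← hg.tsum_eq (f := F), tsum_congr hFg, tsum_mul_left,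
    Complex.cpow_sub _ _ (by norm_num), Complex.cpow_one]
  · ring
  · intro t ht; by_contra h; exact ht (hrangeg t h)
  · intro t ht; by_contra h; exact ht (hrangee t h)

/-- Twice the sum of `exp (t * b ^ 2)` over `-a ≤ b ≤ a`, the end points being counted half. -/
noncomputable def thetaSum (a : ℕ) (t : ℝ) : ℝ :=
  ∑ k ∈ Finset.range a, (Real.exp (t * k ^ 2) + Real.exp (t * (k + 1) ^ 2))

/-- The generating function of the reduced forms with first coefficient `a`. -/
noncomputable def formSeries (a : ℕ) (t : ℝ) : ℝ :=
  Real.exp (-(4 * a ^ 2) * t) * (1 / 2 * (Real.cosh (2 * a * t) / Real.sinh (2 * a * t))) *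
    thetaSum a t - 1 / 6 * Real.exp (-(3 * a ^ 2) * t)

lemma sideWeight_eq_sum (a : ℕ) (b : ℤ) :
    (if |b| < a then 1 else if 0 < a ∧ |b| = a then 1 / 2 else 0 : ℝ) =
      ∑ k ∈ Finset.range a, (1 / 2 : ℝ) * (((if b = k then 1 else 0) + (if b = k + 1 then 1 else 0))
        + ((if b = -k then 1 else 0) + (if b = -(k + 1) then 1 else 0))) := by
  induction a with
  | zero => simp
  | succ a ih =>
    rw [Finset.sum_range_succ, ← ih]
    rcases eq_or_ne a 0 with rfl | ha
    · push_cast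
      rcases abs_cases b with ⟨h, h'⟩ | ⟨h, h'⟩ <;> rw [h] <;>
        split_ifs <;> first | omega | (norm_num; done) | simp_all
    · push_cast
      rcases abs_cases b with ⟨h, h'⟩ | ⟨h, h'⟩ <;> rw [h] <;>
        split_ifs <;> first | omega | norm_num

lemma hasSum_sideWeight_mul_exp (a : ℕ) (t : ℝ) :
    HasSum (fun b : ℤ => (if |b| < a then 1 else if 0 < a ∧ |b| = a then 1 / 2 else 0 : ℝ) *
      Real.exp (t * b ^ 2)) (thetaSum a t) := by
  simp_rw [sideWeight_eq_sum, Finset.sum_mul, thetaSum]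
  refine hasSum_sum fun k _ => ?_
  have key : ∀ c : ℤ, HasSum (fun b : ℤ => (if b = c then 1 else 0 : ℝ) * Real.exp (t * b ^ 2))
      (Real.exp (t * c ^ 2)) := fun c => by
    convert! hasSum_ite_eq c (Real.exp (t * c ^ 2)) using 2 with b
    split_ifs with h <;> simp [h]
  have h := (((key k).add (key (k + 1))).add ((key (-k)).add (key (-(k + 1))))).mul_left (1 / 2)
  convert! h using 1
  · ext b; ring
  · push_cast; ring_nf

lemma hasSum_half_geometric {u : ℝ} (hu : 0 < u) :
    HasSum (fun m : ℕ => (if m = 0 then 1 / 2 else 1 : ℝ) * Real.exp (-(2 * u) * m))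
      (1 / 2 * (Real.cosh u / Real.sinh u)) := by
  have hq : Real.exp (-(2 * u)) < 1 := by rw [Real.exp_lt_one_iff]; linarith
  have h1 := hasSum_geometric_of_lt_one (Real.exp_pos _).le hq
  have h2 := h1.sub (hasSum_ite_eq (0 : ℕ) (1 / 2 : ℝ))
  convert! h2 using 1
  · ext m
    rw [← Real.exp_nat_mul, mul_comm (m : ℝ)]
    split_ifs with h
    · subst h; norm_num
    · simp
  · have hs : Real.sinh u ≠ 0 := (Real.sinh_pos_iff.mpr hu).ne'
    have h3 : 1 - Real.exp (-(2 * u)) ≠ 0 := by linarith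
    rw [Real.cosh_eq, Real.sinh_eq] at *
    have h4 : Real.exp (-(2 * u)) = Real.exp (-u) * Real.exp (-u) := by
      rw [← Real.exp_add]; ring_nf
    have h5 : Real.exp u * Real.exp (-u) = 1 := by rw [← Real.exp_add]; simp
    have h6 : Real.exp u - Real.exp (-u) ≠ 0 := by
      intro h; apply hs; rw [h]; simp
    rw [h4] at h3 ⊢
    generalize Real.exp u = x at *
    generalize Real.exp (-u) = y at *
    have h7 : 1 - y ^ 2 ≠ 0 := by rwa [sq]
    rw [← sq]
    field_simp
    linear_combination (-2 * y) * h5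

lemma formWeight_eq (n : ℕ) (i : ℤ × ℕ) :
    formWeight n i =
      (if |i.1| < (n + 1 : ℕ) then 1 else
        if 0 < n + 1 ∧ |i.1| = (n + 1 : ℕ) then 1 / 2 else 0 : ℝ) *
      (if i.2 = 0 then 1 / 2 else 1) -
      ((if i = ((n : ℤ) + 1, 0) then 1 / 12 else 0) +
        (if i = (-((n : ℤ) + 1), 0) then 1 / 12 else 0)) := by
  obtain ⟨b, m⟩ := i
  unfold formWeight
  push_cast
  simp only [Prod.mk.injEq]
  have hn : (0 : ℤ) < n + 1 := by positivity
  rcases lt_trichotomy |b| ((n : ℤ) + 1) with h | h | h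
  · have h1 : b ≠ n + 1 := by rintro rfl; rw [abs_of_pos hn] at h; omega
    have h2 : b ≠ -(n + 1) := by rintro rfl; rw [abs_neg, abs_of_pos hn] at h; omega
    rcases eq_or_ne m 0 with rfl | hm
    · rw [reducedWeight_arc hn h (by simp)]; simp [-neg_add_rev, h, h1, h2]; norm_num
    · rw [reducedWeight_interior hn h (by omega)]; simp [h, hm]
  · rcases eq_or_ne m 0 with rfl | hm
    · rw [reducedWeight_corner hn h (by simp)]
      rcases (abs_eq hn.le).mp h with rfl | rfl
      · have : ¬ ((n : ℤ) + 1 = -(n + 1)) := by omega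
        simp only [h, this, and_true, and_self, lt_irrefl, Nat.succ_pos, if_true, if_false]
        norm_num
      · have : ¬ (-((n : ℤ) + 1) = (n + 1)) := by omega
        simp only [h, this, and_true, and_self, lt_irrefl, Nat.succ_pos, if_true, if_false]
        norm_num
    · rw [reducedWeight_side hn h (by omega)]; simp [h, hm]; norm_num
  · have h1 : b ≠ n + 1 := by rintro rfl; rw [abs_of_pos hn] at h; omega
    have h2 : b ≠ -(n + 1) := by rintro rfl; rw [abs_neg, abs_of_pos hn] at h; omega
    rw [reducedWeight_eq_zero (fun h' => by omega)]
    simp [-neg_add_rev, h1, h2, h.ne', h.not_gt]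

lemma hasSum_formWeight_mul_exp (n : ℕ) {t : ℝ} (ht : 0 < t) :
    HasSum (fun i : ℤ × ℕ => formWeight n i * Real.exp (-(formDisc n i : ℝ) * t))
      (formSeries (n + 1) t) := by
  have h1 := hasSum_sideWeight_mul_exp (n + 1) t
  have h2 := hasSum_half_geometric (u := 2 * (n + 1) * t) (by positivity)
  have h3 := h1.mul h2 (h1.summable.mul_of_nonneg h2.summable
    (fun b => by dsimp only; split_ifs <;> positivity)
    (fun m => by dsimp only; split_ifs <;> positivity))
  have key : ∀ c : ℤ × ℕ, HasSum (fun i : ℤ × ℕ => (if i = c then 1 / 12 else 0 : ℝ) *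
      Real.exp (-(formDisc n i : ℝ) * t)) (1 / 12 * Real.exp (-(formDisc n c : ℝ) * t)) := fun c => by
    convert! hasSum_ite_eq c (1 / 12 * Real.exp (-(formDisc n c : ℝ) * t)) using 2 with b
    split_ifs with h <;> simp [h]
  have h4 := (h3.mul_left (Real.exp (-(4 * (n + 1) ^ 2) * t))).sub
    ((key (n + 1, 0)).add (key (-(n + 1), 0)))
  convert! h4 using 1
  · ext i
    rw [formWeight_eq, sub_mul, add_mul]
    congr 1
    have : Real.exp (-(formDisc n i : ℝ) * t) = Real.exp (-(4 * (n + 1) ^ 2) * t) *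
        (Real.exp (t * i.1 ^ 2) * Real.exp (-(2 * (2 * (n + 1) * t)) * i.2)) := by
      rw [← Real.exp_add, ← Real.exp_add]
      congr 1
      simp only [formDisc]; push_cast; ring
    rw [this]; ring
  · simp only [formSeries, formDisc]
    push_cast
    ring_nf

lemma hasSum_mellin_formSeries (n : ℕ) {s : ℂ} (hs : 6 ≤ s.re) :
    HasSum (fun i : ℤ × ℕ => Complex.Gamma s * (formWeight n i : ℂ) /
      ((formDisc n i : ℝ) : ℂ) ^ s) (mellin (fun t => (formSeries (n + 1) t : ℂ)) s) := by
  refine hasSum_mellin (fun i => ?_) (by linarith) (fun t ht => ?_) ?_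
  · by_cases h : formWeight n i = 0
    · left; simp [h]
    · right; exact_mod_cast formDisc_pos (abs_le_of_formWeight_ne_zero h)
  · have := Complex.hasSum_ofReal.mpr (hasSum_formWeight_mul_exp n ht)
    simpa using this
  · exact (summable_formWeight hs).comp_injective (i := fun i => (n, i))
      (fun _ _ h => by simpa using h)

lemma Gamma_mul_shintaniZetaSeries_two {s : ℂ} (hs : 6 ≤ s.re) :
    HasSum (fun n : ℕ => mellin (fun t => (formSeries (n + 1) t : ℂ)) s)
      (Complex.Gamma s * 4 ^ (1 - s) * shintaniZetaSeries 2 s) := by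
  rw [shintaniZetaSeries_two_eq hs]
  have h1 : Summable fun x : ℕ × ℤ × ℕ =>
      (formWeight x.1 x.2 : ℂ) / ((formDisc x.1 x.2 : ℝ) : ℂ) ^ s := by
    refine (summable_formWeight hs).of_norm_bounded (fun x => ?_)
    by_cases h : formWeight x.1 x.2 = 0
    · simp [h]
    · have hp := formDisc_pos (abs_le_of_formWeight_ne_zero h)
      have hp' : (0 : ℝ) < formDisc x.1 x.2 := by exact_mod_cast hp
      rw [norm_div, Complex.norm_cpow_eq_rpow_re_of_pos hp']
  have h2 := (h1.hasSum.mul_left (Complex.Gamma s)).prod_fiberwise (fun n => by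
    have := hasSum_mellin_formSeries n hs
    simp_rw [mul_div_assoc] at this
    exact this)
  convert! h2 using 1
  have : (4 : ℂ) ^ (1 - s) * 4 ^ (s - 1) = 1 := by
    rw [← Complex.cpow_add _ _ (by norm_num)]; simp
  linear_combination (Complex.Gamma s * ∑' x : ℕ × ℤ × ℕ,
    (formWeight x.1 x.2 : ℂ) / ((formDisc x.1 x.2 : ℝ) : ℂ) ^ s) * this

open Real in
lemma hasSum_mul_coth_sub_one {u : ℝ} (hu : u ≠ 0) :
    HasSum (fun n : ℕ => 2 * u ^ 2 / (u ^ 2 + (π * (n + 1)) ^ 2))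
      (u * (cosh u / sinh u) - 1) := by
  have hz : Complex.I * u / π ∈ Complex.integerComplement := by
    rintro ⟨n, hn⟩
    have := congrArg Complex.im hn
    rw [mul_div_assoc, ← Complex.ofReal_div] at this
    simp only [Complex.intCast_im, Complex.mul_im, Complex.ofReal_re, Complex.ofReal_im,
      Complex.I_re, Complex.I_im, zero_mul, one_mul, zero_add] at this
    exact div_ne_zero hu pi_ne_zero this.symm
  have h1 := (summable_cotTerm hz).hasSum
  rw [← cot_series_rep' hz] at h1
  have h2 := h1.mul_left (Complex.I * u / π)
  rw [← Complex.hasSum_ofReal]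
  have hπ : (π : ℂ) ≠ 0 := by exact_mod_cast pi_ne_zero
  have hu' : (u : ℂ) ≠ 0 := by exact_mod_cast hu
  convert! h2 using 1
  · ext n
    rw [cotTerm_identity hz]
    have h3 : (u : ℂ) ^ 2 + (π * (n + 1)) ^ 2 ≠ 0 := by
      norm_cast; positivity
    have h4 : (Complex.I * u / π + (n + 1)) * (Complex.I * u / π - (n + 1)) =
        -(u ^ 2 + (π * (n + 1)) ^ 2) / π ^ 2 := by
      field_simp
      linear_combination (u : ℂ) ^ 2 * Complex.I_sq
    rw [h4]
    push_cast
    generalize (u : ℂ) ^ 2 + (π * (n + 1)) ^ 2 = X at *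
    field_simp
    linear_combination Complex.I_sq
  · have hs : (Complex.sinh u) ≠ 0 := by
      rw [← Complex.ofReal_sinh]; exact_mod_cast sinh_eq_zero.not.mpr hu
    have h5 : (π : ℂ) * (Complex.I * u / π) = u * Complex.I := by field_simp
    rw [h5, Complex.cot, Complex.cos_mul_I, Complex.sin_mul_I]
    push_cast
    field_simp

/-- The Taylor coefficients of `u * coth u` as a function of `u ^ 2`. -/
noncomputable def cothCoeff (i : ℕ) : ℝ := 4 ^ i * bernoulli (2 * i) / (2 * i).factorial

lemma cothCoeff_zero : cothCoeff 0 = 1 := by simp [cothCoeff]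

open Real in
lemma hasSum_cothCoeff {k : ℕ} (hk : k ≠ 0) (u : ℝ) :
    HasSum (fun n : ℕ => 2 * (-1) ^ (k + 1) * (u ^ 2 / (π * (n + 1)) ^ 2) ^ k)
      (cothCoeff k * u ^ (2 * k)) := by
  have h := (hasSum_nat_add_iff' 1).mpr (hasSum_zeta_nat hk)
  have h2 := h.mul_left (2 * (-1) ^ (k + 1) * u ^ (2 * k) / π ^ (2 * k))
  have hk2 : 2 * k ≠ 0 := by omega
  convert! h2 using 1
  · ext n
    push_cast
    rw [div_pow, mul_pow, mul_pow, ← pow_mul, ← pow_mul, ← pow_mul]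
    field_simp
  · simp [hk]
    have h3 : (2 : ℝ) * 2 ^ (2 * k - 1) = 4 ^ k := by
      rw [← pow_succ', Nat.sub_add_cancel (by omega), pow_mul]; norm_num
    have h4 : ((-1 : ℝ) ^ (k + 1)) * (-1) ^ (k + 1) = 1 := by rw [← mul_pow]; simp
    have hp : π ^ (2 * k) ≠ 0 := by positivity
    rw [cothCoeff, ← h3]
    field_simp
    rw [← sq] at h4
    rw [h4, mul_one]

lemma abs_geometric_remainder_le (I : ℕ) {q : ℝ} (hq : 0 ≤ q) :
    |2 * q / (1 + q) - ∑ k ∈ Finset.range I, 2 * (-1) ^ (k + 2) * q ^ (k + 1)| ≤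
      2 * q ^ (I + 1) := by
  have h : 2 * q / (1 + q) - ∑ k ∈ Finset.range I, 2 * (-1) ^ (k + 2) * q ^ (k + 1) =
      2 * (-1) ^ I * q ^ (I + 1) / (1 + q) := by
    induction I with
    | zero => simp
    | succ I ih =>
      rw [Finset.sum_range_succ, ← sub_sub, ih]
      field_simp
      ring
  rw [h, abs_div, abs_mul, abs_mul, abs_pow, abs_neg, abs_one, one_pow, abs_two, mul_one,
    abs_of_nonneg (show 0 ≤ q ^ (I + 1) by positivity), abs_of_pos (show 0 < 1 + q by positivity)]
  exact div_le_self (by positivity) (by linarith)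

open Real in
lemma exists_abs_mul_coth_sub_le (I : ℕ) : ∃ C : ℝ, 0 ≤ C ∧ ∀ u : ℝ, u ≠ 0 →
    |u * (cosh u / sinh u) - ∑ i ∈ Finset.range (I + 1), cothCoeff i * u ^ (2 * i)| ≤
      C * u ^ (2 * (I + 1)) := by
  have hs : Summable fun n : ℕ => 2 * (1 / (π * ((n : ℝ) + 1)) ^ 2) ^ (I + 1) := by
    have h := (hasSum_cothCoeff (Nat.succ_ne_zero I) 1).summable.mul_left ((-1) ^ (I + 2))
    refine h.congr fun n => ?_
    have h4 : ((-1 : ℝ) ^ (I + 1 + 1)) * (-1) ^ (I + 1 + 1) = 1 := by rw [← mul_pow]; simp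
    rw [one_pow, Nat.succ_eq_add_one]
    linear_combination (2 * (1 / (π * ((n : ℝ) + 1)) ^ 2) ^ (I + 1)) * h4
  refine ⟨∑' n : ℕ, 2 * (1 / (π * ((n : ℝ) + 1)) ^ 2) ^ (I + 1),
    tsum_nonneg fun n => by positivity, fun u hu => ?_⟩
  have h1 := (hasSum_mul_coth_sub_one hu).sub
    (hasSum_sum fun k (_ : k ∈ Finset.range I) => hasSum_cothCoeff (Nat.succ_ne_zero k) u)
  have h2 : u * (cosh u / sinh u) - 1 - ∑ k ∈ Finset.range I, cothCoeff k.succ * u ^ (2 * k.succ) =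
      u * (cosh u / sinh u) - ∑ i ∈ Finset.range (I + 1), cothCoeff i * u ^ (2 * i) := by
    rw [Finset.sum_range_succ', cothCoeff_zero]
    simp only [Nat.succ_eq_add_one]
    ring
  rw [h2] at h1
  rw [← h1.tsum_eq, mul_comm _ (u ^ (2 * (I + 1))), ← tsum_mul_left, ← Real.norm_eq_abs]
  refine tsum_of_norm_bounded (hs.mul_left _).hasSum fun n => ?_
  have hp : (0 : ℝ) < (π * (n + 1)) ^ 2 := by positivity
  have h3 := abs_geometric_remainder_le I (q := u ^ 2 / (π * (n + 1)) ^ 2) (by positivity)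
  rw [Real.norm_eq_abs]
  have h5 : 2 * u ^ 2 / (u ^ 2 + (π * (n + 1)) ^ 2) =
      2 * (u ^ 2 / (π * (n + 1)) ^ 2) / (1 + u ^ 2 / (π * (n + 1)) ^ 2) := by
    field_simp
    rw [add_comm]
  rw [h5]
  refine h3.trans (le_of_eq ?_)
  rw [div_eq_mul_one_div, mul_pow, ← pow_mul]
  ring

/-- The normalised Bernoulli polynomial `B_n(x) / n!`. -/
noncomputable def bernoulliKernel (n : ℕ) (x : ℝ) : ℝ := bernoulliFun n x / n.factorial

lemma continuous_bernoulliKernel (n : ℕ) : Continuous (bernoulliKernel n) :=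
  (continuous_bernoulliFun n).div_const _

lemma hasDerivAt_bernoulliKernel (n : ℕ) (x : ℝ) :
    HasDerivAt (bernoulliKernel (n + 1)) (bernoulliKernel n x) x := by
  convert! (hasDerivAt_bernoulliFun (n + 1) x).div_const ((n + 1).factorial : ℝ) using 1
  rw [bernoulliKernel, Nat.factorial_succ, Nat.add_sub_cancel]
  push_cast
  have : (n : ℝ) + 1 ≠ 0 := by positivity
  field_simp

section EulerMaclaurin

variable {g : ℕ → ℝ → ℝ}

lemma integral_bernoulliKernel_mul_succ (hg : ∀ n x, HasDerivAt (g n) (g (n + 1) x) x)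
    (n : ℕ) (c : ℝ) :
    ∫ x in (0 : ℝ)..1, bernoulliKernel (n + 1) x * g (n + 1) (c + x) =
      bernoulliKernel (n + 1) 1 * g n (c + 1) - bernoulliKernel (n + 1) 0 * g n c -
        ∫ x in (0 : ℝ)..1, bernoulliKernel n x * g n (c + x) := by
  have hc : ∀ n, Continuous (g n) := fun n =>
    continuous_iff_continuousAt.mpr fun x => (hg n x).continuousAt
  have := intervalIntegral.integral_mul_deriv_eq_deriv_mul (a := (0 : ℝ)) (b := 1)
    (u := bernoulliKernel (n + 1)) (v := fun x => g n (c + x)) (u' := bernoulliKernel n)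
    (v' := fun x => g (n + 1) (c + x)) (fun x _ => hasDerivAt_bernoulliKernel n x)
    (fun x _ => (hg n (c + x)).comp_const_add c x)
    ((continuous_bernoulliKernel n).intervalIntegrable _ _)
    (((hc (n + 1)).comp (continuous_const.add continuous_id)).intervalIntegrable _ _)
  simpa using this

lemma eulerMaclaurin_unit (hg : ∀ n x, HasDerivAt (g n) (g (n + 1) x) x) (J : ℕ) (c : ℝ) :
    g 0 c + g 0 (c + 1) = 2 * (∫ x in (0 : ℝ)..1, g 0 (c + x)) +
      ∑ j ∈ Finset.range J, 2 * (bernoulli (2 * (j + 1)) / (2 * (j + 1)).factorial : ℝ) *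
        (g (2 * j + 1) (c + 1) - g (2 * j + 1) c) +
      2 * ∫ x in (0 : ℝ)..1, bernoulliKernel (2 * J + 1) x * g (2 * J + 1) (c + x) := by
  induction J with
  | zero =>
    have := integral_bernoulliKernel_mul_succ hg 0 c
    simp only [bernoulliKernel, zero_add, bernoulliFun_one, bernoulliFun_zero, Nat.factorial_one,
      Nat.factorial_zero, Nat.cast_one, div_one, one_mul] at this
    simp only [bernoulliKernel, mul_zero, zero_add, Finset.range_zero, Finset.sum_empty,
      bernoulliFun_one, Nat.factorial_one, Nat.cast_one, div_one, this]
    ring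
  | succ J ih =>
    rw [Finset.sum_range_succ, ih]
    have h1 := integral_bernoulliKernel_mul_succ hg (2 * J + 1) c
    have h2 := integral_bernoulliKernel_mul_succ hg (2 * J + 1 + 1) c
    have e1 : bernoulliKernel (2 * J + 1 + 1) 1 = bernoulliKernel (2 * J + 1 + 1) 0 := by
      rw [bernoulliKernel, bernoulliKernel, bernoulliFun_endpoints_eq_of_ne_one (by omega)]
    have e2 : bernoulliKernel (2 * J + 1 + 1) 0 =
        bernoulli (2 * (J + 1)) / (2 * (J + 1)).factorial := by
      rw [bernoulliKernel, bernoulliFun_eval_zero]; rfl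
    have e3 : bernoulliKernel (2 * J + 1 + 1 + 1) 0 = 0 := by
      rw [bernoulliKernel, bernoulliFun_eval_zero,
        bernoulli_eq_zero_of_odd ⟨J + 1, by ring⟩ (by omega)]
      simp
    have e4 : bernoulliKernel (2 * J + 1 + 1 + 1) 1 = 0 := by
      rw [← e3, bernoulliKernel, bernoulliKernel, bernoulliFun_endpoints_eq_of_ne_one (by omega)]
    rw [e1, e2] at h1
    rw [e3, e4] at h2
    rw [show 2 * (J + 1) + 1 = 2 * J + 1 + 1 + 1 by ring, h2]
    linear_combination (2 : ℝ) * h1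

lemma eulerMaclaurin (hg : ∀ n x, HasDerivAt (g n) (g (n + 1) x) x) (J a : ℕ) :
    ∑ k ∈ Finset.range a, (g 0 k + g 0 (k + 1)) = 2 * (∫ x in (0 : ℝ)..a, g 0 x) +
      ∑ j ∈ Finset.range J, 2 * (bernoulli (2 * (j + 1)) / (2 * (j + 1)).factorial : ℝ) *
        (g (2 * j + 1) a - g (2 * j + 1) 0) +
      2 * ∑ k ∈ Finset.range a,
        ∫ x in (0 : ℝ)..1, bernoulliKernel (2 * J + 1) x * g (2 * J + 1) (k + x) := by
  have hc : ∀ n, Continuous (g n) := fun n =>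
    continuous_iff_continuousAt.mpr fun x => (hg n x).continuousAt
  induction a with
  | zero => simp
  | succ a ih =>
    have h1 := eulerMaclaurin_unit hg J a
    have h2 : ∫ x in (0 : ℝ)..1, g 0 (a + x) = ∫ x in (a : ℝ)..(a + 1), g 0 x := by
      rw [intervalIntegral.integral_comp_add_left]; simp
    have h3 := intervalIntegral.integral_add_adjacent_intervals (μ := MeasureTheory.volume)
      ((hc 0).intervalIntegrable 0 (a : ℝ)) ((hc 0).intervalIntegrable (a : ℝ) (a + 1))
    have h4 : ∑ j ∈ Finset.range J, 2 * (bernoulli (2 * (j + 1)) / (2 * (j + 1)).factorial : ℝ) *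
        (g (2 * j + 1) (a + 1) - g (2 * j + 1) 0) =
      ∑ j ∈ Finset.range J, 2 * (bernoulli (2 * (j + 1)) / (2 * (j + 1)).factorial : ℝ) *
        (g (2 * j + 1) a - g (2 * j + 1) 0) +
      ∑ j ∈ Finset.range J, 2 * (bernoulli (2 * (j + 1)) / (2 * (j + 1)).factorial : ℝ) *
        (g (2 * j + 1) (a + 1) - g (2 * j + 1) a) := by
      rw [← Finset.sum_add_distrib]
      exact Finset.sum_congr rfl fun j _ => by ring
    rw [Finset.sum_range_succ, Finset.sum_range_succ, ih, h1, h2, mul_add]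
    push_cast
    rw [← h3, h4]
    ring

lemma abs_eulerMaclaurin_remainder_le (n : ℕ) : ∃ C : ℝ, 0 ≤ C ∧ ∀ (f : ℝ → ℝ) (M : ℝ) (a : ℕ),
    (∀ x : ℝ, 0 ≤ x → x ≤ a → |f x| ≤ M) →
    |2 * ∑ k ∈ Finset.range a, ∫ x in (0 : ℝ)..1, bernoulliKernel n x * f (k + x)| ≤
      C * (a * M) := by
  obtain ⟨C, hC⟩ := (isCompact_Icc (a := (0 : ℝ)) (b := 1)).exists_bound_of_continuousOn
    (continuous_bernoulliKernel n).continuousOn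
  have hC0 : 0 ≤ C := (norm_nonneg _).trans (hC 0 (by simp))
  refine ⟨2 * C, by positivity, fun f M a hf => ?_⟩
  rw [abs_mul, abs_two, mul_assoc]
  refine mul_le_mul_of_nonneg_left ?_ zero_le_two
  refine (Finset.abs_sum_le_sum_abs _ _).trans ?_
  have : ∀ k ∈ Finset.range a,
      |∫ x in (0 : ℝ)..1, bernoulliKernel n x * f (k + x)| ≤ C * M := by
    intro k hk
    have hk' : (k : ℝ) + 1 ≤ a := by exact_mod_cast Finset.mem_range.mp hk
    have h := intervalIntegral.norm_integral_le_of_norm_le_const (a := (0 : ℝ)) (b := 1)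
      (f := fun x => bernoulliKernel n x * f (k + x)) (C := C * M) (fun x hx => ?_)
    · simpa using h
    · rw [Set.uIoc_of_le zero_le_one] at hx
      rw [norm_mul]
      exact mul_le_mul (hC x ⟨hx.1.le, hx.2⟩)
        (hf _ (add_nonneg k.cast_nonneg hx.1.le) (by linarith [hx.2])) (norm_nonneg _) hC0
  refine (Finset.sum_le_sum this).trans (le_of_eq ?_)
  simp
  ring

end EulerMaclaurin

open Polynomial in
/-- `D ^ (2 * j) exp (t * x ^ 2) = t ^ j * p (t * x ^ 2) * exp (t * x ^ 2)` with
`p = gaussEvenPoly j`. -/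
noncomputable def gaussEvenPoly : ℕ → Polynomial ℝ
  | 0 => 1
  | j + 1 => 2 * (derivative (gaussEvenPoly j) + gaussEvenPoly j) +
      2 * X * (derivative (2 * (derivative (gaussEvenPoly j) + gaussEvenPoly j)) +
        2 * (derivative (gaussEvenPoly j) + gaussEvenPoly j))

open Polynomial in
/-- `D ^ (2 * j + 1) exp (t * x ^ 2) = t ^ (j + 1) * x * q (t * x ^ 2) * exp (t * x ^ 2)` with
`q = gaussOddPoly j`. -/
noncomputable def gaussOddPoly (j : ℕ) : Polynomial ℝ :=
  2 * (derivative (gaussEvenPoly j) + gaussEvenPoly j)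

open Polynomial in
lemma gaussEvenPoly_succ (j : ℕ) : gaussEvenPoly (j + 1) =
    gaussOddPoly j + 2 * X * (derivative (gaussOddPoly j) + gaussOddPoly j) := rfl

open Polynomial in
lemma gaussPoly_recursion (j : ℕ) :
    gaussOddPoly j + 2 * X * derivative (gaussOddPoly j) =
        ((4 * j + 2 : ℕ) : Polynomial ℝ) * gaussEvenPoly j := by
  induction j with
  | zero => simp [gaussOddPoly, gaussEvenPoly]
  | succ j ih =>
    have h1 : gaussEvenPoly (j + 1) =
        ((4 * j + 2 : ℕ) : Polynomial ℝ) * gaussEvenPoly j + 2 * X * gaussOddPoly j := by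
      rw [← ih, gaussEvenPoly_succ]; ring
    have hq : gaussOddPoly j = 2 * (derivative (gaussEvenPoly j) + gaussEvenPoly j) := rfl
    have h2 : derivative (gaussEvenPoly (j + 1)) = (2 * j + 2 : ℕ) * gaussOddPoly j := by
      rw [h1]
      simp only [derivative_add, derivative_mul, derivative_natCast, derivative_X,
        derivative_ofNat]
      push_cast at ih ⊢
      linear_combination ih - (2 * (j : Polynomial ℝ) + 1) * hq
    have hq' : gaussOddPoly (j + 1) =
        2 * (derivative (gaussEvenPoly (j + 1)) + gaussEvenPoly (j + 1)) := rfl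
    rw [hq', h2]
    simp only [derivative_add, derivative_mul, derivative_natCast,
        derivative_ofNat, h2]
    push_cast at h1 ih ⊢
    linear_combination 4 * ((j : Polynomial ℝ) + 1) * ih - 4 * ((j : Polynomial ℝ) + 1) * h1

lemma coeff_zero_gaussPoly (j : ℕ) :
    (gaussEvenPoly j).coeff 0 = ((2 * j).factorial : ℝ) / j.factorial ∧
      (gaussOddPoly j).coeff 0 = ((2 * (j + 1)).factorial : ℝ) / (j + 1).factorial := by
  have h0 : ∀ j, (gaussOddPoly j).coeff 0 = (4 * j + 2) * (gaussEvenPoly j).coeff 0 := by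
    intro j
    have := congrArg (Polynomial.coeff · 0) (gaussPoly_recursion j)
    simp only [Polynomial.coeff_zero_eq_eval_zero] at this ⊢
    simpa using this
  have h1 : ∀ j, (gaussEvenPoly (j + 1)).coeff 0 = (gaussOddPoly j).coeff 0 := by
    intro j
    rw [gaussEvenPoly_succ]
    simp [Polynomial.coeff_zero_eq_eval_zero]
  have h2 : ∀ j, (gaussEvenPoly j).coeff 0 = ((2 * j).factorial : ℝ) / j.factorial := by
    intro j
    induction j with
    | zero => simp [gaussEvenPoly]
    | succ j ih =>
      rw [h1, h0, ih, mul_add, mul_one, Nat.factorial_succ, Nat.factorial_succ, Nat.factorial_succ]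
      push_cast
      field_simp
      ring
  exact ⟨h2 j, by rw [← h1, h2]⟩

/-- The derivatives of `exp (t * x ^ 2)` with respect to `x`. -/
noncomputable def gaussDeriv (t : ℝ) (n : ℕ) (x : ℝ) : ℝ :=
  (if Even n then t ^ (n / 2) * (gaussEvenPoly (n / 2)).eval (t * x ^ 2) else
    t ^ (n / 2 + 1) * (x * (gaussOddPoly (n / 2)).eval (t * x ^ 2))) * Real.exp (t * x ^ 2)

lemma gaussDeriv_even (t : ℝ) (j : ℕ) (x : ℝ) : gaussDeriv t (2 * j) x =
    t ^ j * (gaussEvenPoly j).eval (t * x ^ 2) * Real.exp (t * x ^ 2) := by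
  simp [gaussDeriv]

lemma gaussDeriv_odd (t : ℝ) (j : ℕ) (x : ℝ) : gaussDeriv t (2 * j + 1) x =
    t ^ (j + 1) * (x * (gaussOddPoly j).eval (t * x ^ 2)) * Real.exp (t * x ^ 2) := by
  have : (2 * j + 1) / 2 = j := by omega
  simp [gaussDeriv, this]

lemma hasDerivAt_gaussDeriv (t : ℝ) (n : ℕ) (x : ℝ) :
    HasDerivAt (gaussDeriv t n) (gaussDeriv t (n + 1) x) x := by
  have hu : HasDerivAt (fun x : ℝ => t * x ^ 2) (2 * t * x) x := by
    convert! (hasDerivAt_pow 2 x).const_mul t using 1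
    norm_num; ring
  have hP : ∀ p : Polynomial ℝ, HasDerivAt (fun x => p.eval (t * x ^ 2))
      ((Polynomial.derivative p).eval (t * x ^ 2) * (2 * t * x)) x := fun p =>
    (p.hasDerivAt (t * x ^ 2)).comp (h := fun x : ℝ => t * x ^ 2) x hu
  rcases Nat.even_or_odd' n with ⟨j, rfl | rfl⟩
  · rw [gaussDeriv_odd, show gaussDeriv t (2 * j) = _ from funext (gaussDeriv_even t j)]
    convert! ((hP (gaussEvenPoly j)).const_mul (t ^ j)).mul hu.exp using 1
    simp [gaussOddPoly]
    ring
  · rw [show 2 * j + 1 + 1 = 2 * (j + 1) by ring, gaussDeriv_even,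
      show gaussDeriv t (2 * j + 1) = _ from funext (gaussDeriv_odd t j)]
    convert! (((hasDerivAt_id x).mul (hP (gaussOddPoly j))).const_mul (t ^ (j + 1))).mul hu.exp
      using 1
    simp [gaussEvenPoly_succ]
    ring

lemma exists_abs_eval_le_mul_exp (p : Polynomial ℝ) {c : ℝ} (hc : 0 < c) :
    ∃ C : ℝ, 0 ≤ C ∧ ∀ x : ℝ, 0 ≤ x → |p.eval x| ≤ C * Real.exp (c * x) := by
  refine ⟨∑ i ∈ Finset.range (p.natDegree + 1), |p.coeff i| * (i.factorial / c ^ i),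
    Finset.sum_nonneg fun i _ => by positivity, fun x hx => ?_⟩
  rw [Polynomial.eval_eq_sum_range, Finset.sum_mul]
  refine (Finset.abs_sum_le_sum_abs _ _).trans (Finset.sum_le_sum fun i _ => ?_)
  rw [abs_mul, abs_of_nonneg (pow_nonneg hx i), mul_assoc]
  refine mul_le_mul_of_nonneg_left ?_ (abs_nonneg _)
  have := Real.pow_div_factorial_le_exp (c * x) (by positivity) i
  rw [div_le_iff₀' (by positivity), mul_pow] at this
  rw [div_mul_eq_mul_div, le_div_iff₀' (by positivity)]
  exact this

/-- The Euler-Maclaurin approximation of `thetaSum`. -/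
noncomputable def thetaMain (J a : ℕ) (t : ℝ) : ℝ :=
  2 * (∫ x in (0 : ℝ)..a, Real.exp (t * x ^ 2)) +
    ∑ j ∈ Finset.range J, 2 * (bernoulli (2 * (j + 1)) / (2 * (j + 1)).factorial : ℝ) *
      (t ^ (j + 1) * (a * (gaussOddPoly j).eval (t * a ^ 2)) * Real.exp (t * a ^ 2))

lemma exists_abs_thetaSum_sub_le (I : ℕ) : ∃ C : ℝ, 0 ≤ C ∧ ∀ (a : ℕ) (t : ℝ), 0 < t →
    |thetaSum a t - thetaMain (I + 1) a t| ≤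
      C * (a * t ^ (I + 1) * Real.exp (2 * (t * a ^ 2))) := by
  obtain ⟨C, hC0, hC⟩ := abs_eulerMaclaurin_remainder_le (2 * (I + 1) + 1)
  obtain ⟨D, hD0, hD⟩ := exists_abs_eval_le_mul_exp (gaussOddPoly (I + 1)) (c := 1 / 2) (by norm_num)
  refine ⟨C * (2 * D), by positivity, fun a t ht => ?_⟩
  have h := eulerMaclaurin (hasDerivAt_gaussDeriv t) (I + 1) a
  have h0 : ∀ x, gaussDeriv t 0 x = Real.exp (t * x ^ 2) := fun x => by
    simpa [gaussEvenPoly] using gaussDeriv_even t 0 x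
  simp only [h0, gaussDeriv_odd, mul_zero, zero_mul, sub_zero] at h
  rw [thetaSum, h, thetaMain, add_sub_cancel_left]
  rcases Nat.eq_zero_or_pos a with rfl | ha
  · simp
  have ha1 : (1 : ℝ) ≤ a := by exact_mod_cast ha
  refine (hC (fun y => t ^ (I + 1 + 1) * (y * (gaussOddPoly (I + 1)).eval (t * y ^ 2)) *
    Real.exp (t * y ^ 2)) (2 * D * (t ^ (I + 1) * Real.exp (2 * (t * a ^ 2)))) a
    fun x hx hxa => ?_).trans (le_of_eq (by ring))
  have hq := hD (t * x ^ 2) (by positivity)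
  have h1 : t * x ^ 2 ≤ t * a ^ 2 := by gcongr
  have h2 : t * x ≤ 2 * Real.exp (1 / 2 * (t * a ^ 2)) := by
    have := Real.add_one_le_exp (1 / 2 * (t * a ^ 2))
    have : t * x ≤ t * a ^ 2 := by gcongr; nlinarith
    linarith
  have h3 : Real.exp (2 * (t * a ^ 2)) = Real.exp (1 / 2 * (t * a ^ 2)) *
      Real.exp (1 / 2 * (t * a ^ 2)) * Real.exp (t * a ^ 2) := by
    rw [← Real.exp_add, ← Real.exp_add]; ring_nf
  rw [abs_mul, abs_mul, abs_mul, abs_of_pos (Real.exp_pos _), abs_of_nonneg hx,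
    abs_of_pos (by positivity : 0 < t ^ (I + 1 + 1))]
  calc t ^ (I + 1 + 1) * (x * |(gaussOddPoly (I + 1)).eval (t * x ^ 2)|) * Real.exp (t * x ^ 2)
      = t ^ (I + 1) * ((t * x) * |(gaussOddPoly (I + 1)).eval (t * x ^ 2)| *
          Real.exp (t * x ^ 2)) := by ring
    _ ≤ t ^ (I + 1) * ((2 * Real.exp (1 / 2 * (t * a ^ 2))) *
          (D * Real.exp (1 / 2 * (t * a ^ 2))) * Real.exp (t * a ^ 2)) := by
        gcongr
        exact hq.trans (by gcongr)
    _ = _ := by rw [h3]; ring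

/-- The truncated expansion of `u * coth u`. -/
noncomputable def cothMain (I : ℕ) (u : ℝ) : ℝ :=
  ∑ i ∈ Finset.range (I + 1), cothCoeff i * u ^ (2 * i)

/-- The truncated asymptotic expansion of `formSeries`. -/
noncomputable def formMain (I a : ℕ) (t : ℝ) : ℝ :=
  Real.exp (-(4 * a ^ 2) * t) * (1 / (4 * a * t) * cothMain I (2 * a * t)) * thetaMain (I + 1) a t -
    1 / 6 * Real.exp (-(3 * a ^ 2) * t)

lemma pow_le_factorial_mul_exp {x : ℝ} (hx : 0 ≤ x) (n : ℕ) :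
    x ^ n ≤ n.factorial * Real.exp x := by
  have := Real.pow_div_factorial_le_exp x hx n
  rwa [div_le_iff₀' (by positivity)] at this

lemma abs_thetaSum_le (a : ℕ) {t : ℝ} (ht : 0 < t) :
    |thetaSum a t| ≤ 2 * a * Real.exp (t * a ^ 2) := by
  rw [thetaSum, abs_of_nonneg (Finset.sum_nonneg fun _ _ => by positivity)]
  have : ∀ k ∈ Finset.range a, Real.exp (t * k ^ 2) + Real.exp (t * (k + 1) ^ 2) ≤
      2 * Real.exp (t * a ^ 2) := by
    intro k hk
    have hk' : (k : ℝ) + 1 ≤ a := by exact_mod_cast Finset.mem_range.mp hk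
    have hk0 : (0 : ℝ) ≤ k := k.cast_nonneg
    have h1 : Real.exp (t * k ^ 2) ≤ Real.exp (t * a ^ 2) := by
      gcongr
      exact (Finset.mem_range.mp hk).le
    have h2 : Real.exp (t * (k + 1) ^ 2) ≤ Real.exp (t * a ^ 2) := by gcongr
    linarith
  refine (Finset.sum_le_sum this).trans (le_of_eq ?_)
  simp
  ring

lemma exists_abs_cothMain_le (I : ℕ) : ∃ C : ℝ, 0 ≤ C ∧ ∀ (a : ℕ) (t : ℝ), 0 < a → 0 < t →
    |cothMain I (2 * a * t)| ≤ C * Real.exp (t * a ^ 2) := by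
  refine ⟨∑ i ∈ Finset.range (I + 1), |cothCoeff i| * (4 ^ i * (2 * i).factorial),
    Finset.sum_nonneg fun _ _ => by positivity, fun a t ha ht => ?_⟩
  have ha1 : (1 : ℝ) ≤ a := by exact_mod_cast ha
  rw [cothMain, Finset.sum_mul]
  refine (Finset.abs_sum_le_sum_abs _ _).trans (Finset.sum_le_sum fun i _ => ?_)
  rw [abs_mul, abs_of_nonneg (by positivity : (0 : ℝ) ≤ (2 * a * t) ^ (2 * i)),
    mul_assoc |cothCoeff i|]
  refine mul_le_mul_of_nonneg_left ?_ (abs_nonneg _)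
  have h1 : ((a : ℝ) * t) ^ (2 * i) ≤ (t * (a : ℝ) ^ 2) ^ (2 * i) := by
    have h : (a : ℝ) * t ≤ t * (a : ℝ) ^ 2 := by
      nlinarith [mul_le_mul_of_nonneg_left ha1 (by positivity : 0 ≤ t * (a : ℝ))]
    exact pow_le_pow_left₀ (by positivity) h _
  have h2 := pow_le_factorial_mul_exp (by positivity : 0 ≤ t * (a : ℝ) ^ 2) (2 * i)
  calc (2 * a * t) ^ (2 * i) = 4 ^ i * (a * t) ^ (2 * i) := by
        rw [mul_assoc, mul_pow, pow_mul]; norm_num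
    _ ≤ 4 ^ i * ((2 * i).factorial * Real.exp (t * a ^ 2)) := by
        gcongr; exact h1.trans h2
    _ = _ := by ring

lemma exists_abs_formSeries_sub_le (I : ℕ) : ∃ C : ℝ, 0 ≤ C ∧ ∀ (a : ℕ) (t : ℝ), 0 < a → 0 < t →
    |formSeries a t - formMain I a t| ≤ C * (t ^ I * Real.exp (-(a ^ 2 * t))) := by
  obtain ⟨A, hA0, hA⟩ := exists_abs_mul_coth_sub_le I
  obtain ⟨B, hB0, hB⟩ := exists_abs_thetaSum_sub_le I
  obtain ⟨D, hD0, hD⟩ := exists_abs_cothMain_le I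
  refine ⟨2 * (4 ^ I * A * (I + 1).factorial) + D * B / 4, by positivity, fun a t ha ht => ?_⟩
  have ha1 : (1 : ℝ) ≤ a := by exact_mod_cast ha
  have ha0 : (0 : ℝ) < a := by linarith
  set τ := t * (a : ℝ) ^ 2 with hτ
  have hτ0 : 0 ≤ τ := by positivity
  have hu : 2 * a * t ≠ 0 := by positivity
  have h1 := hA (2 * a * t) hu
  have h2 := hB a t ht
  have h3 := hD a t ha ht
  have h4 := abs_thetaSum_le a ht
  rw [← hτ] at h2 h3 h4
  set u := 2 * (a : ℝ) * t with hu_def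
  have hupos : 0 < u := by positivity
  have e : formSeries a t - formMain I a t = Real.exp (-(4 * τ)) * (1 / (2 * u)) *
      ((u * (Real.cosh u / Real.sinh u) - cothMain I u) * thetaSum a t +
        cothMain I u * (thetaSum a t - thetaMain (I + 1) a t)) := by
    have e1 : -(4 * (a : ℝ) ^ 2) * t = -(4 * τ) := by rw [hτ]; ring
    have e2 : 4 * (a : ℝ) * t = 2 * u := by rw [hu_def]; ring
    rw [formSeries, formMain, e1, e2, ← hu_def]
    field_simp
    ring
  rw [e, abs_mul, abs_of_pos (by positivity : 0 < Real.exp (-(4 * τ)) * (1 / (2 * u)))]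
  have h5 : |(u * (Real.cosh u / Real.sinh u) - cothMain I u) * thetaSum a t +
        cothMain I u * (thetaSum a t - thetaMain (I + 1) a t)| ≤
      A * u ^ (2 * (I + 1)) * (2 * a * Real.exp τ) +
        D * Real.exp τ * (B * (a * t ^ (I + 1) * Real.exp (2 * τ))) := by
    refine (abs_add_le _ _).trans ?_
    rw [abs_mul, abs_mul]
    gcongr
    exact h1
  have h6 : A * u ^ (2 * (I + 1)) * (2 * a * Real.exp τ) ≤
      2 * u * (2 * (4 ^ I * A * (I + 1).factorial)) * (t ^ I * Real.exp (3 * τ)) := by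
    have e3 : A * u ^ (2 * (I + 1)) * (2 * a * Real.exp τ) =
        2 * u * (2 * (4 ^ I * A) * t ^ I) * (τ ^ (I + 1) * Real.exp τ) := by
      have e4 : (4 : ℝ) ^ I = 2 ^ (I * 2) := by rw [mul_comm, pow_mul]; norm_num
      rw [hτ, hu_def, e4]
      ring
    have e4 : τ ^ (I + 1) * Real.exp τ ≤ (I + 1).factorial * Real.exp (3 * τ) := by
      have e5 : Real.exp (3 * τ) = Real.exp τ * Real.exp (2 * τ) := by
        rw [← Real.exp_add]; ring_nf
      have e6 := pow_le_factorial_mul_exp hτ0 (I + 1)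
      have e7 : Real.exp τ ≤ Real.exp (2 * τ) := by gcongr; linarith
      rw [e5, ← mul_assoc]
      gcongr
    rw [e3]
    refine (mul_le_mul_of_nonneg_left e4 (by positivity)).trans (le_of_eq (by ring))
  have h7 : D * Real.exp τ * (B * (a * t ^ (I + 1) * Real.exp (2 * τ))) =
      2 * u * (D * B / 4) * (t ^ I * Real.exp (3 * τ)) := by
    have e5 : Real.exp (3 * τ) = Real.exp τ * Real.exp (2 * τ) := by
      rw [← Real.exp_add]; ring_nf
    rw [e5, hu_def]
    ring
  have h8 : Real.exp (-(4 * τ)) * Real.exp (3 * τ) = Real.exp (-(a ^ 2 * t)) := by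
    rw [← Real.exp_add, hτ]; ring_nf
  calc _ ≤ Real.exp (-(4 * τ)) * (1 / (2 * u)) *
        (2 * u * (2 * (4 ^ I * A * (I + 1).factorial)) * (t ^ I * Real.exp (3 * τ)) +
          2 * u * (D * B / 4) * (t ^ I * Real.exp (3 * τ))) := by
        refine mul_le_mul_of_nonneg_left ?_ (by positivity)
        rw [← h7]
        exact h5.trans (by gcongr)
    _ = _ := by
      rw [← h8]
      field_simp

/-- The Laplace transform of the distribution of `φ` on `[0, 1]`. -/
noncomputable def laplaceKernel (φ : ℝ → ℝ) (τ : ℝ) : ℝ := ∫ θ in (0 : ℝ)..1, Real.exp (-(φ θ * τ))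

/-- The negative moments of `φ` on `[0, 1]`. -/
noncomputable def negMoment (φ : ℝ → ℝ) (w : ℂ) : ℂ :=
  ∫ θ in (0 : ℝ)..1, Complex.exp (-(w * Real.log (φ θ)))

lemma differentiable_negMoment {φ : ℝ → ℝ} (hφ : Continuous φ) (h3 : ∀ θ, 0 ≤ θ → θ ≤ 1 → 3 ≤ φ θ)
    (h4 : ∀ θ, 0 ≤ θ → θ ≤ 1 → φ θ ≤ 4) : Differentiable ℂ (negMoment φ) := by
  intro w
  have hmeas : Measurable fun θ => Real.log (φ θ) := Real.measurable_log.comp hφ.measurable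
  have hlog : ∀ θ ∈ Set.uIoc (0 : ℝ) 1, |Real.log (φ θ)| ≤ Real.log 4 := by
    intro θ hθ
    rw [Set.uIoc_of_le zero_le_one] at hθ
    have h1 := h3 θ hθ.1.le hθ.2
    have h2 := h4 θ hθ.1.le hθ.2
    rw [abs_of_nonneg (Real.log_nonneg (by linarith))]
    exact Real.log_le_log (by linarith) h2
  have hb : ∀ θ ∈ Set.uIoc (0 : ℝ) 1, ∀ x : ℂ, ‖Complex.exp (-(x * Real.log (φ θ)))‖ ≤
      Real.exp (‖x‖ * Real.log 4) := by
    intro θ hθ x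
    refine (Complex.norm_exp_le_exp_norm _).trans (Real.exp_le_exp.mpr ?_)
    rw [norm_neg, norm_mul, Complex.norm_real]
    exact mul_le_mul_of_nonneg_left (hlog θ hθ) (norm_nonneg _)
  have key := intervalIntegral.hasDerivAt_integral_of_dominated_loc_of_deriv_le (𝕜 := ℂ)
    (μ := MeasureTheory.volume) (a := (0 : ℝ)) (b := 1) (x₀ := w) (s := Metric.ball w 1)
    (F := fun w θ => Complex.exp (-(w * Real.log (φ θ))))
    (F' := fun w θ => Complex.exp (-(w * Real.log (φ θ))) * -(Real.log (φ θ) : ℂ))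
    (bound := fun _ => Real.exp ((‖w‖ + 1) * Real.log 4) * Real.log 4)
    (Metric.ball_mem_nhds _ one_pos) ?_ ?_ ?_ ?_ ?_ ?_
  · exact key.2.differentiableAt
  · exact Filter.Eventually.of_forall fun x => Measurable.aestronglyMeasurable (by fun_prop)
  · refine (intervalIntegrable_const (c := Real.exp (‖w‖ * Real.log 4))).mono_fun
      (Measurable.aestronglyMeasurable (by fun_prop)) ?_
    refine (MeasureTheory.ae_restrict_iff' measurableSet_uIoc).mpr (Filter.Eventually.of_forall ?_)
    intro θ hθ
    simpa using hb θ hθ w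
  · exact Measurable.aestronglyMeasurable (by fun_prop)
  · refine Filter.Eventually.of_forall fun θ hθ x hx => ?_
    rw [norm_mul, norm_neg, Complex.norm_real]
    refine mul_le_mul ((hb θ hθ x).trans ?_) (hlog θ hθ) (norm_nonneg _) (Real.exp_nonneg _)
    have h1 : ‖x‖ ≤ ‖w‖ + 1 := by
      have h2 := norm_add_le w (x - w)
      rw [add_sub_cancel] at h2
      have h3 := mem_ball_iff_norm.mp hx
      linarith
    have h0 : 0 ≤ Real.log 4 := Real.log_nonneg (by norm_num)
    gcongr
  · exact intervalIntegrable_const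
  · refine Filter.Eventually.of_forall fun θ hθ x hx => ?_
    have := ((hasDerivAt_id x).mul_const (Real.log (φ θ) : ℂ)).fun_neg.cexp
    simpa using this

open MeasureTheory in
lemma integrable_cpow_mul_exp_prod {φ : ℝ → ℝ} (hφ : Continuous φ)
    (h3 : ∀ θ, 0 ≤ θ → θ ≤ 1 → 3 ≤ φ θ) {w : ℂ} (hw : 0 < w.re) {r : ℝ} (hr : 0 < r) :
    Integrable (Function.uncurry fun (t : ℝ) (θ : ℝ) =>
      (t : ℂ) ^ (w - 1) * Complex.exp (-((φ θ * r : ℝ) * t)))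
      ((volume.restrict (Set.Ioi 0)).prod (volume.restrict (Set.Ioc 0 1))) := by
  have h1 : IntegrableOn (fun t : ℝ => t ^ (w.re - 1) * Real.exp (-(3 * r) * t)) (Set.Ioi 0) := by
    have := integrableOn_rpow_mul_exp_neg_mul_rpow (p := 1) (s := w.re - 1) (b := 3 * r)
      (by linarith) one_pos (by positivity)
    simpa using this
  have h2 : IntegrableOn (fun _ : ℝ => (1 : ℝ)) (Set.Ioc 0 1) := by
    simp
  refine (h1.mul_prod h2).mono' (Measurable.aestronglyMeasurable ?_) ?_
  · have := hφ.measurable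
    simp only [Function.uncurry_def]
    fun_prop
  · rw [Measure.prod_restrict]
    refine (ae_restrict_iff' (measurableSet_Ioi.prod measurableSet_Ioc)).mpr
      (Filter.Eventually.of_forall ?_)
    rintro ⟨t, θ⟩ ⟨ht, hθ⟩
    simp only [Set.mem_Ioi, Set.mem_Ioc] at ht hθ
    simp only [Function.uncurry_apply_pair]
    rw [norm_mul, Complex.norm_cpow_eq_rpow_re_of_pos ht, Complex.norm_exp, mul_one]
    have h := h3 θ hθ.1.le hθ.2
    have e : (-(((φ θ * r : ℝ) : ℂ) * (t : ℂ))).re = -(φ θ * r * t) := by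
      rw [← Complex.ofReal_mul, ← Complex.ofReal_neg, Complex.ofReal_re]
    rw [e, Complex.sub_re, Complex.one_re]
    gcongr
    have : 0 < r * t := by positivity
    nlinarith

lemma ofReal_laplaceKernel (φ : ℝ → ℝ) (τ : ℝ) :
    (laplaceKernel φ τ : ℂ) = ∫ θ in (0 : ℝ)..1, Complex.exp (-(φ θ * τ : ℝ)) := by
  rw [laplaceKernel, ← intervalIntegral.integral_ofReal]
  simp

open MeasureTheory in
lemma hasMellin_laplaceKernel {φ : ℝ → ℝ} (hφ : Continuous φ)
    (h3 : ∀ θ, 0 ≤ θ → θ ≤ 1 → 3 ≤ φ θ) {w : ℂ} (hw : 0 < w.re) {r : ℝ} (hr : 0 < r) :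
    HasMellin (fun t => (laplaceKernel φ (r * t) : ℂ)) w
      (Complex.Gamma w * negMoment φ w * (r : ℂ) ^ (-w)) := by
  have hprod := integrable_cpow_mul_exp_prod hφ h3 hw hr
  have e : ∀ t : ℝ, (t : ℂ) ^ (w - 1) • (laplaceKernel φ (r * t) : ℂ) =
      ∫ θ in Set.Ioc (0 : ℝ) 1, (t : ℂ) ^ (w - 1) * Complex.exp (-((φ θ * r : ℝ) * t)) := by
    intro t
    rw [ofReal_laplaceKernel, intervalIntegral.integral_of_le zero_le_one, smul_eq_mul,
      ← integral_const_mul]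
    congr! 5
    push_cast
    ring
  refine ⟨?_, ?_⟩
  · rw [MellinConvergent]
    simp_rw [e]
    exact hprod.integral_prod_left
  · rw [mellin]
    simp_rw [e]
    rw [integral_integral_swap hprod, negMoment, intervalIntegral.integral_of_le zero_le_one,
      mul_right_comm, ← integral_const_mul]
    refine setIntegral_congr_fun measurableSet_Ioc fun θ hθ => ?_
    have h := h3 θ hθ.1.le hθ.2
    have hpos : 0 < φ θ := by linarith
    rw [Complex.integral_cpow_mul_exp_neg_mul_Ioi hw (by positivity), one_div, ← Complex.ofReal_inv,
      mul_inv, Complex.ofReal_mul, Complex.mul_cpow_ofReal_nonneg (by positivity) (by positivity)]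
    have e1 : ((r⁻¹ : ℝ) : ℂ) ^ w = (r : ℂ) ^ (-w) := by
      rw [Complex.cpow_neg, Complex.ofReal_inv, Complex.inv_cpow]
      rw [Complex.arg_ofReal_of_nonneg hr.le]
      exact Real.pi_pos.ne
    have e2 : (((φ θ)⁻¹ : ℝ) : ℂ) ^ w = Complex.exp (-(w * Real.log (φ θ))) := by
      rw [Complex.cpow_def_of_ne_zero (by exact_mod_cast (by positivity : (φ θ)⁻¹ ≠ 0)),
        ← Complex.ofReal_log (by positivity), Real.log_inv]
      push_cast
      ring_nf
    rw [e1, e2]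
    ring

/-- The Mellin transforms of the family `f 1, f 2, …` sum to `Gamma * g` on the strip
`6 ≤ re s < 10`, and `g` extends from there to the part of the strip `-(k + 1) < re s < 10` in the
upper half plane and to the point `-k`. -/
structure HasMellinSum (k : ℕ) (f : ℕ → ℝ → ℝ) (g : ℂ → ℂ) : Prop where
  convergent : ∀ s : ℂ, 6 ≤ s.re → s.re < 10 → ∀ n : ℕ,
    MellinConvergent (fun t => (f (n + 1) t : ℂ)) s
  hasSum : ∀ s : ℂ, 6 ≤ s.re → s.re < 10 →
    HasSum (fun n : ℕ => mellin (fun t => (f (n + 1) t : ℂ)) s) (Complex.Gamma s * g s)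
  differentiableAt : ∀ s : ℂ, -(k + 1 : ℝ) < s.re → s.re < 10 → 0 < s.im → DifferentiableAt ℂ g s
  continuousAt : ContinuousAt g (-k)

lemma mellin_congr {f g : ℝ → ℂ} (h : ∀ t, 0 < t → f t = g t) (s : ℂ) :
    mellin f s = mellin g s :=
  MeasureTheory.setIntegral_congr_fun measurableSet_Ioi fun t ht => by
    simp only [h t ht]

lemma mellinConvergent_congr {f g : ℝ → ℂ} (h : ∀ t, 0 < t → f t = g t) {s : ℂ}
    (hf : MellinConvergent f s) : MellinConvergent g s :=
  (MeasureTheory.integrableOn_congr_fun (fun t ht => by simp only [h t ht])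
    measurableSet_Ioi).mp hf

namespace HasMellinSum

variable {k : ℕ} {f f' : ℕ → ℝ → ℝ} {g g' : ℂ → ℂ}

lemma congr (h : HasMellinSum k f g) (hf : ∀ a t, 0 < a → 0 < t → f a t = f' a t) :
    HasMellinSum k f' g where
  convergent s h1 h2 n := mellinConvergent_congr
    (fun t ht => by rw [hf (n + 1) t n.succ_pos ht]) (h.convergent s h1 h2 n)
  hasSum s h1 h2 := by
    convert h.hasSum s h1 h2 using 2 with n
    exact mellin_congr (fun t ht => by rw [hf (n + 1) t n.succ_pos ht]) s
  differentiableAt := h.differentiableAt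
  continuousAt := h.continuousAt

lemma add (h : HasMellinSum k f g) (h' : HasMellinSum k f' g') :
    HasMellinSum k (fun a t => f a t + f' a t) (fun s => g s + g' s) where
  convergent s h1 h2 n := by
    simpa using (hasMellin_add (h.convergent s h1 h2 n) (h'.convergent s h1 h2 n)).1
  hasSum s h1 h2 := by
    have := (h.hasSum s h1 h2).add (h'.hasSum s h1 h2)
    rw [← mul_add] at this
    convert this using 2 with n
    simpa using (hasMellin_add (h.convergent s h1 h2 n) (h'.convergent s h1 h2 n)).2
  differentiableAt s h1 h2 h3 := (h.differentiableAt s h1 h2 h3).add (h'.differentiableAt s h1 h2 h3)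
  continuousAt := h.continuousAt.add h'.continuousAt

lemma const_mul (h : HasMellinSum k f g) (c : ℝ) :
    HasMellinSum k (fun a t => c * f a t) (fun s => c * g s) where
  convergent s h1 h2 n := by
    simpa using (h.convergent s h1 h2 n).const_smul (c : ℂ)
  hasSum s h1 h2 := by
    have := (h.hasSum s h1 h2).mul_left (c : ℂ)
    rw [mul_left_comm] at this
    have e : (fun n : ℕ => mellin (fun t => ((c * f (n + 1) t : ℝ) : ℂ)) s) =
        fun n : ℕ => (c : ℂ) * mellin (fun t => (f (n + 1) t : ℂ)) s := by
      funext n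
      simpa using mellin_const_smul (fun t => (f (n + 1) t : ℂ)) s (c : ℂ)
    rw [e]
    exact this
  differentiableAt s h1 h2 h3 := (h.differentiableAt s h1 h2 h3).const_mul _
  continuousAt := continuousAt_const.mul h.continuousAt

lemma zero : HasMellinSum k (fun _ _ => 0) (fun _ => 0) where
  convergent s _ _ _ := by simp [MellinConvergent]
  hasSum s _ _ := by simp [mellin]
  differentiableAt _ _ _ _ := differentiableAt_const _
  continuousAt := continuousAt_const

lemma sum {ι : Type*} {F : ι → ℕ → ℝ → ℝ} {G : ι → ℂ → ℂ} (S : Finset ι)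
    (h : ∀ i ∈ S, HasMellinSum k (F i) (G i)) :
    HasMellinSum k (fun a t => ∑ i ∈ S, F i a t) (fun s => ∑ i ∈ S, G i s) := by
  classical
  induction S using Finset.induction_on with
  | empty => simpa using zero
  | insert i S hi ih =>
    simp only [Finset.sum_insert hi]
    exact (h i (Finset.mem_insert_self i S)).add
      (ih fun j hj => h j (Finset.mem_insert_of_mem hj))

end HasMellinSum

/-- The terms of the asymptotic expansion of `formSeries`. -/
noncomputable def kernelTerm (φ : ℝ → ℝ) (m p a : ℕ) (t : ℝ) : ℝ :=
  t ^ m / t * ((a : ℝ) ^ 2) ^ p * laplaceKernel φ (a ^ 2 * t)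

/-- The factor `Gamma (s + m - 1) / Gamma s`. -/
noncomputable def gammaRatio (m : ℕ) (s : ℂ) : ℂ := (∏ i ∈ Finset.range m, (s - 1 + i)) / (s - 1)

/-- The Dirichlet series attached to a term of the asymptotic expansion. -/
noncomputable def kernelZeta (φ : ℝ → ℝ) (m e : ℕ) (s : ℂ) : ℂ :=
  gammaRatio m s * negMoment φ (s + m - 1) * riemannZeta (2 * (s + e - 1))

lemma Gamma_add_natCast {z : ℂ} (hz : 0 < z.re) (m : ℕ) :
    Complex.Gamma (z + m) = (∏ i ∈ Finset.range m, (z + i)) * Complex.Gamma z := by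
  induction m with
  | zero => simp
  | succ m ih =>
    have h : z + m ≠ 0 := by
      intro h
      have := congrArg Complex.re h
      simp only [Complex.add_re, Complex.natCast_re, Complex.zero_re] at this
      have h2 : (0 : ℝ) ≤ m := m.cast_nonneg
      linarith
    rw [Nat.cast_succ, ← add_assoc, Complex.Gamma_add_one _ h, ih, Finset.prod_range_succ]
    ring

lemma Gamma_mul_gammaRatio {s : ℂ} (hs : 1 < s.re) (m : ℕ) :
    Complex.Gamma s * gammaRatio m s = Complex.Gamma (s + m - 1) := by
  have h1 : 0 < (s - 1).re := by simpa using hs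
  have h0 : s - 1 ≠ 0 := by
    intro h
    rw [h] at h1
    simp at h1
  have h2 := Gamma_add_natCast h1 m
  have h3 := Complex.Gamma_add_one _ h0
  rw [sub_add_cancel] at h3
  rw [show s + m - 1 = s - 1 + m by ring, h2, h3, gammaRatio]
  field_simp

lemma differentiableAt_gammaRatio {s : ℂ} (hs : s ≠ 1) (m : ℕ) :
    DifferentiableAt ℂ (gammaRatio m) s := by
  have hp : DifferentiableAt ℂ (fun s : ℂ => ∏ i ∈ Finset.range m, (s - 1 + i)) s := by
    fun_prop
  have hd : DifferentiableAt ℂ (fun s : ℂ => s - 1) s := by fun_prop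
  exact hp.fun_div hd (sub_ne_zero.mpr hs)

lemma hasMellin_kernelTerm {φ : ℝ → ℝ} (hφ : Continuous φ) (h3 : ∀ θ, 0 ≤ θ → θ ≤ 1 → 3 ≤ φ θ)
    {m p e : ℕ} (hm : m = p + e) {s : ℂ} (hs : 1 < s.re) {a : ℕ} (ha : 0 < a) :
    HasMellin (fun t => (kernelTerm φ m p a t : ℂ)) s
      (Complex.Gamma s * (gammaRatio m s * negMoment φ (s + m - 1)) *
        (1 / (a : ℂ) ^ (2 * (s + e - 1)))) := by
  have ha' : (0 : ℝ) < a := by exact_mod_cast ha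
  have hw : 0 < (s + (m - 1 : ℂ)).re := by
    have h2 : (0 : ℝ) ≤ m := m.cast_nonneg
    simp
    linarith
  have key := hasMellin_laplaceKernel hφ h3 hw (by positivity : 0 < (a : ℝ) ^ 2)
  have e1 : ∀ t : ℝ, 0 < t → (((a : ℝ) ^ 2) ^ p : ℂ) • ((t : ℂ) ^ (m - 1 : ℂ) •
      (laplaceKernel φ (a ^ 2 * t) : ℂ)) = (kernelTerm φ m p a t : ℂ) := by
    intro t ht
    have : (t : ℂ) ≠ 0 := by exact_mod_cast ht.ne'
    rw [kernelTerm, Complex.cpow_sub _ _ this, Complex.cpow_one, Complex.cpow_natCast]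
    push_cast
    simp only [smul_eq_mul]
    ring
  refine ⟨mellinConvergent_congr e1 ((MellinConvergent.cpow_smul.mpr key.1).const_smul _), ?_⟩
  rw [← mellin_congr e1, mellin_const_smul, mellin_cpow_smul, key.2, ← mul_assoc,
    Gamma_mul_gammaRatio hs, smul_eq_mul]
  have e2 : (((a : ℝ) ^ 2) ^ p : ℂ) * (((a : ℝ) ^ 2 : ℝ) : ℂ) ^ (-(s + (m - 1 : ℂ))) =
      1 / (a : ℂ) ^ (2 * (s + e - 1)) := by
    have ha0 : (a : ℂ) ≠ 0 := by exact_mod_cast ha.ne'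
    have h1 : (((a : ℝ) ^ 2 : ℝ) : ℂ) = (a : ℂ) ^ (2 : ℕ) := by push_cast; rfl
    have h2 : ((a : ℂ) ^ (2 : ℕ)) ^ (-(s + (m - 1 : ℂ))) = (a : ℂ) ^ (2 * -(s + (m - 1 : ℂ))) := by
      rw [← Complex.natCast_cpow_natCast_mul]
      norm_num
    rw [h1, h2, one_div, ← Complex.cpow_neg]
    have h3 : (((a : ℝ) ^ 2) ^ p : ℂ) = (a : ℂ) ^ ((2 * p : ℕ) : ℂ) := by
      rw [Complex.cpow_natCast, pow_mul]
      norm_num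
    rw [h3, ← Complex.cpow_add _ _ ha0, hm]
    congr 1
    push_cast
    ring
  rw [mul_comm, mul_assoc, mul_comm _ (_ ^ p), e2, add_sub_assoc s (m : ℂ)]

lemma hasMellinSum_kernelTerm (k : ℕ) {φ : ℝ → ℝ} (hφ : Continuous φ)
    (h3 : ∀ θ, 0 ≤ θ → θ ≤ 1 → 3 ≤ φ θ) (h4 : ∀ θ, 0 ≤ θ → θ ≤ 1 → φ θ ≤ 4)
    {m p e : ℕ} (hm : m = p + e) :
    HasMellinSum k (kernelTerm φ m p) (kernelZeta φ m e) := by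
  have hdiff : ∀ s : ℂ, s ≠ 1 → 2 * (s + e - 1) ≠ 1 → DifferentiableAt ℂ (kernelZeta φ m e) s := by
    intro s h1 h2
    have hm := differentiable_negMoment hφ h3 h4
    have hz : DifferentiableAt ℂ (fun s : ℂ => riemannZeta (2 * (s + e - 1))) s :=
      (differentiableAt_riemannZeta h2).comp s (by fun_prop)
    have hn : DifferentiableAt ℂ (fun s : ℂ => negMoment φ (s + m - 1)) s :=
      (hm _).comp s (by fun_prop)
    exact ((differentiableAt_gammaRatio h1 m).mul hn).mul hz
  refine ⟨fun s h6 _ n => (hasMellin_kernelTerm hφ h3 hm (by linarith) n.succ_pos).1,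
    fun s h6 _ => ?_, fun s _ _ h => ?_, ?_⟩
  · have h1 : 1 < (2 * (s + e - 1)).re := by
      have h2 : (0 : ℝ) ≤ e := e.cast_nonneg
      simp
      linarith
    have h2 : Summable fun n : ℕ => 1 / ((n + 1 : ℕ) : ℂ) ^ (2 * (s + e - 1)) :=
      (summable_nat_add_iff 1 (f := fun n : ℕ => 1 / (n : ℂ) ^ (2 * (s + e - 1)))).mpr
        (Complex.summable_one_div_nat_cpow.mpr h1)
    have h5 := h2.hasSum.mul_left
      (Complex.Gamma s * (gammaRatio m s * negMoment φ (s + m - 1)))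
    have e1 : ∑' n : ℕ, 1 / ((n + 1 : ℕ) : ℂ) ^ (2 * (s + e - 1)) =
        riemannZeta (2 * (s + e - 1)) := by
      rw [zeta_eq_tsum_one_div_nat_add_one_cpow h1]
      push_cast
      rfl
    rw [e1, mul_assoc] at h5
    have e2 : (fun n : ℕ => mellin (fun t => (kernelTerm φ m p (n + 1) t : ℂ)) s) =
        fun n : ℕ => Complex.Gamma s * (gammaRatio m s * negMoment φ (s + m - 1)) *
          (1 / ((n + 1 : ℕ) : ℂ) ^ (2 * (s + e - 1))) := by
      funext n
      exact (hasMellin_kernelTerm hφ h3 hm (by linarith) n.succ_pos).2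
    rw [e2, kernelZeta]
    exact h5
  · refine hdiff s ?_ ?_
    · rintro rfl
      simp at h
    · intro h'
      have := congrArg Complex.im h'
      simp at this
      linarith
  · refine (hdiff _ ?_ ?_).continuousAt
    · intro h
      have := congrArg Complex.re h
      have h2 : (0 : ℝ) ≤ k := k.cast_nonneg
      simp at this
      linarith
    · intro h
      have h2 : (2 * (-k + e - 1) : ℤ) = 1 := by exact_mod_cast h
      omega

lemma laplaceKernel_const (c τ : ℝ) : laplaceKernel (fun _ => c) τ = Real.exp (-(c * τ)) := by
  simp [laplaceKernel]

lemma laplaceKernel_four_sub_sq (τ : ℝ) : laplaceKernel (fun θ => 4 - θ ^ 2) τ =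
    Real.exp (-(4 * τ)) * ∫ θ in (0 : ℝ)..1, Real.exp (τ * θ ^ 2) := by
  rw [laplaceKernel, ← intervalIntegral.integral_const_mul]
  congr 1
  funext θ
  rw [← Real.exp_add]
  ring_nf

lemma integral_exp_mul_sq (a : ℕ) (t : ℝ) : ∫ x in (0 : ℝ)..a, Real.exp (t * x ^ 2) =
    a * ∫ θ in (0 : ℝ)..1, Real.exp (a ^ 2 * t * θ ^ 2) := by
  have := intervalIntegral.mul_integral_comp_mul_left (a := 0) (b := 1)
    (f := fun x => Real.exp (t * x ^ 2)) (a : ℝ)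
  rw [mul_zero, mul_one] at this
  rw [← this]
  congr! 4
  ring_nf

/-- The coefficients of the terms of `formMain` coming from the Euler-Maclaurin corrections. -/
noncomputable def correctionCoeff (i j l : ℕ) : ℝ :=
  1 / 2 * (cothCoeff i * 4 ^ i) * (bernoulli (2 * (j + 1)) / (2 * (j + 1)).factorial : ℝ) *
    (gaussOddPoly j).coeff l

lemma formMain_eq_sum_kernelTerm (I a : ℕ) (t : ℝ) (ha : 0 < a) (ht : 0 < t) : formMain I a t =
    ∑ i ∈ Finset.range (I + 1),
      (1 / 2 * (cothCoeff i * 4 ^ i) * kernelTerm (fun θ => 4 - θ ^ 2) (2 * i) i a t +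
        ∑ j ∈ Finset.range (I + 1), ∑ l ∈ Finset.range ((gaussOddPoly j).natDegree + 1),
          correctionCoeff i j l * kernelTerm (fun _ => 3) (2 * i + j + l + 1) (i + l) a t) +
      -1 / 6 * kernelTerm (fun _ => 3) 1 0 a t := by
  have ha0 : (a : ℝ) ≠ 0 := by positivity
  have e1 : Real.exp (-(4 * (a : ℝ) ^ 2) * t) = Real.exp (-(4 * (a ^ 2 * t))) := by
    congr 1; ring
  have e3 : Real.exp (-(3 * (a : ℝ) ^ 2) * t) = Real.exp (-(3 * (a ^ 2 * t))) := by
    congr 1; ring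
  have e4 : Real.exp (-(3 * ((a : ℝ) ^ 2 * t))) =
      Real.exp (-(4 * (a ^ 2 * t))) * Real.exp (t * a ^ 2) := by
    rw [← Real.exp_add]; congr 1; ring
  rw [formMain, cothMain, Finset.mul_sum, Finset.mul_sum, Finset.sum_mul, sub_eq_add_neg]
  congr 1
  · refine Finset.sum_congr rfl fun i _ => ?_
    have hp : (2 * (a : ℝ) * t) ^ (2 * i) = 4 ^ i * (a ^ 2) ^ i * t ^ (2 * i) := by
      rw [mul_pow, mul_pow, pow_mul, pow_mul (a : ℝ)]; norm_num
    rw [thetaMain, mul_add, Finset.mul_sum]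
    congr 1
    · rw [kernelTerm, laplaceKernel_four_sub_sq, integral_exp_mul_sq, e1, hp]
      field_simp
      ring
    · refine Finset.sum_congr rfl fun j _ => ?_
      rw [Polynomial.eval_eq_sum_range]
      simp only [Finset.mul_sum, Finset.sum_mul]
      refine Finset.sum_congr rfl fun l _ => ?_
      rw [kernelTerm, laplaceKernel_const, e1, e4, hp, correctionCoeff]
      field_simp
      ring
  · rw [kernelTerm, laplaceKernel_const, e3]
    field_simp

/-- The Dirichlet series attached to `formMain`. -/
noncomputable def mainZeta (I : ℕ) (s : ℂ) : ℂ :=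
  ∑ i ∈ Finset.range (I + 1),
    (((1 / 2 * (cothCoeff i * 4 ^ i) : ℝ) : ℂ) * kernelZeta (fun θ => 4 - θ ^ 2) (2 * i) i s +
      ∑ j ∈ Finset.range (I + 1), ∑ l ∈ Finset.range ((gaussOddPoly j).natDegree + 1),
        (correctionCoeff i j l : ℂ) * kernelZeta (fun _ => 3) (2 * i + j + l + 1) (i + j + 1) s) +
    ((-1 / 6 : ℝ) : ℂ) * kernelZeta (fun _ => 3) 1 1 s

lemma hasMellinSum_formMain (k I : ℕ) : HasMellinSum k (formMain I) (mainZeta I) := by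
  have h3 : ∀ {m p e : ℕ}, m = p + e →
      HasMellinSum k (kernelTerm (fun _ => 3) m p) (kernelZeta (fun _ => 3) m e) := fun hm =>
    hasMellinSum_kernelTerm k continuous_const (fun _ _ _ => le_rfl)
      (fun _ _ _ => by norm_num) hm
  have h4 : ∀ {m p e : ℕ}, m = p + e → HasMellinSum k (kernelTerm (fun θ => 4 - θ ^ 2) m p)
      (kernelZeta (fun θ => 4 - θ ^ 2) m e) := fun hm =>
    hasMellinSum_kernelTerm k (by fun_prop) (fun _ _ _ => by nlinarith)
      (fun _ _ _ => by nlinarith) hm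
  refine HasMellinSum.congr (f := fun a t => ∑ i ∈ Finset.range (I + 1),
      (1 / 2 * (cothCoeff i * 4 ^ i) * kernelTerm (fun θ => 4 - θ ^ 2) (2 * i) i a t +
        ∑ j ∈ Finset.range (I + 1), ∑ l ∈ Finset.range ((gaussOddPoly j).natDegree + 1),
          correctionCoeff i j l * kernelTerm (fun _ => 3) (2 * i + j + l + 1) (i + l) a t) +
      -1 / 6 * kernelTerm (fun _ => 3) 1 0 a t) ?_
    fun a t ha ht => (formMain_eq_sum_kernelTerm I a t ha ht).symm
  refine HasMellinSum.add (HasMellinSum.sum _ fun i _ => ?_) ((h3 (zero_add 1).symm).const_mul (-1 / 6))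
  refine HasMellinSum.add ((h4 (by ring)).const_mul _) (HasMellinSum.sum _ fun j _ => ?_)
  exact HasMellinSum.sum _ fun l _ => (h3 (by ring)).const_mul _

lemma continuous_thetaMain (J a : ℕ) : Continuous (thetaMain J a) := by
  have h : Continuous fun t : ℝ => ∫ x in (0 : ℝ)..a, Real.exp (t * x ^ 2) :=
    intervalIntegral.continuous_parametric_intervalIntegral_of_continuous'
      (f := fun t x => Real.exp (t * x ^ 2)) (by simp only [Function.uncurry_def]; fun_prop) 0 a
  unfold thetaMain
  fun_prop

lemma kernelZeta_neg_natCast_eq_zero (φ : ℝ → ℝ) {m e k : ℕ} (h : e ≤ k ∨ k + 2 ≤ m) :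
    kernelZeta φ m e (-k) = 0 := by
  rcases h with h | h
  · obtain ⟨n, rfl⟩ := Nat.exists_eq_add_of_le h
    have : (2 * (-((e + n : ℕ) : ℂ) + e - 1)) = -2 * ((n : ℂ) + 1) := by push_cast; ring
    rw [kernelZeta, this, riemannZeta_neg_two_mul_nat_add_one, mul_zero]
  · have : ∏ i ∈ Finset.range m, (-(k : ℂ) - 1 + i) = 0 :=
      Finset.prod_eq_zero (Finset.mem_range.mpr (by omega : k + 1 < m)) (by push_cast; ring)
    rw [kernelZeta, gammaRatio, this]
    simp

lemma prod_range_neg_sub_one_add (k : ℕ) :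
    ∏ i ∈ Finset.range (k + 1), (-(k : ℂ) - 1 + i) = (-1) ^ (k + 1) * (k + 1).factorial := by
  rw [← Finset.prod_range_reflect, ← Finset.prod_range_add_one_eq_factorial, Nat.cast_prod,
    Finset.prod_congr rfl (g := fun i : ℕ => (-1 : ℂ) * ((i + 1 : ℕ) : ℂ)), Finset.prod_mul_distrib]
  · simp
  · intro i hi
    have : i ≤ k := Nat.lt_succ_iff.mp (Finset.mem_range.mp hi)
    rw [show k + 1 - 1 - i = k - i by omega]
    push_cast [this]
    ring

lemma kernelZeta_neg_natCast (φ : ℝ → ℝ) (k : ℕ) :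
    kernelZeta φ (k + 1) (k + 1) (-k) = -((-1) ^ k * k.factorial) / 2 := by
  have h1 : negMoment φ 0 = 1 := by simp [negMoment]
  have h2 : -(k : ℂ) - 1 ≠ 0 := by
    rw [← neg_add', neg_ne_zero]
    exact_mod_cast k.succ_ne_zero
  rw [kernelZeta, gammaRatio, prod_range_neg_sub_one_add]
  have e1 : -(k : ℂ) + ((k + 1 : ℕ) : ℂ) - 1 = 0 := by push_cast; ring
  rw [e1, mul_zero, riemannZeta_zero, h1, Nat.factorial_succ, mul_one]
  push_cast
  field_simp
  ring

lemma mainZeta_neg_natCast (k : ℕ) {I : ℕ} (hI : k ≤ I) : mainZeta I (-k) =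
    -((-1) ^ k * (bernoulli (2 * (k + 1)) : ℂ)) / (4 * (k + 1)) + if k = 0 then 1 / 12 else 0 := by
  rw [mainZeta]
  congr 1
  · rw [Finset.sum_eq_single 0]
    · rw [kernelZeta_neg_natCast_eq_zero _ (Or.inl (Nat.zero_le k)), mul_zero, zero_add,
        Finset.sum_eq_single k, Finset.sum_eq_single 0]
      · rw [show 2 * 0 + k + 0 + 1 = k + 1 by omega,
          kernelZeta_neg_natCast, correctionCoeff, cothCoeff_zero, (coeff_zero_gaussPoly k).2]
        have h1 : ((2 * (k + 1)).factorial : ℂ) ≠ 0 := by exact_mod_cast Nat.factorial_ne_zero _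
        have h2 : (k.factorial : ℂ) ≠ 0 := by exact_mod_cast Nat.factorial_ne_zero _
        have h3 : (k : ℂ) + 1 ≠ 0 := by exact_mod_cast k.succ_ne_zero
        rw [Nat.factorial_succ k]
        push_cast
        field_simp
        norm_num
        ring
      · intro l _ hl
        rw [kernelZeta_neg_natCast_eq_zero _ (by omega), mul_zero]
      · simp
      · intro j _ hj
        refine Finset.sum_eq_zero fun l _ => ?_
        rw [kernelZeta_neg_natCast_eq_zero _ (by omega), mul_zero]
      · intro h
        exact absurd (Finset.mem_range.mpr (by omega)) h
    · intro i _ hi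
      rw [kernelZeta_neg_natCast_eq_zero _ (by omega), mul_zero, zero_add]
      refine Finset.sum_eq_zero fun j _ => Finset.sum_eq_zero fun l _ => ?_
      rw [kernelZeta_neg_natCast_eq_zero _ (by omega), mul_zero]
    · simp
  · split_ifs with h
    · subst h
      rw [kernelZeta_neg_natCast]
      norm_num
    · rw [kernelZeta_neg_natCast_eq_zero _ (by omega), mul_zero]

section Remainder

variable {f : ℝ → ℝ} {C : ℝ} {I a : ℕ}

lemma bounds_of_abs_le_pow_mul_exp (hC : 0 ≤ C) (ha : 0 < a)
    (h : ∀ t, 0 < t → |f t| ≤ C * (t ^ I * Real.exp (-(a ^ 2 * t)))) :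
    ((fun t => (f t : ℂ)) =O[Filter.atTop] fun t => Real.exp (-(1 / 2) * t)) ∧
      (fun t => (f t : ℂ)) =O[nhdsWithin 0 (Set.Ioi 0)] fun t => t ^ (-(-(I : ℝ))) := by
  have ha1 : (1 : ℝ) ≤ (a : ℝ) ^ 2 := one_le_pow₀ (by exact_mod_cast ha)
  constructor
  · refine Asymptotics.IsBigO.of_bound (C * (2 ^ I * I.factorial)) ?_
    filter_upwards [Filter.eventually_gt_atTop 0] with t ht
    rw [Complex.norm_real, Real.norm_eq_abs, Real.norm_eq_abs, Real.abs_exp, mul_assoc]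
    refine (h t ht).trans (mul_le_mul_of_nonneg_left ?_ hC)
    have h1 := pow_le_factorial_mul_exp (by positivity : 0 ≤ t / 2) I
    have h2 : Real.exp (-(a ^ 2 * t)) ≤ Real.exp (-t) := by
      apply Real.exp_le_exp.mpr
      nlinarith
    calc t ^ I * Real.exp (-(a ^ 2 * t)) = 2 ^ I * (t / 2) ^ I * Real.exp (-(a ^ 2 * t)) := by
          rw [← mul_pow, mul_div_cancel₀ t two_ne_zero]
      _ ≤ 2 ^ I * (I.factorial * Real.exp (t / 2)) * Real.exp (-t) := by gcongr
      _ = 2 ^ I * I.factorial * (Real.exp (t / 2) * Real.exp (-t)) := by ring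
      _ = _ := by rw [← Real.exp_add]; ring_nf
  · refine Asymptotics.IsBigO.of_bound C ?_
    filter_upwards [self_mem_nhdsWithin] with t ht
    have ht0 : (0 : ℝ) < t := ht
    rw [Complex.norm_real, Real.norm_eq_abs, neg_neg, Real.rpow_natCast,
      Real.norm_of_nonneg (by positivity)]
    refine (h t ht0).trans (mul_le_mul_of_nonneg_left ?_ hC)
    have : Real.exp (-(a ^ 2 * t)) ≤ 1 := Real.exp_le_one_iff.mpr (by
      have : 0 ≤ (a : ℝ) ^ 2 * t := by positivity
      linarith)
    exact mul_le_of_le_one_right (by positivity) this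

lemma norm_mellin_le_of_abs_le_pow_mul_exp (ha : 0 < a)
    (h : ∀ t, 0 < t → |f t| ≤ C * (t ^ I * Real.exp (-(a ^ 2 * t)))) {s : ℂ}
    (hs : 0 < s.re + I) : ‖mellin (fun t => (f t : ℂ)) s‖ ≤
      C * ((1 / (a : ℝ) ^ 2) ^ (s.re + I) * Real.Gamma (s.re + I)) := by
  have ha1 : (0 : ℝ) < (a : ℝ) ^ 2 := by positivity
  rw [← Real.integral_rpow_mul_exp_neg_mul_Ioi hs ha1, ← MeasureTheory.integral_const_mul, mellin]
  refine MeasureTheory.norm_integral_le_of_norm_le ?_ ?_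
  · have := integrableOn_rpow_mul_exp_neg_mul_rpow (p := 1) (s := s.re + I - 1) (b := (a : ℝ) ^ 2)
      (by linarith) one_pos ha1
    simp only [Real.rpow_one, neg_mul] at this
    exact this.const_mul C
  · refine (MeasureTheory.ae_restrict_iff' measurableSet_Ioi).mpr
      (Filter.Eventually.of_forall fun t ht => ?_)
    have ht0 : (0 : ℝ) < t := ht
    rw [norm_smul, Complex.norm_cpow_eq_rpow_re_of_pos ht0, Complex.norm_real, Real.norm_eq_abs]
    have e : t ^ (s.re + I - 1) = t ^ (s - 1).re * t ^ I := by
      rw [← Real.rpow_natCast, ← Real.rpow_add ht0, Complex.sub_re, Complex.one_re]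
      ring_nf
    rw [e]
    refine (mul_le_mul_of_nonneg_left (h t ht0) (by positivity)).trans (le_of_eq (by ring))

end Remainder

lemma hasMellinSum_of_abs_le {f : ℕ → ℝ → ℝ} {C : ℝ} {I k : ℕ} (hC : 0 ≤ C) (hI : k + 2 ≤ I)
    (hcont : ∀ a, 0 < a → ContinuousOn (f a) (Set.Ioi 0))
    (h : ∀ a t, 0 < a → 0 < t → |f a t| ≤ C * (t ^ I * Real.exp (-(a ^ 2 * t)))) :
    HasMellinSum k f
      (fun s => (Complex.Gamma s)⁻¹ * ∑' n : ℕ, mellin (fun t => (f (n + 1) t : ℂ)) s) := by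
  set U : Set ℂ := {s | -(k + 1 : ℝ) < s.re ∧ s.re < 10} with hU
  have hUo : IsOpen U := (isOpen_lt continuous_const Complex.continuous_re).inter
    (isOpen_lt Complex.continuous_re continuous_const)
  have hI' : (k : ℝ) + 2 ≤ I := by exact_mod_cast hI
  have hloc : ∀ a, 0 < a →
      MeasureTheory.LocallyIntegrableOn (fun t => (f a t : ℂ)) (Set.Ioi 0) := fun a ha =>
    (Complex.continuous_ofReal.comp_continuousOn (hcont a ha)).locallyIntegrableOn
      measurableSet_Ioi
  have hdiff : ∀ n : ℕ, ∀ s ∈ U, DifferentiableAt ℂ (mellin (fun t => (f (n + 1) t : ℂ))) s := by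
    intro n s hs
    have hb := bounds_of_abs_le_pow_mul_exp hC n.succ_pos fun t ht => h (n + 1) t n.succ_pos ht
    exact mellin_differentiableAt_of_isBigO_rpow_exp (by norm_num) (hloc _ n.succ_pos) hb.1 hb.2
      (by have := hs.1; linarith)
  have hconv : ∀ n : ℕ, ∀ s ∈ U, MellinConvergent (fun t => (f (n + 1) t : ℂ)) s := by
    intro n s hs
    have hb := bounds_of_abs_le_pow_mul_exp hC n.succ_pos fun t ht => h (n + 1) t n.succ_pos ht
    exact mellinConvergent_of_isBigO_rpow_exp (by norm_num) (hloc _ n.succ_pos) hb.1 hb.2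
      (by have := hs.1; linarith)
  obtain ⟨G, hG⟩ := isCompact_Icc.exists_bound_of_continuousOn (s := Set.Icc (1 : ℝ) (10 + I))
    (f := Real.Gamma) fun x hx => (Real.differentiableAt_Gamma fun m hm => by
      have h1 := hx.1
      have h2 : (0 : ℝ) ≤ m := m.cast_nonneg
      linarith).continuousAt.continuousWithinAt
  have hbound : ∀ n : ℕ, ∀ s ∈ U, ‖mellin (fun t => (f (n + 1) t : ℂ)) s‖ ≤
      C * G * (1 / ((n + 1 : ℕ) : ℝ) ^ 2) := by
    intro n s hs
    have h1 : 1 ≤ s.re + I := by have := hs.1; linarith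
    have h2 : s.re + I ≤ 10 + I := by have := hs.2; linarith
    refine (norm_mellin_le_of_abs_le_pow_mul_exp n.succ_pos
      (fun t ht => h (n + 1) t n.succ_pos ht) (by linarith)).trans ?_
    have h3 : (1 / ((n + 1 : ℕ) : ℝ) ^ 2) ^ (s.re + I) ≤ 1 / ((n + 1 : ℕ) : ℝ) ^ 2 := by
      conv_rhs => rw [← Real.rpow_one (1 / ((n + 1 : ℕ) : ℝ) ^ 2)]
      refine Real.rpow_le_rpow_of_exponent_ge (by positivity) ?_ h1
      rw [div_le_one (by positivity)]
      exact one_le_pow₀ (by exact_mod_cast n.succ_pos)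
    have h4 : Real.Gamma (s.re + I) ≤ G := (le_abs_self _).trans (hG _ ⟨h1, h2⟩)
    rw [mul_assoc, mul_comm G]
    have h5 : 0 ≤ Real.Gamma (s.re + I) := (Real.Gamma_pos_of_pos (by linarith)).le
    gcongr
  have hsum : Summable fun n : ℕ => C * G * (1 / ((n + 1 : ℕ) : ℝ) ^ 2) :=
    (((summable_nat_add_iff 1 (f := fun n : ℕ => 1 / (n : ℝ) ^ 2)).mpr
      (Real.summable_one_div_nat_pow.mpr one_lt_two)).mul_left _)
  have hM : DifferentiableOn ℂ (fun s => ∑' n : ℕ, mellin (fun t => (f (n + 1) t : ℂ)) s) U :=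
    Complex.differentiableOn_tsum_of_summable_norm hsum
      (fun n s hs => (hdiff n s hs).differentiableWithinAt) hUo fun n s hs => hbound n s hs
  have hg : ∀ s ∈ U, DifferentiableAt ℂ (fun s => (Complex.Gamma s)⁻¹ *
      ∑' n : ℕ, mellin (fun t => (f (n + 1) t : ℂ)) s) s := fun s hs =>
    (Complex.differentiable_one_div_Gamma s).mul ((hM s hs).differentiableAt (hUo.mem_nhds hs))
  have hk0 : (0 : ℝ) ≤ k := k.cast_nonneg
  refine ⟨fun s h6 h10 n => hconv n s ⟨by linarith, h10⟩, fun s h6 h10 => ?_,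
    fun s h1 h10 _ => hg s ⟨h1, h10⟩, (hg _ ⟨?_, ?_⟩).continuousAt⟩
  · have hs : s ∈ U := ⟨by linarith, h10⟩
    rw [mul_inv_cancel_left₀ (Complex.Gamma_ne_zero_of_re_pos (by linarith))]
    exact (Summable.of_norm_bounded hsum fun n => hbound n s hs).hasSum
  · simp
  · simp
    linarith

lemma continuousOn_formSeries {a : ℕ} (ha : 0 < a) : ContinuousOn (formSeries a) (Set.Ioi 0) := by
  have h1 : Continuous (thetaSum a) := by
    unfold thetaSum
    fun_prop
  have h2 : ContinuousOn (fun t : ℝ => Real.cosh (2 * a * t) / Real.sinh (2 * a * t))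
      (Set.Ioi 0) := by
    refine ContinuousOn.div (by fun_prop) (by fun_prop) fun t ht => ?_
    have : (0 : ℝ) < t := ht
    exact (Real.sinh_pos_iff.mpr (by positivity)).ne'
  unfold formSeries
  fun_prop

lemma continuousOn_formMain (I : ℕ) {a : ℕ} (ha : 0 < a) :
    ContinuousOn (formMain I a) (Set.Ioi 0) := by
  have h1 := continuous_thetaMain (I + 1) a
  have h2 : ContinuousOn (fun t : ℝ => 1 / (4 * a * t)) (Set.Ioi 0) := by
    refine ContinuousOn.div (by fun_prop) (by fun_prop) fun t ht => ?_
    have : (0 : ℝ) < t := ht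
    positivity
  have h3 : Continuous (cothMain I) := by
    unfold cothMain
    fun_prop
  unfold formMain
  fun_prop

lemma exists_hasMellinSum_formSeries (k : ℕ) : ∃ g : ℂ → ℂ, HasMellinSum k formSeries g ∧
    g (-k) = -((-1) ^ k * (bernoulli (2 * (k + 1)) : ℂ)) / (4 * (k + 1)) +
      if k = 0 then 1 / 12 else 0 := by
  obtain ⟨C, hC, h⟩ := exists_abs_formSeries_sub_le (k + 2)
  have h1 := hasMellinSum_of_abs_le (f := fun a t => formSeries a t - formMain (k + 2) a t) hC le_rfl
    (fun a ha => (continuousOn_formSeries ha).sub (continuousOn_formMain _ ha)) h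
  refine ⟨_, ((hasMellinSum_formMain k (k + 2)).add h1).congr fun a t _ _ => by ring, ?_⟩
  rw [mainZeta_neg_natCast k (by omega), Complex.Gamma_neg_nat_eq_zero]
  simp

theorem eval_continuation_shintaniZetaSeries {Z : ℂ → ℂ}
    (hZhol : ∀ s : ℂ, s ≠ 1 → s ≠ 3 / 2 → DifferentiableAt ℂ Z s)
    (hZser : ∀ s : ℂ, 3 / 2 < s.re → Z s = shintaniZetaSeries 2 s) (k : ℕ) :
    Z (-k) = (4 : ℂ) ^ (-(k : ℂ) - 1) *
      (-((-1) ^ k * (bernoulli (2 * (k + 1)) : ℂ)) / (4 * (k + 1)) +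
        if k = 0 then 1 / 12 else 0) := by
  obtain ⟨g, hg, hgk⟩ := exists_hasMellinSum_formSeries k
  have hZg : ∀ s : ℂ, 6 ≤ s.re → s.re < 10 → Z s = 4 ^ (s - 1) * g s := by
    intro s h6 h10
    have h1 := (Gamma_mul_shintaniZetaSeries_two h6).unique (hg.hasSum s h6 h10)
    rw [← hZser s (by linarith), mul_assoc] at h1
    have h2 := mul_left_cancel₀ (Complex.Gamma_ne_zero_of_re_pos (by linarith)) h1
    rw [← h2, ← mul_assoc, ← Complex.cpow_add _ _ (by norm_num)]
    simp
  set U : Set ℂ := {s | (-(k + 1 : ℝ) < s.re ∧ s.re < 10) ∧ 0 < s.im} with hU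
  have hUo : IsOpen U := ((isOpen_lt continuous_const Complex.continuous_re).inter
    (isOpen_lt Complex.continuous_re continuous_const)).inter
    (isOpen_lt continuous_const Complex.continuous_im)
  have hUc : IsPreconnected U := by
    refine Convex.isPreconnected ?_
    exact ((convex_halfSpace_re_gt _).inter (convex_halfSpace_re_lt _)).inter
      (convex_halfSpace_im_gt _)
  have hk0 : (0 : ℝ) ≤ k := k.cast_nonneg
  have hpow : Differentiable ℂ fun s : ℂ => (4 : ℂ) ^ (s - 1) := fun s => by
    refine DifferentiableAt.const_cpow (by fun_prop) (Or.inl (by norm_num))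
  have hZan : AnalyticOnNhd ℂ Z U := by
    refine DifferentiableOn.analyticOnNhd (fun s hs => ?_) hUo
    have him := hs.2
    refine (hZhol s ?_ ?_).differentiableWithinAt
    · rintro rfl
      simp at him
    · rintro rfl
      norm_num at him
  have hgan : AnalyticOnNhd ℂ (fun s => 4 ^ (s - 1) * g s) U :=
    DifferentiableOn.analyticOnNhd (fun s hs => ((hpow s).mul
      (hg.differentiableAt s hs.1.1 hs.1.2 hs.2)).differentiableWithinAt) hUo
  have hev : Z =ᶠ[nhds (7 + Complex.I)] fun s => 4 ^ (s - 1) * g s := by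
    have hV : IsOpen {s : ℂ | 6 < s.re ∧ s.re < 10} :=
      (isOpen_lt continuous_const Complex.continuous_re).inter
        (isOpen_lt Complex.continuous_re continuous_const)
    filter_upwards [hV.mem_nhds (by constructor <;> norm_num)] with s hs
    exact hZg s hs.1.le hs.2
  have hmem : (7 + Complex.I) ∈ U := by
    refine ⟨⟨?_, ?_⟩, ?_⟩ <;> norm_num
    linarith
  have heq := hZan.eqOn_of_preconnected_of_eventuallyEq hgan hUc hmem hev
  have hZc : ContinuousAt Z (-k) := by
    refine (hZhol _ ?_ ?_).continuousAt
    · intro h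
      have := congrArg Complex.re h
      simp at this
      linarith
    · intro h
      have := congrArg Complex.re h
      norm_num at this
      linarith
  have hpath : Filter.Tendsto (fun y : ℝ => -(k : ℂ) + y * Complex.I) (nhdsWithin 0 (Set.Ioi 0))
      (nhds (-(k : ℂ))) := by
    have : Continuous fun y : ℝ => -(k : ℂ) + y * Complex.I := by fun_prop
    simpa using (this.tendsto 0).mono_left nhdsWithin_le_nhds
  have hlim1 := hZc.tendsto.comp hpath
  have hlim2 := ((hpow (-k)).continuousAt.mul hg.continuousAt).tendsto.comp hpath
  rw [← hgk]
  refine tendsto_nhds_unique hlim1 (hlim2.congr' ?_)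
  filter_upwards [self_mem_nhdsWithin] with y hy
  refine (heq ⟨⟨?_, ?_⟩, ?_⟩).symm
  · simp
  · simp
    linarith
  · simpa using hy

/-- **Siegel.**  Let `Z` be the meromorphic continuation of the Shintani zeta function
`ζ_Sh(L_2^*, s)` (holomorphic away from the possible simple poles `s = 1, 3/2`, and given by
the orbit series for `Re s > 3/2`).  Then `ζ_Sh(L_2^*, 0) = 1/96`, and for `n > 2`,
`ζ_Sh(L_2^*, 2-n) = -(-1)^n·B_{2n-2}/(2^{2n}·(n-1))`. -/
theorem statement8 (Z : ℂ → ℂ)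
    (hZhol : ∀ s : ℂ, s ≠ 1 → s ≠ 3 / 2 → DifferentiableAt ℂ Z s)
    (hZser : ∀ s : ℂ, 3 / 2 < s.re → Z s = shintaniZetaSeries 2 s) :
    Z 0 = 1 / 96 ∧
      ∀ n : ℕ, 2 < n →
        Z (2 - (n : ℂ)) =
          -((-1) ^ n * ((bernoulli' (2 * n - 2) : ℚ) : ℂ)) / (2 ^ (2 * n) * ((n : ℂ) - 1)) := by
  constructor
  · have h := eval_continuation_shintaniZetaSeries hZhol hZser 0
    rw [Nat.cast_zero, neg_zero] at h
    rw [h, zero_sub, Complex.cpow_neg_one]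
    norm_num [bernoulli_two]
  · intro n hn
    obtain ⟨k, rfl⟩ : ∃ k, n = k + 2 := ⟨n - 2, by omega⟩
    have hk : k ≠ 0 := by omega
    have h := eval_continuation_shintaniZetaSeries hZhol hZser k
    have e1 : (2 : ℂ) - ((k + 2 : ℕ) : ℂ) = -k := by push_cast; ring
    have e2 : 2 * (k + 2) - 2 = 2 * (k + 1) := by omega
    have e3 : (4 : ℂ) ^ (-(k : ℂ) - 1) = (4 ^ (k + 1))⁻¹ := by
      rw [← neg_add', Complex.cpow_neg, ← Complex.cpow_natCast]
      push_cast
      rfl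
    have e4 : (2 : ℂ) ^ (2 * (k + 2)) = 4 * 4 ^ (k + 1) := by
      rw [pow_mul, ← pow_succ']; norm_num
    have h3 : (k : ℂ) + 1 ≠ 0 := by exact_mod_cast k.succ_ne_zero
    have e5 : ((k + 2 : ℕ) : ℂ) - 1 = k + 1 := by push_cast; ring
    rw [e1, e2, h, e3, e4, e5, if_neg hk, bernoulli_eq_bernoulli'_of_ne_one (by omega)]
    field_simp
    ring
end

section
/- Let Ψ(g) = J_ρ(g^{-1}, iI_n)^{-1} · ρ((g^{-1}·iI_n + iI_n)/(2i))^{-1} for g ∈ Sp(n,ℝ), where ρ is an irreducible polynomial representation of GL(n,ℂ) with ρ(conj(ᵗg)) = conj(ᵗρ(g)). Then conj(ᵗΨ(g)) = Ψ(g^{-1}) for all g ∈ Sp(n,ℝ). -/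
open Matrix

/-- The bottom blocks of a real matrix with `C * Dᵀ = D * Cᵀ` and `A * Dᵀ - B * Cᵀ = 1` give an
invertible complex matrix `i C + D`. -/
theorem isUnit_det_I_smul_add {m : Type*} [Fintype m] [DecidableEq m] {A B C D : Matrix m m ℝ}
    (hCD : C * Dᵀ = D * Cᵀ) (hAD : A * Dᵀ - B * Cᵀ = 1) :
    IsUnit (C.map ((↑) : ℝ → ℂ) * (Complex.I • 1) + D.map ((↑) : ℝ → ℂ)).det := by
  have hS : (C * Cᵀ + D * Dᵀ).det ≠ 0 := by
    intro h0
    obtain ⟨v, hv, hSv⟩ := exists_mulVec_eq_zero_iff.mpr h0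
    have hsum : (Cᵀ *ᵥ v) ⬝ᵥ (Cᵀ *ᵥ v) + (Dᵀ *ᵥ v) ⬝ᵥ (Dᵀ *ᵥ v) = 0 := by
      have := congrArg (v ⬝ᵥ ·) hSv
      simpa [add_mulVec, ← mulVec_mulVec, dotProduct_mulVec, mulVec_transpose] using this
    have hC : 0 ≤ (Cᵀ *ᵥ v) ⬝ᵥ (Cᵀ *ᵥ v) := Finset.sum_nonneg fun _ _ => mul_self_nonneg _
    have hD : 0 ≤ (Dᵀ *ᵥ v) ⬝ᵥ (Dᵀ *ᵥ v) := Finset.sum_nonneg fun _ _ => mul_self_nonneg _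
    have hC0 : Cᵀ *ᵥ v = 0 := dotProduct_self_eq_zero.mp (by linarith)
    have hD0 : Dᵀ *ᵥ v = 0 := dotProduct_self_eq_zero.mp (by linarith)
    apply hv
    rw [← one_mulVec v, ← hAD, sub_mulVec, ← mulVec_mulVec, ← mulVec_mulVec, hC0, hD0]
    simp
  have hmap (X Y : Matrix m m ℝ) : (X * Y).map ((↑) : ℝ → ℂ) = X.map (↑) * Y.map (↑) :=
    Matrix.map_mul (f := Complex.ofRealHom)
  have hprod : (C.map ((↑) : ℝ → ℂ) * (Complex.I • 1) + D.map ((↑) : ℝ → ℂ)) *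
      (Dᵀ.map ((↑) : ℝ → ℂ) - Complex.I • Cᵀ.map ((↑) : ℝ → ℂ)) =
      (C * Cᵀ + D * Dᵀ).map ((↑) : ℝ → ℂ) := by
    have h := congrArg (fun X => X.map ((↑) : ℝ → ℂ)) hCD
    simp only [hmap] at h
    rw [Matrix.map_add _ Complex.ofReal_add, hmap, hmap]
    simp only [mul_smul_comm, mul_one, add_mul, mul_sub, smul_mul_assoc, h]
    simp only [smul_add, smul_smul, Complex.I_mul_I, neg_smul, one_smul]
    abel
  have hdet : ((C * Cᵀ + D * Dᵀ).map ((↑) : ℝ → ℂ)).det ≠ 0 := by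
    have := (Complex.ofRealHom.map_det (C * Cᵀ + D * Dᵀ)).symm
    intro h0
    exact hS (Complex.ofReal_eq_zero.mp (this.symm.trans h0))
  rw [← hprod, det_mul] at hdet
  exact isUnit_iff_ne_zero.mpr (left_ne_zero_of_mul hdet)

/-- The block relations satisfied by a symplectic matrix. -/
theorem symplecticGroup_toBlocks_relations {m : Type*} [Fintype m] [DecidableEq m]
    {M : Matrix (m ⊕ m) (m ⊕ m) ℝ} (hM : M ∈ symplecticGroup m ℝ) :
    M.toBlocks₂₁ * M.toBlocks₂₂ᵀ = M.toBlocks₂₂ * M.toBlocks₂₁ᵀ ∧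
      M.toBlocks₁₁ * M.toBlocks₂₂ᵀ - M.toBlocks₁₂ * M.toBlocks₂₁ᵀ = 1 := by
  rw [SymplecticGroup.mem_iff, ← fromBlocks_toBlocks M] at hM
  simp only [J, fromBlocks_transpose, fromBlocks_multiply, fromBlocks_inj] at hM
  obtain ⟨-, h12, -, h22⟩ := hM
  simp only [mul_zero, mul_one, mul_neg, zero_add, add_zero, neg_mul] at h12 h22
  constructor
  · exact (sub_eq_zero.mp (by rw [← h22]; abel)).symm
  · rw [← neg_inj, ← h12]; abel

/-- The blocks of the inverse of a symplectic matrix. -/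
theorem symplecticGroup_coe_inv_eq_fromBlocks {m : Type*} [Fintype m] [DecidableEq m]
    (g : symplecticGroup m ℝ) :
    (g⁻¹).1 = fromBlocks g.1.toBlocks₂₂ᵀ (-g.1.toBlocks₁₂ᵀ)
      (-g.1.toBlocks₂₁ᵀ) g.1.toBlocks₁₁ᵀ := by
  have h : (g⁻¹).1 = -J m ℝ * g.1ᵀ * J m ℝ := SymplecticGroup.coe_inv g
  rw [h]
  conv_lhs => rw [← fromBlocks_toBlocks g.1]
  simp [J, fromBlocks_transpose, fromBlocks_multiply, fromBlocks_neg]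

/-- **Godement's spherical function identity.**  Let `ρ` be a (polynomial, multiplicative)
representation of `n×n` complex matrices satisfying `ρ(conj ᵗA) = conj ᵗρ(A)`, and for
`g ∈ Sp(n,ℝ)` acting on the Siegel upper half space by `g·Z = (AZ+B)(CZ+D)⁻¹`, with
automorphic factor `J_ρ(g,Z) = ρ(CZ+D)`, set
`Ψ(g) = J_ρ(g⁻¹, iI_n)⁻¹ · ρ((g⁻¹·iI_n + iI_n)/(2i))⁻¹`.
Then `conj(ᵗΨ(g)) = Ψ(g⁻¹)` for all `g ∈ Sp(n,ℝ)`. -/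
theorem statement16 (n d : ℕ)
    (ρ : Matrix (Fin n) (Fin n) ℂ →* Matrix (Fin d) (Fin d) ℂ)
    (hstar : ∀ A : Matrix (Fin n) (Fin n) ℂ, ρ Aᴴ = (ρ A)ᴴ)
    (g : Matrix.symplecticGroup (Fin n) ℝ) :
    let toC : Matrix (Fin n ⊕ Fin n) (Fin n ⊕ Fin n) ℝ → Matrix (Fin n ⊕ Fin n) (Fin n ⊕ Fin n) ℂ :=
      fun M => M.map ((↑) : ℝ → ℂ)
    let act : Matrix.symplecticGroup (Fin n) ℝ → Matrix (Fin n) (Fin n) ℂ →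
        Matrix (Fin n) (Fin n) ℂ := fun h Z =>
      ((toC h.1).toBlocks₁₁ * Z + (toC h.1).toBlocks₁₂) *
        ((toC h.1).toBlocks₂₁ * Z + (toC h.1).toBlocks₂₂)⁻¹
    let Jρ : Matrix.symplecticGroup (Fin n) ℝ → Matrix (Fin n) (Fin n) ℂ →
        Matrix (Fin d) (Fin d) ℂ := fun h Z =>
      ρ ((toC h.1).toBlocks₂₁ * Z + (toC h.1).toBlocks₂₂)
    let Ψ : Matrix.symplecticGroup (Fin n) ℝ → Matrix (Fin d) (Fin d) ℂ := fun h =>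
      (Jρ h⁻¹ (Complex.I • 1))⁻¹ *
        (ρ ((2 * Complex.I)⁻¹ • (act h⁻¹ (Complex.I • 1) + Complex.I • 1)))⁻¹
    (Ψ g)ᴴ = Ψ g⁻¹ := by
  intro toC act Jρ Ψ
  let K : symplecticGroup (Fin n) ℝ → Matrix (Fin n) (Fin n) ℂ := fun h =>
    (2 * Complex.I)⁻¹ • ((toC h.1).toBlocks₁₁ * (Complex.I • 1) + (toC h.1).toBlocks₁₂ +
      Complex.I • ((toC h.1).toBlocks₂₁ * (Complex.I • 1) + (toC h.1).toBlocks₂₂))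
  have hΨ (h : symplecticGroup (Fin n) ℝ) : Ψ h = (ρ (K h⁻¹))⁻¹ := by
    obtain ⟨hCD, hAD⟩ := symplecticGroup_toBlocks_relations (h⁻¹).2
    have hu : IsUnit ((toC (h⁻¹).1).toBlocks₂₁ * (Complex.I • 1) + (toC (h⁻¹).1).toBlocks₂₂).det :=
      isUnit_det_I_smul_add hCD hAD
    simp only [Ψ, Jρ, act]
    rw [← Matrix.mul_inv_rev, ← map_mul, smul_mul_assoc, add_mul, nonsing_inv_mul_cancel_right _ _ hu,
      smul_mul_assoc, one_mul]
  have hK : (K g⁻¹)ᴴ = K g := by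
    simp only [K, toC, symplecticGroup_coe_inv_eq_fromBlocks g]
    ext i j
    simp [toBlocks₁₁, toBlocks₁₂, toBlocks₂₁, toBlocks₂₂]
    ring
  rw [hΨ, hΨ, inv_inv, conjTranspose_nonsing_inv, ← hstar, hK]
end
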